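/- Let F be a finite simple graph with e(F) > 0 and m = |F| vertices, and let 0 < p ≤ 1. Let α_1,…,α_m be positive reals with Σ_{i=1}^m α_i ≤ 1 and (α_1,…,α_m) ≠ (1/m,…,1/m). Then the property P̃(F;α_1,…,α_m) and the stronger property P^u(F;α_1,…,α_m) are both p-quasi-random properties of graph sequences. -/

import Mathlib

open Filter Finset Asymptotics MeasureTheory

/-- `labCount F G U` is the number of injective graph homomorphisms `φ : F → G`
with `φ i ∈ U i` for every vertex `i` of `F` (the quantity `N(F,G;U₁,…,U_m)`). -/
noncomputable def labCount {m : ℕ} {β : Type} [Fintype β]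
    (F : SimpleGraph (Fin m)) (G : SimpleGraph β) (U : Fin m → Finset β) : ℕ :=
  Nat.card {φ : Fin m → β //
    Function.Injective φ ∧ (∀ i j, F.Adj i j → G.Adj (φ i) (φ j)) ∧ ∀ i, φ i ∈ U i}

/-- `totalCount F G` is the total number of injective graph homomorphisms `F → G`,
the quantity `N(F,G)`. -/
noncomputable def totalCount {m : ℕ} {β : Type} [Fintype β]
    (F : SimpleGraph (Fin m)) (G : SimpleGraph β) : ℕ :=
  Nat.card {φ : Fin m → β //
    Function.Injective φ ∧ ∀ i j, F.Adj i j → G.Adj (φ i) (φ j)}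

/-- `symCount F G U` is `Ñ(F,G;U₁,…,U_m) = (1/m!) ∑_σ N(F,G;U_{σ(1)},…,U_{σ(m)})`. -/
noncomputable def symCount {m : ℕ} {β : Type} [Fintype β]
    (F : SimpleGraph (Fin m)) (G : SimpleGraph β) (U : Fin m → Finset β) : ℝ :=
  ((m.factorial : ℝ))⁻¹ * ∑ σ : Equiv.Perm (Fin m), (labCount F G (fun i => U (σ i)) : ℝ)

/-- `numEdges F` is `e(F)`, the number of edges of `F`. -/
noncomputable def numEdges {m : ℕ} (F : SimpleGraph (Fin m)) : ℕ := Nat.card F.edgeSet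

/-- A sequence of graphs `G n` on vertex sets `Fin (V n)` is `p`-quasi-random if, for every
finite simple graph `F`, `N(F,G_n) = p^(e F) |G_n|^(|F|) + o(|G_n|^(|F|))`. -/
def IsQuasirandom (p : ℝ) (V : ℕ → ℕ) (G : ∀ n, SimpleGraph (Fin (V n))) : Prop :=
  ∀ (m : ℕ) (F : SimpleGraph (Fin m)),
    (fun n => (totalCount F (G n) : ℝ) - p ^ numEdges F * (V n : ℝ) ^ m)
      =o[atTop] (fun n => (V n : ℝ) ^ m)

/-- The property `P(F;α₁,…,α_m)`: `N(F,G_n;U₁,…,U_m) = p^(e F) ∏ |U_i| + o(|G_n|^m)`,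
uniformly over all pairwise disjoint `U₁,…,U_m ⊆ V(G_n)` with `|U_i| = ⌊α_i |G_n|⌋`. -/
def SatisfiesP {m : ℕ} (F : SimpleGraph (Fin m)) (p : ℝ) (α : Fin m → ℝ)
    (V : ℕ → ℕ) (G : ∀ n, SimpleGraph (Fin (V n))) : Prop :=
  ∃ ε : ℕ → ℝ, Tendsto ε atTop (nhds 0) ∧
    ∀ (n : ℕ) (U : Fin m → Finset (Fin (V n))),
      Pairwise (fun i j => Disjoint (U i) (U j)) →
      (∀ i, (U i).card = ⌊α i * (V n : ℝ)⌋₊) →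
      |(labCount F (G n) U : ℝ) - p ^ numEdges F * ∏ i, ((U i).card : ℝ)|
        ≤ ε n * (V n : ℝ) ^ m

/-- The property `P̃(F;α₁,…,α_m)`: as `SatisfiesP` but with the symmetrized count `Ñ`. -/
def SatisfiesPt {m : ℕ} (F : SimpleGraph (Fin m)) (p : ℝ) (α : Fin m → ℝ)
    (V : ℕ → ℕ) (G : ∀ n, SimpleGraph (Fin (V n))) : Prop :=
  ∃ ε : ℕ → ℝ, Tendsto ε atTop (nhds 0) ∧
    ∀ (n : ℕ) (U : Fin m → Finset (Fin (V n))),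
      Pairwise (fun i j => Disjoint (U i) (U j)) →
      (∀ i, (U i).card = ⌊α i * (V n : ℝ)⌋₊) →
      |symCount F (G n) U - p ^ numEdges F * ∏ i, ((U i).card : ℝ)|
        ≤ ε n * (V n : ℝ) ^ m

/-- The property `Pᵘ(F;α₁,…,α_m)`: `P` holds for every labelling of `F`. -/
def SatisfiesPu {m : ℕ} (F : SimpleGraph (Fin m)) (p : ℝ) (α : Fin m → ℝ)
    (V : ℕ → ℕ) (G : ∀ n, SimpleGraph (Fin (V n))) : Prop :=
  ∀ σ : Equiv.Perm (Fin m), SatisfiesP (SimpleGraph.map σ.toEmbedding F) p α V G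


/-- The bilinear form `∑ x, ∑ y, f x * K x y * g y` of the kernel `K`. -/
noncomputable def bilSum {β : Type*} [Fintype β] (K : β → β → ℝ) (f g : β → ℝ) : ℝ :=
  ∑ x, ∑ y, f x * K x y * g y

theorem prod_update_update {ι β : Type*} [Fintype ι] [DecidableEq ι] {k l : ι} (hkl : k ≠ l)
    (w : ι → β → ℝ) (φ : ι → β) (x y : β) :
    ∏ i, w i (Function.update (Function.update φ k x) l y i)
      = w k x * w l y * ∏ i ∈ (univ.erase k).erase l, w i (φ i) := by
  rw [← Finset.mul_prod_erase univ _ (mem_univ k),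
    ← Finset.mul_prod_erase (univ.erase k) _ (mem_erase.2 ⟨hkl.symm, mem_univ l⟩), mul_assoc]
  congr 1
  · simp [hkl]
  congr 1
  · simp
  refine Finset.prod_congr rfl fun i hi => ?_
  simp only [mem_erase] at hi
  simp [hi.1, hi.2.1]

section Sums

variable {ι β : Type*} [Fintype ι] [DecidableEq ι] [Fintype β]

/-- The weighted homomorphism sum over all maps `φ : ι → β`. -/
noncomputable def homSum (E : Finset (ι × ι)) (W : β → β → ℝ) (w : ι → β → ℝ) : ℝ :=
  ∑ φ : ι → β, (∏ e ∈ E, W (φ e.1) (φ e.2)) * ∏ i, w i (φ i)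

/-- The bilinear form of the kernel `K` is bounded by `c` on `[0, u] × [0, v]`. -/
def CutBound (K : β → β → ℝ) (u v : β → ℝ) (c : ℝ) : Prop :=
  ∀ f g : β → ℝ, 0 ≤ f → f ≤ u → 0 ≤ g → g ≤ v → |bilSum K f g| ≤ c

theorem sum_sum_update (k : ι) (H : (ι → β) → ℝ) :
    ∑ φ : ι → β, ∑ x, H (Function.update φ k x) = Fintype.card β * ∑ φ, H φ := by
  classical
  let e : ((ι → β) × β) ≃ ((ι → β) × β) :=
    { toFun := fun q => (Function.update q.1 k q.2, q.1 k)
      invFun := fun q => (Function.update q.1 k q.2, q.1 k)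
      left_inv := fun q => by simp
      right_inv := fun q => by simp }
  have h1 : ∑ q : (ι → β) × β, H (e q).1 = ∑ q : (ι → β) × β, H q.1 :=
    Equiv.sum_comp e (fun q => H q.1)
  rw [Fintype.sum_prod_type, Fintype.sum_prod_type] at h1
  simp only [Finset.sum_const, Finset.card_univ, nsmul_eq_mul] at h1
  rw [Finset.mul_sum, ← h1]
  rfl

theorem sum_prod_eq_prod_sum (w : ι → β → ℝ) :
    ∑ φ : ι → β, ∏ i, w i (φ i) = ∏ i, ∑ x, w i x := by
  classical
  rw [Finset.prod_univ_sum, Fintype.piFinset_univ]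

theorem abs_sum_edge_le {W K : β → β → ℝ} (hW0 : ∀ x y, 0 ≤ W x y) (hW1 : ∀ x y, W x y ≤ 1)
    {w u : ι → β → ℝ} (hw : ∀ i x, 0 ≤ w i x) (hwu : ∀ i x, w i x ≤ u i x)
    {k l : ι} (hkl : k ≠ l) (E : Finset (ι × ι))
    (hE : ∀ e ∈ E, (e.1 = k ∨ e.2 = k) → e.1 ≠ l ∧ e.2 ≠ l)
    {c : ℝ} (hc : 0 ≤ c) (hK : CutBound K (u k) (u l) (c * ((∑ x, u k x) * ∑ x, u l x))) :
    |∑ φ : ι → β, K (φ k) (φ l) * ((∏ e ∈ E, W (φ e.1) (φ e.2)) * ∏ i, w i (φ i))|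
      ≤ c * ∏ i, ∑ x, u i x := by
  classical
  rcases isEmpty_or_nonempty β with hβ | hβ
  · have : IsEmpty (ι → β) := ⟨fun φ => hβ.false (φ k)⟩
    simp only [Finset.univ_eq_empty, Finset.sum_empty, abs_zero]
    exact mul_nonneg hc (Finset.prod_nonneg fun i _ => le_refl _)
  have hu : ∀ i x, 0 ≤ u i x := fun i x => (hw i x).trans (hwu i x)
  set N : ℝ := (Fintype.card β : ℝ) with hN
  have hNpos : 0 < N := by rw [hN]; exact_mod_cast Fintype.card_pos
  set H : (ι → β) → ℝ := fun φ =>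
    K (φ k) (φ l) * ((∏ e ∈ E, W (φ e.1) (φ e.2)) * ∏ i, w i (φ i)) with hH
  have key : ∀ φ : ι → β,
      |∑ x, ∑ y, H (Function.update (Function.update φ k x) l y)|
        ≤ c * ∑ x, ∑ y, ∏ i, u i (Function.update (Function.update φ k x) l y i) := by
    intro φ
    set f : β → ℝ := fun x => w k x * ∏ e ∈ E with (e.1 = k ∨ e.2 = k),
      W (Function.update φ k x e.1) (Function.update φ k x e.2) with hf
    set g : β → ℝ := fun y => w l y * ∏ e ∈ E with ¬ (e.1 = k ∨ e.2 = k),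
      W (Function.update φ l y e.1) (Function.update φ l y e.2) with hg
    set C : ℝ := ∏ i ∈ (univ.erase k).erase l, w i (φ i) with hC
    have hC0 : 0 ≤ C := Finset.prod_nonneg fun i _ => hw _ _
    have e1 : ∀ x y, H (Function.update (Function.update φ k x) l y)
        = C * (f x * K x y * g y) := by
      intro x y
      simp only [hH]
      rw [prod_update_update hkl]
      rw [← Finset.prod_filter_mul_prod_filter_not E (fun e => e.1 = k ∨ e.2 = k)]
      have a1 : ∏ e ∈ E with (e.1 = k ∨ e.2 = k),
          W (Function.update (Function.update φ k x) l y e.1)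
            (Function.update (Function.update φ k x) l y e.2)
          = ∏ e ∈ E with (e.1 = k ∨ e.2 = k),
            W (Function.update φ k x e.1) (Function.update φ k x e.2) := by
        refine Finset.prod_congr rfl fun e he => ?_
        rw [mem_filter] at he
        have := hE e he.1 he.2
        rw [Function.update_of_ne this.1, Function.update_of_ne this.2]
      have a2 : ∏ e ∈ E with ¬ (e.1 = k ∨ e.2 = k),
          W (Function.update (Function.update φ k x) l y e.1)
            (Function.update (Function.update φ k x) l y e.2)
          = ∏ e ∈ E with ¬ (e.1 = k ∨ e.2 = k),
            W (Function.update φ l y e.1) (Function.update φ l y e.2) := by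
        refine Finset.prod_congr rfl fun e he => ?_
        rw [mem_filter] at he
        have := he.2
        push Not at this
        rw [Function.update_comm hkl, Function.update_of_ne this.1, Function.update_of_ne this.2]
      rw [a1, a2]
      have a3 : Function.update (Function.update φ k x) l y k = x := by simp [hkl]
      have a4 : Function.update (Function.update φ k x) l y l = y := by simp
      rw [a3, a4, hf, hg, hC]
      ring
    have e2 : ∑ x, ∑ y, H (Function.update (Function.update φ k x) l y)
        = C * ∑ x, ∑ y, f x * K x y * g y := by
      simp only [e1, ← Finset.mul_sum]
    have prod01 : ∀ (S : Finset (ι × ι)) (ψ : ι → β),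
        0 ≤ ∏ e ∈ S, W (ψ e.1) (ψ e.2) ∧ ∏ e ∈ S, W (ψ e.1) (ψ e.2) ≤ 1 := fun S ψ =>
      ⟨Finset.prod_nonneg fun e _ => hW0 _ _,
        Finset.prod_le_one (fun e _ => hW0 _ _) fun e _ => hW1 _ _⟩
    have hb := hK f g (fun x => mul_nonneg (hw _ _) (prod01 _ _).1)
      (fun x => (mul_le_of_le_one_right (hw _ _) (prod01 _ _).2).trans (hwu _ _))
      (fun x => mul_nonneg (hw _ _) (prod01 _ _).1)
      (fun x => (mul_le_of_le_one_right (hw _ _) (prod01 _ _).2).trans (hwu _ _))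
    have e3 : ∑ x, ∑ y, ∏ i, u i (Function.update (Function.update φ k x) l y i)
        = (∑ x, u k x) * (∑ x, u l x) * ∏ i ∈ (univ.erase k).erase l, u i (φ i) := by
      simp only [prod_update_update hkl]
      rw [Finset.sum_mul_sum, Finset.sum_mul]
      simp only [Finset.sum_mul]
    rw [e2, e3, abs_mul, abs_of_nonneg hC0]
    have hCu : C ≤ ∏ i ∈ (univ.erase k).erase l, u i (φ i) :=
      Finset.prod_le_prod (fun i _ => hw _ _) fun i _ => hwu _ _
    have hs : 0 ≤ (∑ x, u k x) * ∑ x, u l x :=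
      mul_nonneg (Finset.sum_nonneg fun _ _ => hu _ _) (Finset.sum_nonneg fun _ _ => hu _ _)
    calc C * |∑ x, ∑ y, f x * K x y * g y|
        ≤ C * (c * ((∑ x, u k x) * ∑ x, u l x)) := mul_le_mul_of_nonneg_left hb hC0
      _ ≤ (∏ i ∈ (univ.erase k).erase l, u i (φ i)) * (c * ((∑ x, u k x) * ∑ x, u l x)) :=
          mul_le_mul_of_nonneg_right hCu (mul_nonneg hc hs)
      _ = _ := by ring
  have two : ∀ H' : (ι → β) → ℝ,
      ∑ φ : ι → β, ∑ x, ∑ y, H' (Function.update (Function.update φ k x) l y)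
        = N * (N * ∑ φ, H' φ) := by
    intro H'
    rw [sum_sum_update k (fun φ => ∑ y, H' (Function.update φ l y)), sum_sum_update l H']
  have h1 : N * (N * |∑ φ, H φ|) ≤ N * (N * (c * ∏ i, ∑ x, u i x)) := by
    calc N * (N * |∑ φ, H φ|) = |N * (N * ∑ φ, H φ)| := by
          rw [abs_mul, abs_mul, abs_of_pos hNpos]
      _ = |∑ φ : ι → β, ∑ x, ∑ y, H (Function.update (Function.update φ k x) l y)| := by
          rw [two]
      _ ≤ ∑ φ : ι → β, c * ∑ x, ∑ y, ∏ i, u i (Function.update (Function.update φ k x) l y i) :=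
          (Finset.abs_sum_le_sum_abs _ _).trans (Finset.sum_le_sum fun φ _ => key φ)
      _ = _ := by
          rw [← Finset.mul_sum, two (fun ψ => ∏ i, u i (ψ i)), sum_prod_eq_prod_sum]
          ring
  exact le_of_mul_le_mul_left (le_of_mul_le_mul_left h1 hNpos) hNpos

end Sums

/-- Counting lemma: edges along which `W` is close to the constant `p` in cut norm may be
replaced by `p` in a homomorphism sum. -/
theorem abs_homSum_sub_le {m : ℕ} {β : Type*} [Fintype β] {W : β → β → ℝ}
    (hW0 : ∀ x y, 0 ≤ W x y) (hW1 : ∀ x y, W x y ≤ 1)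
    {w u : Fin m → β → ℝ} (hw : ∀ i x, 0 ≤ w i x) (hwu : ∀ i x, w i x ≤ u i x)
    {p : ℝ} (hp0 : 0 ≤ p) (hp1 : p ≤ 1) {c : ℝ} (hc : 0 ≤ c)
    (E₂ E₁ : Finset (Fin m × Fin m)) (hd : Disjoint E₁ E₂)
    (h₁ : ∀ e ∈ E₁, e.1 < e.2) (h₂ : ∀ e ∈ E₂, e.1 < e.2)
    (hK : ∀ e ∈ E₁, CutBound (fun x y => W x y - p) (u e.1) (u e.2)
      (c * ((∑ x, u e.1 x) * ∑ x, u e.2 x))) :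
    |homSum (E₁ ∪ E₂) W w - p ^ E₁.card * homSum E₂ W w|
      ≤ E₁.card * (c * ∏ i, ∑ x, u i x) := by
  classical
  induction E₁ using Finset.induction_on with
  | empty => simp
  | insert e E₁ he ih =>
    have hd' := Finset.disjoint_insert_left.1 hd
    have ih' := ih hd'.2 (fun e he => h₁ e (mem_insert_of_mem he))
      (fun e he => hK e (mem_insert_of_mem he))
    have hnot : e ∉ E₁ ∪ E₂ := by simp [he, hd'.1]
    have hlt := h₁ e (mem_insert_self _ _)
    have hall : ∀ e' ∈ E₁ ∪ E₂, e'.1 < e'.2 := by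
      intro e' he'
      rcases mem_union.1 he' with h | h
      · exact h₁ e' (mem_insert_of_mem h)
      · exact h₂ e' h
    have h1 := abs_sum_edge_le hW0 hW1 hw hwu hlt.ne (E₁ ∪ E₂)
      (by
        intro e' he' hk
        have hne : e' ≠ e := fun h => hnot (h ▸ he')
        have hl := hall e' he'
        rcases hk with hk | hk
        · refine ⟨by rw [hk]; exact hlt.ne, fun h => hne (Prod.ext hk h)⟩
        · refine ⟨fun h => ?_, by rw [hk]; exact hlt.ne⟩
          rw [h, hk] at hl
          exact absurd hl hlt.asymm) hc (hK e (mem_insert_self _ _))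
    have h2 : homSum (insert e E₁ ∪ E₂) W w - p * homSum (E₁ ∪ E₂) W w
        = ∑ φ : Fin m → β, (W (φ e.1) (φ e.2) - p) *
          ((∏ e ∈ E₁ ∪ E₂, W (φ e.1) (φ e.2)) * ∏ i, w i (φ i)) := by
      rw [homSum, homSum, Finset.insert_union, Finset.mul_sum, ← Finset.sum_sub_distrib]
      refine Finset.sum_congr rfl fun φ _ => ?_
      rw [Finset.prod_insert hnot]
      ring
    rw [← h2] at h1
    have h3 : homSum (insert e E₁ ∪ E₂) W w - p ^ (insert e E₁).card * homSum E₂ W w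
        = (homSum (insert e E₁ ∪ E₂) W w - p * homSum (E₁ ∪ E₂) W w)
          + p * (homSum (E₁ ∪ E₂) W w - p ^ E₁.card * homSum E₂ W w) := by
      rw [Finset.card_insert_of_notMem he]; ring
    rw [h3, Finset.card_insert_of_notMem he]
    refine (abs_add_le _ _).trans ?_
    rw [abs_mul, abs_of_nonneg hp0]
    have h4 : p * |homSum (E₁ ∪ E₂) W w - p ^ E₁.card * homSum E₂ W w|
        ≤ |homSum (E₁ ∪ E₂) W w - p ^ E₁.card * homSum E₂ W w| :=
      mul_le_of_le_one_left (abs_nonneg _) hp1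
    push_cast
    linarith

section Bilinear

variable {β : Type*} [Fintype β] (K : β → β → ℝ)

theorem bilSum_add_left (f f' g : β → ℝ) :
    bilSum K (f + f') g = bilSum K f g + bilSum K f' g := by
  simp only [bilSum, Pi.add_apply, add_mul, Finset.sum_add_distrib]

theorem bilSum_smul_left (c : ℝ) (f g : β → ℝ) :
    bilSum K (c • f) g = c * bilSum K f g := by
  simp only [bilSum, Pi.smul_apply, smul_eq_mul, Finset.mul_sum, mul_assoc]

theorem bilSum_comm {K : β → β → ℝ} (hK : ∀ x y, K x y = K y x) (f g : β → ℝ) :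
    bilSum K f g = bilSum K g f := by
  rw [bilSum, bilSum, Finset.sum_comm]
  refine Finset.sum_congr rfl fun x _ => Finset.sum_congr rfl fun y _ => ?_
  rw [hK y x]; ring

theorem bilSum_comb {K : β → β → ℝ} (hK : ∀ x y, K x y = K y x) (c d : ℝ) (f g : β → ℝ) :
    bilSum K (c • f + d • g) (c • f + d • g)
      = c ^ 2 * bilSum K f f + 2 * c * d * bilSum K f g + d ^ 2 * bilSum K g g := by
  rw [bilSum_add_left, bilSum_smul_left, bilSum_smul_left, bilSum_comm hK f,
    bilSum_comm hK g, bilSum_add_left, bilSum_smul_left, bilSum_smul_left, bilSum_add_left,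
    bilSum_smul_left, bilSum_smul_left, bilSum_comm hK g f]
  ring

theorem bilSum_sub_right (f g g' : β → ℝ) :
    bilSum K f (g - g') = bilSum K f g - bilSum K f g' := by
  simp only [bilSum, Pi.sub_apply, mul_sub, Finset.sum_sub_distrib]

theorem bilSum_sub_const (a : ℝ) (f g : β → ℝ) :
    bilSum (fun x y => K x y - a) f g = bilSum K f g - a * ((∑ x, f x) * ∑ y, g y) := by
  rw [Finset.sum_mul_sum]
  simp only [bilSum, Finset.mul_sum]
  rw [← Finset.sum_sub_distrib]
  refine Finset.sum_congr rfl fun x _ => ?_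
  rw [← Finset.sum_sub_distrib]
  exact Finset.sum_congr rfl fun y _ => by ring

theorem abs_bilSum_le {K : β → β → ℝ} (hK : ∀ x y, |K x y| ≤ 1) {f g u v : β → ℝ}
    (hf : ∀ x, |f x| ≤ u x) (hg : ∀ x, |g x| ≤ v x) :
    |bilSum K f g| ≤ (∑ x, u x) * ∑ y, v y := by
  rw [Finset.sum_mul_sum, bilSum]
  refine (Finset.abs_sum_le_sum_abs _ _).trans (Finset.sum_le_sum fun x _ => ?_)
  refine (Finset.abs_sum_le_sum_abs _ _).trans (Finset.sum_le_sum fun y _ => ?_)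
  rw [abs_mul, abs_mul]
  have h1 := hf x
  have h2 := hg y
  have h3 := hK x y
  have := abs_nonneg (f x)
  calc |f x| * |K x y| * |g y| ≤ u x * 1 * v y := by have := this.trans h1; gcongr
    _ = u x * v y := by ring

theorem bilSum_nonneg {K : β → β → ℝ} (hK : ∀ x y, 0 ≤ K x y) {f g : β → ℝ}
    (hf : 0 ≤ f) (hg : 0 ≤ g) : 0 ≤ bilSum K f g :=
  Finset.sum_nonneg fun x _ => Finset.sum_nonneg fun y _ =>
    mul_nonneg (mul_nonneg (hf x) (hK x y)) (hg y)

end Bilinear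

section Regular

variable {β : Type} [Fintype β]

/-- Below any weight there is one, smaller by a bounded factor only, on which the functional `ρ`
cannot be decreased substantially by passing to a further large subweight. -/
theorem exists_subweight_almost_min (ρ : (β → ℝ) → ℝ) (hρ : ∀ w, 0 ≤ w → 0 ≤ ρ w)
    {η γ : ℝ} (hη : 0 ≤ η) (hγ0 : 0 < γ) (hγ1 : γ ≤ 1) (k : ℕ) :
    ∀ s : β → ℝ, 0 ≤ s → ρ s ≤ k * η → ∃ s' : β → ℝ, 0 ≤ s' ∧ s' ≤ s ∧
      γ ^ k * ∑ x, s x ≤ ∑ x, s' x ∧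
      ∀ w : β → ℝ, 0 ≤ w → w ≤ s' → γ * ∑ x, s' x ≤ ∑ x, w x → ρ s' - η ≤ ρ w := by
  induction k with
  | zero =>
    intro s hs h
    refine ⟨s, hs, le_rfl, by simp, fun w hw _ _ => ?_⟩
    have := hρ w hw
    have := hρ s hs
    rw [Nat.cast_zero, zero_mul] at h
    linarith
  | succ k ih =>
    intro s hs h
    by_cases hgood : ∀ w : β → ℝ, 0 ≤ w → w ≤ s → γ * ∑ x, s x ≤ ∑ x, w x → ρ s - η ≤ ρ w
    · refine ⟨s, hs, le_rfl, ?_, hgood⟩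
      exact mul_le_of_le_one_left (Finset.sum_nonneg fun x _ => hs x) (pow_le_one₀ hγ0.le hγ1)
    · push Not at hgood
      obtain ⟨w, hw0, hws, hγw, hlt⟩ := hgood
      obtain ⟨s', h0, h1, h2, h3⟩ := ih w hw0 (by push_cast at h; linarith)
      refine ⟨s', h0, h1.trans hws, ?_, h3⟩
      calc γ ^ (k + 1) * ∑ x, s x = γ ^ k * (γ * ∑ x, s x) := by ring
        _ ≤ γ ^ k * ∑ x, w x := by gcongr
        _ ≤ _ := h2

theorem exists_subweight_form_ge {W : β → β → ℝ} (hW0 : ∀ x y, 0 ≤ W x y)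
    (hW1 : ∀ x y, W x y ≤ 1) {η : ℝ} (hη0 : 0 < η) (hη1 : η ≤ 1) {s : β → ℝ} (hs : 0 ≤ s)
    (hpos : 0 < ∑ x, s x) :
    ∃ s' : β → ℝ, 0 ≤ s' ∧ s' ≤ s ∧ η ^ ⌈1 / η⌉₊ * ∑ x, s x ≤ ∑ x, s' x ∧
      ∃ a : ℝ, 0 ≤ a ∧ a ≤ 1 ∧ bilSum (fun x y => W x y - a) s' s' = 0 ∧
        ∀ w : β → ℝ, 0 ≤ w → w ≤ s' →
          -(η * (∑ x, s' x) ^ 2) ≤ bilSum (fun x y => W x y - a) w w := by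
  set ρ : (β → ℝ) → ℝ := fun w => bilSum W w w / (∑ x, w x) ^ 2 with hρ
  have hρ0 : ∀ w, 0 ≤ w → 0 ≤ ρ w := fun w hw =>
    div_nonneg (bilSum_nonneg hW0 hw hw) (sq_nonneg _)
  have hρ1 : ∀ w, 0 ≤ w → ρ w ≤ 1 := fun w hw => by
    refine div_le_one_of_le₀ ?_ (sq_nonneg _)
    rw [sq]
    refine (le_abs_self _).trans (abs_bilSum_le (fun x y => ?_) ?_ ?_)
    · rw [abs_of_nonneg (hW0 x y)]; exact hW1 x y
    · exact fun x => (abs_of_nonneg (hw x)).le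
    · exact fun x => (abs_of_nonneg (hw x)).le
  obtain ⟨s', h0, h1, h2, h3⟩ := exists_subweight_almost_min ρ hρ0 hη0.le hη0 hη1 ⌈1 / η⌉₊ s hs
    ((hρ1 s hs).trans (by
      have := Nat.le_ceil (1 / η)
      rwa [div_le_iff₀ hη0] at this))
  have hpos' : 0 < ∑ x, s' x := lt_of_lt_of_le (by positivity) h2
  refine ⟨s', h0, h1, h2, ρ s', hρ0 s' h0, hρ1 s' h0, ?_, fun w hw hws => ?_⟩
  · rw [bilSum_sub_const, hρ]
    field_simp
    ring
  · rw [bilSum_sub_const]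
    have hw' : 0 ≤ ∑ x, w x := Finset.sum_nonneg fun x _ => hw x
    have hle : ∑ x, w x ≤ ∑ x, s' x := Finset.sum_le_sum fun x _ => hws x
    rcases le_or_gt (η * ∑ x, s' x) (∑ x, w x) with hc | hc
    · have h4 := h3 w hw hws hc
      have hwpos : 0 < ∑ x, w x := lt_of_lt_of_le (by positivity) hc
      have h5 : bilSum W w w = ρ w * (∑ x, w x) ^ 2 := by
        rw [hρ]; field_simp
      have h6 : (∑ x, w x) ^ 2 ≤ (∑ x, s' x) ^ 2 := by gcongr
      rw [h5]
      nlinarith [mul_le_mul_of_nonneg_right h4 (sq_nonneg (∑ x, w x)),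
        mul_le_mul_of_nonneg_left h6 hη0.le]
    · have h5 := bilSum_nonneg hW0 hw hw
      have h6 : (∑ x, w x) ^ 2 ≤ (η * ∑ x, s' x) ^ 2 := by gcongr
      have h7 : ρ s' * (∑ x, w x) ^ 2 ≤ (∑ x, w x) ^ 2 :=
        mul_le_of_le_one_left (sq_nonneg _) (hρ1 s' h0)
      have h8 : (η * ∑ x, s' x) ^ 2 ≤ η * (∑ x, s' x) ^ 2 := by
        rw [mul_pow]
        have : η ^ 2 ≤ η := by nlinarith
        gcongr
      rw [← sq]
      linarith

theorem form_almost_psd {K : β → β → ℝ} (hK : ∀ x y, K x y = K y x) (hK1 : ∀ x y, |K x y| ≤ 1)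
    {s : β → ℝ} {θ : ℝ} (hθ0 : 0 < θ) (hθ1 : θ ≤ 1) (hss : bilSum K s s = 0)
    (hge : ∀ w : β → ℝ, 0 ≤ w → w ≤ s → -(θ ^ 2 * (∑ x, s x) ^ 2) ≤ bilSum K w w) :
    (∀ w : β → ℝ, 0 ≤ w → w ≤ s → |bilSum K s w| ≤ θ * (∑ x, s x) ^ 2) ∧
      ∀ v : β → ℝ, (∀ x, |v x| ≤ s x) → -(8 * θ * (∑ x, s x) ^ 2) ≤ bilSum K v v := by
  set σ := ∑ x, s x with hσ
  have up : ∀ w : β → ℝ, 0 ≤ w → w ≤ s → bilSum K s w ≤ θ * σ ^ 2 := by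
    intro w hw hws
    have hww : bilSum K w w ≤ σ ^ 2 := by
      rw [sq]
      refine (le_abs_self _).trans (abs_bilSum_le hK1 ?_ ?_) <;>
      exact fun x => by rw [abs_of_nonneg (hw x)]; exact hws x
    have h1 := hge ((1 : ℝ) • s + (-θ) • w)
      (fun x => by
        have := hw x; have := hws x
        simp only [Pi.zero_apply, Pi.add_apply, Pi.smul_apply, smul_eq_mul] at *
        nlinarith)
      (fun x => by
        have := hw x
        simp only [Pi.zero_apply, Pi.add_apply, Pi.smul_apply, smul_eq_mul] at *
        nlinarith)
    rw [bilSum_comb hK, hss] at h1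
    have h2 : θ ^ 2 * bilSum K w w ≤ θ ^ 2 * σ ^ 2 := by gcongr
    have h3 : θ * bilSum K s w ≤ θ * (θ * σ ^ 2) := by nlinarith
    exact le_of_mul_le_mul_left h3 hθ0
  have both : ∀ w : β → ℝ, 0 ≤ w → w ≤ s → |bilSum K s w| ≤ θ * σ ^ 2 := by
    intro w hw hws
    have h1 := up (s - w) (sub_nonneg.2 hws) (by simpa using hw)
    rw [bilSum_sub_right, hss] at h1
    exact abs_le.2 ⟨by linarith, up w hw hws⟩
  refine ⟨both, fun v hv => ?_⟩
  have hf0 : 0 ≤ (1 / 2 : ℝ) • s + (1 / 2 : ℝ) • v := fun x => by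
    have := abs_le.1 (hv x)
    simp only [Pi.zero_apply, Pi.add_apply, Pi.smul_apply, smul_eq_mul]
    linarith
  have hfs : (1 / 2 : ℝ) • s + (1 / 2 : ℝ) • v ≤ s := fun x => by
    have := abs_le.1 (hv x)
    simp only [Pi.add_apply, Pi.smul_apply, smul_eq_mul]
    linarith
  have h1 := hge _ hf0 hfs
  have h2 := (abs_le.1 (both _ hf0 hfs)).2
  rw [bilSum_comm hK s, bilSum_add_left, bilSum_smul_left, bilSum_smul_left, hss,
    bilSum_comm hK v] at h2
  rw [bilSum_comb hK, hss] at h1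
  have h3 : θ ^ 2 * σ ^ 2 ≤ θ * σ ^ 2 := by
    have : θ ^ 2 ≤ θ := by nlinarith
    gcongr
  nlinarith

theorem exists_subweight_almost_psd {θ : ℝ} (hθ0 : 0 < θ) (hθ1 : θ ≤ 1) :
    ∃ κ : ℝ, 0 < κ ∧ κ ≤ 1 ∧ ∀ (β : Type) [Fintype β] (W : β → β → ℝ), (∀ x y, W x y = W y x) →
      (∀ x y, 0 ≤ W x y) → (∀ x y, W x y ≤ 1) → ∀ s : β → ℝ, 0 ≤ s → 0 < ∑ x, s x →
      ∃ s' : β → ℝ, 0 ≤ s' ∧ s' ≤ s ∧ κ * ∑ x, s x ≤ ∑ x, s' x ∧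
      ∃ a : ℝ, 0 ≤ a ∧ a ≤ 1 ∧ bilSum (fun x y => W x y - a) s' s' = 0 ∧
        (∀ w : β → ℝ, 0 ≤ w → w ≤ s' →
          |bilSum (fun x y => W x y - a) s' w| ≤ θ * (∑ x, s' x) ^ 2) ∧
        ∀ v : β → ℝ, (∀ x, |v x| ≤ s' x) →
          -(8 * θ * (∑ x, s' x) ^ 2) ≤ bilSum (fun x y => W x y - a) v v := by
  have h0 : 0 < θ ^ 2 := by positivity
  have h1 : θ ^ 2 ≤ 1 := pow_le_one₀ hθ0.le hθ1
  refine ⟨(θ ^ 2) ^ ⌈1 / θ ^ 2⌉₊, by positivity, pow_le_one₀ h0.le h1, ?_⟩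
  intro β _ W hsym hW0 hW1 s hs hpos
  obtain ⟨s', hs0, hss, hk, a, ha0, ha1, hz, hge⟩ :=
    exists_subweight_form_ge hW0 hW1 h0 h1 hs hpos
  refine ⟨s', hs0, hss, hk, a, ha0, ha1, hz, ?_⟩
  refine form_almost_psd (fun x y => by rw [hsym x y]) (fun x y => ?_) hθ0 hθ1 hz hge
  have := hW0 x y
  have := hW1 x y
  exact abs_le.2 ⟨by linarith, by linarith⟩

/-- Every weight has a subweight, smaller by a bounded factor only, on which the symmetric kernel
`W` is close to a constant in cut norm. -/
theorem exists_subweight_cutBound {ε : ℝ} (hε : 0 < ε) :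
    ∃ κ : ℝ, 0 < κ ∧ κ ≤ 1 ∧ ∀ (β : Type) [Fintype β] (W : β → β → ℝ), (∀ x y, W x y = W y x) →
      (∀ x y, 0 ≤ W x y) → (∀ x y, W x y ≤ 1) → ∀ s : β → ℝ, 0 ≤ s → 0 < ∑ x, s x →
      ∃ s' : β → ℝ, 0 ≤ s' ∧ s' ≤ s ∧ κ * ∑ x, s x ≤ ∑ x, s' x ∧
      ∃ a : ℝ, 0 ≤ a ∧ a ≤ 1 ∧
        CutBound (fun x y => W x y - a) s' s' (ε * ((∑ x, s' x) * ∑ x, s' x)) := by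
  set θ : ℝ := min 1 (ε / 33) with hθ
  have hθ0 : 0 < θ := lt_min one_pos (by positivity)
  have hθ1 : θ ≤ 1 := min_le_left _ _
  have hθε : 33 * θ ≤ ε := by have : θ ≤ ε / 33 := min_le_right _ _; linarith
  obtain ⟨κ₂, hκ₂, hκ₂1, H₂⟩ := exists_subweight_almost_psd hθ0 hθ1
  have hθ₁ : θ * κ₂ ^ 2 ≤ 1 := mul_le_one₀ hθ1 (by positivity) (pow_le_one₀ hκ₂.le hκ₂1)
  obtain ⟨κ₁, hκ₁, hκ₁1, H₁⟩ := exists_subweight_almost_psd (θ := θ * κ₂ ^ 2) (by positivity) hθ₁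
  refine ⟨κ₂ * κ₁, by positivity, mul_le_one₀ hκ₂1 hκ₁.le hκ₁1, ?_⟩
  intro β _ W hsym hW0 hW1 s hs hpos
  obtain ⟨s₁, hs₁, hss₁, hk₁, a₁, ha₁0, ha₁1, -, -, psd₁⟩ := H₁ β W hsym hW0 hW1 s hs hpos
  have hpos₁ : 0 < ∑ x, s₁ x := lt_of_lt_of_le (by positivity) hk₁
  obtain ⟨t, ht, hts, hkt, b, hb0, hb1, hz, hmar, psd₂⟩ :=
    H₂ β (fun x y => 1 - W x y) (fun x y => by rw [hsym]) (fun x y => by linarith [hW1 x y])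
      (fun x y => by linarith [hW0 x y]) s₁ hs₁ hpos₁
  have hpost : 0 < ∑ x, t x := lt_of_lt_of_le (by positivity) hkt
  have hneg : ∀ f g : β → ℝ, bilSum (fun x y => 1 - W x y - b) f g
      = -bilSum (fun x y => W x y - (1 - b)) f g := by
    intro f g
    simp only [bilSum, ← Finset.sum_neg_distrib]
    exact Finset.sum_congr rfl fun x _ => Finset.sum_congr rfl fun y _ => by ring
  simp only [hneg, abs_neg, neg_eq_zero, neg_le_neg_iff] at hz hmar psd₂
  set a := 1 - b with ha
  have hsymK : ∀ x y, W x y - a = W y x - a := fun x y => by rw [hsym]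
  set B := bilSum (fun x y => W x y - a) with hB
  set σ := ∑ x, t x with hσ
  have diag : ∀ w : β → ℝ, 0 ≤ w → w ≤ t → |B w w| ≤ 11 * θ * σ ^ 2 := by
    intro w hw hwt
    set r := (∑ x, w x) / σ with hr
    have hw' : 0 ≤ ∑ x, w x := Finset.sum_nonneg fun x _ => hw x
    have hle : ∑ x, w x ≤ σ := Finset.sum_le_sum fun x _ => hwt x
    have hr0 : 0 ≤ r := div_nonneg hw' hpost.le
    have hr1 : r ≤ 1 := div_le_one_of_le₀ hle hpost.le
    set v : β → ℝ := (1 : ℝ) • w + (-r) • t with hv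
    have hvt : ∀ x, |v x| ≤ t x := by
      intro x
      have h1 := hw x
      have h2 := hwt x
      have h3 := ht x
      simp only [Pi.zero_apply] at h1 h3
      simp only [hv, Pi.add_apply, Pi.smul_apply, smul_eq_mul]
      exact abs_le.2 ⟨by nlinarith, by nlinarith⟩
    have hv0 : ∑ x, v x = 0 := by
      simp only [hv, Pi.add_apply, Pi.smul_apply, smul_eq_mul, Finset.sum_add_distrib,
        ← Finset.mul_sum]
      rw [hr, ← hσ]
      field_simp
      ring
    have h1 := psd₂ v hvt
    have h2 := psd₁ v (fun x => (hvt x).trans (hts x))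
    have h3 : bilSum (fun x y => W x y - a₁) v v = B v v := by
      rw [hB, bilSum_sub_const, bilSum_sub_const, hv0]; ring
    rw [h3] at h2
    have h4 : 8 * (θ * κ₂ ^ 2) * (∑ x, s₁ x) ^ 2 ≤ 8 * θ * σ ^ 2 := by
      have : (κ₂ * ∑ x, s₁ x) ^ 2 ≤ σ ^ 2 := by gcongr
      rw [mul_pow] at this
      nlinarith
    have h5 : B v v = B w w - 2 * r * B t w := by
      rw [hv, hB, bilSum_comb hsymK, ← hB, hz, hB, bilSum_comm hsymK w t]; ring
    have h6 := abs_le.1 (hmar w hw hwt)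
    have h7 : r * B t w ≤ θ * σ ^ 2 := by
      calc r * B t w ≤ r * (θ * σ ^ 2) := by gcongr; exact h6.2
        _ ≤ 1 * (θ * σ ^ 2) := by gcongr
        _ = _ := one_mul _
    have h8 : -(θ * σ ^ 2) ≤ r * B t w := by
      calc -(θ * σ ^ 2) ≤ -(r * (θ * σ ^ 2)) := by
            have : r * (θ * σ ^ 2) ≤ 1 * (θ * σ ^ 2) := by gcongr
            linarith
        _ = r * -(θ * σ ^ 2) := by ring
        _ ≤ r * B t w := by gcongr; exact h6.1
    have h9 : 0 ≤ θ * σ ^ 2 := by positivity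
    exact abs_le.2 ⟨by linarith, by linarith⟩
  refine ⟨t, ht, hts.trans hss₁, ?_, a, by linarith, by linarith, ?_⟩
  · calc κ₂ * κ₁ * ∑ x, s x = κ₂ * (κ₁ * ∑ x, s x) := by ring
      _ ≤ κ₂ * ∑ x, s₁ x := by gcongr
      _ ≤ _ := hkt
  · intro f g hf hft hg hgt
    have h1 := abs_le.1 (diag f hf hft)
    have h2 := abs_le.1 (diag g hg hgt)
    have h3 := abs_le.1 (diag ((1 / 2 : ℝ) • f + (1 / 2 : ℝ) • g)
      (fun x => by
        have := hf x; have := hg x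
        simp only [Pi.zero_apply, Pi.add_apply, Pi.smul_apply, smul_eq_mul] at *
        linarith)
      (fun x => by
        have := hft x; have := hgt x
        simp only [Pi.add_apply, Pi.smul_apply, smul_eq_mul] at *
        linarith))
    rw [hB, bilSum_comb hsymK, ← hB] at h3
    have h4 : 33 * θ * σ ^ 2 ≤ ε * (σ * σ) := by
      rw [← sq]; gcongr
    exact (abs_le.2 ⟨by linarith, by linarith⟩ : |B f g| ≤ 33 * θ * σ ^ 2).trans h4

end Regular
theorem CutBound.mono {β : Type*} [Fintype β] {K : β → β → ℝ} {u v : β → ℝ} {c d : ℝ}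
    (h : CutBound K u v c) (hcd : c ≤ d) : CutBound K u v d :=
  fun f g hf hfu hg hgv => (h f g hf hfu hg hgv).trans hcd

theorem CutBound.symm {β : Type*} [Fintype β] {K : β → β → ℝ} (hK : ∀ x y, K x y = K y x)
    {u v : β → ℝ} {c : ℝ} (h : CutBound K u v c) : CutBound K v u c :=
  fun f g hf hfu hg hgv => by
    rw [bilSum_comm hK]; exact h g f hg hgv hf hfu

theorem abs_sub_mul_pow_le {a b : ℝ} (ha : 0 ≤ a) (hb : 0 ≤ b) (n : ℕ) :
    |a - b| * b ^ n ≤ |a ^ (n + 1) - b ^ (n + 1)| := by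
  rcases le_total a b with h | h
  · have h1 : a ^ n ≤ b ^ n := by gcongr
    have h2 : a ^ (n + 1) ≤ b ^ (n + 1) := by gcongr
    rw [abs_of_nonpos (by linarith), abs_of_nonpos (by linarith), pow_succ, pow_succ]
    nlinarith
  · have h1 : b ^ n ≤ a ^ n := by gcongr
    have h2 : b ^ (n + 1) ≤ a ^ (n + 1) := by gcongr
    rw [abs_of_nonneg (by linarith), abs_of_nonneg (by linarith), pow_succ, pow_succ]
    nlinarith

theorem sum_root_eq {ι β : Type*} [Fintype ι] [DecidableEq ι] [Fintype β] (i : ι) (f : β → ℝ)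
    (h : ι → β → β → ℝ) :
    ∑ φ : ι → β, f (φ i) * ∏ k ∈ univ.erase i, h k (φ i) (φ k)
      = ∑ x, f x * ∏ k ∈ univ.erase i, ∑ y, h k x y := by
  classical
  have h1 : ∀ φ : ι → β, f (φ i) * ∏ k ∈ univ.erase i, h k (φ i) (φ k)
      = ∑ x, f x * ∏ k, (if k = i then (if φ k = x then 1 else 0) else h k x (φ k)) := by
    intro φ
    rw [Finset.sum_eq_single (φ i)]
    · rw [← Finset.mul_prod_erase univ _ (mem_univ i)]
      simp only [if_true, one_mul]
      congr 1
      refine Finset.prod_congr rfl fun k hk => ?_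
      rw [if_neg (ne_of_mem_erase hk)]
    · intro x _ hx
      rw [← Finset.mul_prod_erase univ _ (mem_univ i)]
      simp [hx.symm]
    · simp
  simp only [h1]
  rw [Finset.sum_comm]
  refine Finset.sum_congr rfl fun x _ => ?_
  rw [← Finset.mul_sum,
    sum_prod_eq_prod_sum (fun k y => if k = i then (if y = x then (1 : ℝ) else 0) else h k x y),
    ← Finset.mul_prod_erase univ _ (mem_univ i)]
  simp only [if_true, Finset.sum_ite_eq', mem_univ, one_mul]
  congr 1
  refine Finset.prod_congr rfl fun k hk => ?_
  simp only [if_neg (ne_of_mem_erase hk)]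

section Rooted

variable {m : ℕ} {β : Type} [Fintype β]

/-- The members of `E` that contain the vertex `i`. -/
def edgesAt (E : Finset (Fin m × Fin m)) (i : Fin m) : Finset (Fin m × Fin m) :=
  E.filter fun e => e.1 = i ∨ e.2 = i

theorem homSum_edgesAt {W : β → β → ℝ} (hsym : ∀ x y, W x y = W y x)
    {E : Finset (Fin m × Fin m)} (hE : ∀ e ∈ E, e.1 < e.2) (i : Fin m) {w : Fin m → β → ℝ}
    {g : β → ℝ} (hw : ∀ k ≠ i, w k = g) :
    homSum (edgesAt E i) W w = ∑ x, w i x * ((∑ y, W x y * g y) ^ (edgesAt E i).card *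
      (∑ y, g y) ^ (m - 1 - (edgesAt E i).card)) ∧ (edgesAt E i).card ≤ m - 1 := by
  classical
  set other : Fin m × Fin m → Fin m := fun e => if e.1 = i then e.2 else e.1 with hother
  set S := (edgesAt E i).image other with hS
  have hinj : Set.InjOn other (edgesAt E i : Set (Fin m × Fin m)) := by
    intro e he e' he' h
    simp only [edgesAt, coe_filter, Set.mem_ofPred_eq] at he he'
    have h1 := hE e he.1
    have h2 := hE e' he'.1
    simp only [hother] at h
    apply Prod.ext <;> grind
  have hcard : S.card = (edgesAt E i).card := Finset.card_image_of_injOn hinj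
  have hSi : S ⊆ univ.erase i := by
    intro k hk
    obtain ⟨e, he, rfl⟩ := mem_image.1 hk
    simp only [edgesAt, mem_filter] at he
    have h1 := hE e he.1
    simp only [mem_erase, mem_univ, and_true, hother]
    grind
  have hle : (edgesAt E i).card ≤ m - 1 := by
    rw [← hcard]
    refine (Finset.card_le_card hSi).trans ?_
    simp
  refine ⟨?_, hle⟩
  have h1 : ∀ φ : Fin m → β, (∏ e ∈ edgesAt E i, W (φ e.1) (φ e.2)) * ∏ k, w k (φ k)
      = w i (φ i) * ∏ k ∈ univ.erase i,
        ((if k ∈ S then W (φ i) (φ k) else 1) * g (φ k)) := by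
    intro φ
    have h2 : ∏ e ∈ edgesAt E i, W (φ e.1) (φ e.2) = ∏ k ∈ S, W (φ i) (φ k) := by
      rw [hS, Finset.prod_image hinj]
      refine Finset.prod_congr rfl fun e he => ?_
      simp only [edgesAt, mem_filter] at he
      simp only [hother]
      split_ifs with h
      · rw [h]
      · rw [he.2.resolve_left h, hsym]
    rw [h2, Finset.prod_mul_distrib, Finset.prod_ite_mem,
      Finset.inter_eq_right.2 hSi, ← Finset.mul_prod_erase univ _ (mem_univ i)]
    have h3 : ∏ k ∈ univ.erase i, w k (φ k) = ∏ k ∈ univ.erase i, g (φ k) :=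
      Finset.prod_congr rfl fun k hk => by rw [hw k (ne_of_mem_erase hk)]
    rw [h3]; ring
  rw [homSum]
  simp only [h1]
  rw [sum_root_eq i (w i) (fun k x y => (if k ∈ S then W x y else 1) * g y)]
  refine Finset.sum_congr rfl fun x _ => ?_
  congr 1
  have h4 : ∀ k, ∑ y, (if k ∈ S then W x y else 1) * g y
      = if k ∈ S then ∑ y, W x y * g y else ∑ y, g y := by
    intro k; split_ifs <;> simp
  simp only [h4]
  rw [Finset.prod_ite, Finset.prod_const, Finset.prod_const,
    Finset.filter_mem_eq_inter, Finset.inter_eq_right.2 hSi, hcard]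
  congr 2
  rw [Finset.filter_notMem_eq_sdiff, Finset.card_sdiff_of_subset hSi, hcard]
  simp

/-- The symmetrised weighted count of copies of `E` in `W` deviates from its expected value for
density `p` by at most `c`, for all weights in `[0, 1]`. -/
def SymHomClose (E : Finset (Fin m × Fin m)) (W : β → β → ℝ) (p c : ℝ) : Prop :=
  ∀ w : Fin m → β → ℝ, (∀ i, 0 ≤ w i) → (∀ i, w i ≤ 1) →
    |∑ σ : Equiv.Perm (Fin m), homSum E W (fun i => w (σ i))
      - (m.factorial : ℝ) * (p ^ E.card * ∏ i, ∑ x, w i x)| ≤ c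

variable {W : β → β → ℝ} {E : Finset (Fin m × Fin m)} {p c ε : ℝ} {s : β → ℝ}

theorem abs_sub_le_of_symHomClose (hW0 : ∀ x y, 0 ≤ W x y)
    (hW1 : ∀ x y, W x y ≤ 1) (hE : ∀ e ∈ E, e.1 < e.2) (hEne : E.Nonempty) (hp0 : 0 ≤ p)
    (hstar : SymHomClose E W p c) (hs0 : 0 ≤ s) (hs1 : s ≤ 1) (hε : 0 ≤ ε)
    {a : ℝ} (ha0 : 0 ≤ a) (ha1 : a ≤ 1)
    (hreg : CutBound (fun x y => W x y - a) s s (ε * ((∑ x, s x) * ∑ x, s x))) :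
    |a - p| * p ^ (E.card - 1) * (∑ x, s x) ^ m
      ≤ E.card * ε * (∑ x, s x) ^ m + c := by
  have h1 := hstar (fun _ => s) (fun _ => hs0) (fun _ => hs1)
  have h2 := abs_homSum_sub_le hW0 hW1 (w := fun _ : Fin m => s) (u := fun _ => s)
    (fun _ => hs0) (fun _ _ => le_rfl) ha0 ha1 hε ∅ E (disjoint_empty_right _) hE (by simp)
    (fun _ _ => hreg)
  have h3 : homSum (∅ : Finset (Fin m × Fin m)) W (fun _ => s) = (∑ x, s x) ^ m := by
    simp only [homSum, Finset.prod_empty, one_mul]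
    rw [sum_prod_eq_prod_sum (fun _ : Fin m => s)]
    simp
  rw [h3, union_empty] at h2
  simp only [Finset.sum_const, Finset.card_univ, Fintype.card_perm, Fintype.card_fin,
    nsmul_eq_mul, ← mul_sub, Finset.prod_const] at h1 h2
  set H := homSum E W (fun _ => s)
  set σ := ∑ x, s x
  have hσ : 0 ≤ σ := Finset.sum_nonneg fun x _ => hs0 x
  have hfac : (1 : ℝ) ≤ m.factorial := by exact_mod_cast m.factorial_pos
  have h4 : |H - p ^ E.card * σ ^ m| ≤ c := by
    refine le_trans ?_ h1
    rw [abs_mul, abs_of_nonneg (a := (m.factorial : ℝ)) (by linarith)]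
    exact le_mul_of_one_le_left (abs_nonneg _) hfac
  have h5 : |a ^ E.card - p ^ E.card| * σ ^ m ≤ E.card * (ε * σ ^ m) + c := by
    have h6 : |a ^ E.card - p ^ E.card| * σ ^ m
        = |(H - p ^ E.card * σ ^ m) - (H - a ^ E.card * σ ^ m)| := by
      rw [← abs_of_nonneg (pow_nonneg hσ m), ← abs_mul, abs_of_nonneg (pow_nonneg hσ m)]
      congr 1; ring
    rw [h6]
    refine (abs_sub _ _).trans ?_
    linarith
  have h7 := abs_sub_mul_pow_le ha0 hp0 (E.card - 1)
  have h8 : E.card - 1 + 1 = E.card := Nat.sub_add_cancel hEne.card_pos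
  rw [h8] at h7
  calc |a - p| * p ^ (E.card - 1) * σ ^ m ≤ |a ^ E.card - p ^ E.card| * σ ^ m := by gcongr
    _ ≤ _ := by rw [mul_assoc]; exact h5

end Rooted
theorem star_term_bounds {p γ b : ℝ} (hp : 0 ≤ p) (hγ : 0 ≤ γ) (hb : 0 ≤ b) {e d n : ℕ}
    (hde : d ≤ e) (hdn : d ≤ n) :
    (p * γ ≤ b → 0 ≤ p ^ (e - d) * (b ^ d * γ ^ (n - d)) - p ^ e * γ ^ n ∧
      (1 ≤ d → p ^ (e - 1) * γ ^ (n - 1) * (b - p * γ)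
        ≤ p ^ (e - d) * (b ^ d * γ ^ (n - d)) - p ^ e * γ ^ n)) ∧
    (b ≤ p * γ → p ^ (e - d) * (b ^ d * γ ^ (n - d)) - p ^ e * γ ^ n ≤ 0 ∧
      (1 ≤ d → p ^ (e - d) * (b ^ d * γ ^ (n - d)) - p ^ e * γ ^ n
        ≤ p ^ (e - 1) * γ ^ (n - 1) * (b - p * γ))) := by
  obtain ⟨e', rfl⟩ := Nat.exists_eq_add_of_le hde
  obtain ⟨n', rfl⟩ := Nat.exists_eq_add_of_le hdn
  have hq : 0 ≤ p * γ := mul_nonneg hp hγ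
  have hC : 0 ≤ p ^ e' * γ ^ n' := by positivity
  simp only [Nat.add_sub_cancel_left]
  have h1 : p ^ e' * (b ^ d * γ ^ n') - p ^ (d + e') * γ ^ (d + n')
      = p ^ e' * γ ^ n' * (b ^ d - (p * γ) ^ d) := by
    rw [pow_add, pow_add, mul_pow]; ring
  rw [h1]
  have h2 : 1 ≤ d → p ^ (d + e' - 1) * γ ^ (d + n' - 1) * (b - p * γ)
      = p ^ e' * γ ^ n' * ((p * γ) ^ (d - 1) * (b - p * γ)) := by
    intro hd
    have a1 : d + e' - 1 = e' + (d - 1) := by omega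
    have a2 : d + n' - 1 = n' + (d - 1) := by omega
    rw [a1, a2, pow_add, pow_add, mul_pow]; ring
  have h3 : ∀ x : ℝ, 1 ≤ d → x ^ d = x ^ (d - 1) * x := fun x hd => by
    rw [← pow_succ, Nat.sub_add_cancel hd]
  refine ⟨fun h => ⟨mul_nonneg hC (sub_nonneg.2 (by gcongr)), fun hd => ?_⟩,
    fun h => ⟨mul_nonpos_of_nonneg_of_nonpos hC (sub_nonpos.2 (by gcongr)), fun hd => ?_⟩⟩
  · rw [h2 hd]
    refine mul_le_mul_of_nonneg_left ?_ hC
    have : (p * γ) ^ (d - 1) ≤ b ^ (d - 1) := by gcongr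
    rw [h3 b hd, h3 (p * γ) hd]
    nlinarith
  · rw [h2 hd]
    refine mul_le_mul_of_nonneg_left ?_ hC
    have : b ^ (d - 1) ≤ (p * γ) ^ (d - 1) := by gcongr
    rw [h3 b hd, h3 (p * γ) hd]
    nlinarith

theorem bilSum_sub_eq {β : Type*} [Fintype β] (W : β → β → ℝ) (p : ℝ) (f g : β → ℝ) :
    bilSum (fun x y => W x y - p) f g = ∑ x, f x * (∑ y, W x y * g y - p * ∑ y, g y) := by
  rw [bilSum]
  refine Finset.sum_congr rfl fun x _ => ?_
  rw [Finset.mul_sum, ← Finset.sum_sub_distrib, Finset.mul_sum]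
  exact Finset.sum_congr rfl fun y _ => by ring

section Rooted

variable {m : ℕ} {β : Type} [Fintype β]
  {W : β → β → ℝ} {E : Finset (Fin m × Fin m)} {p c ε : ℝ} {s : β → ℝ}

theorem abs_sum_star_le (hsym : ∀ x y, W x y = W y x) (hW0 : ∀ x y, 0 ≤ W x y)
    (hW1 : ∀ x y, W x y ≤ 1) (hE : ∀ e ∈ E, e.1 < e.2) (hp0 : 0 ≤ p) (hp1 : p ≤ 1)
    (hstar : SymHomClose E W p c) (hs1 : s ≤ 1) (hε : 0 ≤ ε)
    (hreg : CutBound (fun x y => W x y - p) s s (ε * ((∑ x, s x) * ∑ x, s x)))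
    {g : β → ℝ} (hg0 : 0 ≤ g) (hgs : g ≤ s) (i₀ : Fin m) {f : β → ℝ} (hf0 : 0 ≤ f)
    (hf1 : f ≤ 1) :
    |∑ x, f x * ∑ τ : Equiv.Perm (Fin m),
        (p ^ (E.card - (edgesAt E (τ.symm i₀)).card) *
          ((∑ y, W x y * g y) ^ (edgesAt E (τ.symm i₀)).card *
            (∑ y, g y) ^ (m - 1 - (edgesAt E (τ.symm i₀)).card))
          - p ^ E.card * (∑ y, g y) ^ (m - 1))|
      ≤ m.factorial * (E.card * (ε * (Fintype.card β * (∑ x, s x) ^ (m - 1)))) + c := by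
  classical
  set w : Fin m → β → ℝ := fun k => if k = i₀ then f else g with hw
  set u : Fin m → β → ℝ := fun k => if k = i₀ then 1 else s with hu
  have hw0 : ∀ k, 0 ≤ w k := fun k => by simp only [hw]; split_ifs <;> assumption
  have hw1 : ∀ k, w k ≤ 1 := fun k => by
    simp only [hw]; split_ifs
    · exact hf1
    · exact hgs.trans hs1
  have hwu : ∀ k, w k ≤ u k := fun k => by
    simp only [hw, hu]; split_ifs
    · exact hf1
    · exact hgs
  have h1 := hstar w hw0 hw1
  have hprod : ∀ (f' g' : β → ℝ), ∏ k : Fin m, ∑ x, (if k = i₀ then f' else g') x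
      = (∑ x, f' x) * (∑ x, g' x) ^ (m - 1) := by
    intro f' g'
    rw [← Finset.mul_prod_erase univ _ (mem_univ i₀)]
    congr 1
    · simp
    · rw [Finset.prod_congr rfl (g := fun _ => ∑ x, g' x)
        (fun k hk => by rw [if_neg (ne_of_mem_erase hk)])]
      simp
  have hσ : ∀ τ : Equiv.Perm (Fin m),
      |homSum E W (fun k => w (τ k)) - p ^ (E.card - (edgesAt E (τ.symm i₀)).card) *
        ∑ x, f x * ((∑ y, W x y * g y) ^ (edgesAt E (τ.symm i₀)).card *
            (∑ y, g y) ^ (m - 1 - (edgesAt E (τ.symm i₀)).card))|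
        ≤ E.card * (ε * (Fintype.card β * (∑ x, s x) ^ (m - 1))) := by
    intro τ
    set i := τ.symm i₀ with hi
    have hτ : ∀ k, τ k = i₀ ↔ k = i := fun k => by rw [hi, Equiv.eq_symm_apply]
    have hsub : edgesAt E i ⊆ E := Finset.filter_subset _ _
    have h2 := abs_homSum_sub_le hW0 hW1 (w := fun k => w (τ k)) (u := fun k => u (τ k))
      (fun k => hw0 _) (fun k => hwu _) hp0 hp1 hε (edgesAt E i) (E \ edgesAt E i)
      Finset.sdiff_disjoint (fun e he => hE e (Finset.sdiff_subset he))
      (fun e he => hE e (hsub he)) (fun e he => by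
        simp only [edgesAt, Finset.mem_sdiff, Finset.mem_filter, not_and, not_or] at he
        have := he.2 he.1
        simp only [hu, hτ, if_neg this.1, if_neg this.2]
        exact hreg)
    rw [Finset.sdiff_union_of_subset hsub, Finset.card_sdiff_of_subset hsub,
      (homSum_edgesAt hsym hE i (g := g) (w := fun k => w (τ k))
        (fun k hk => by simp only [hw, hτ, if_neg hk])).1,
      Equiv.prod_comp τ (fun k => ∑ x, u k x)] at h2
    simp only [hu] at h2
    rw [hprod] at h2
    simp only [Pi.one_apply, Finset.sum_const, Finset.card_univ, nsmul_eq_mul, mul_one] at h2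
    have h3 : w (τ i) = f := by simp [hw, hi]
    simp only [h3] at h2
    refine h2.trans ?_
    have hs : 0 ≤ ∑ x, s x := Finset.sum_nonneg fun x _ => (hg0 x).trans (hgs x)
    gcongr
    exact Nat.sub_le _ _
  have h4 : ∑ x, f x * ∑ τ : Equiv.Perm (Fin m),
        (p ^ (E.card - (edgesAt E (τ.symm i₀)).card) *
          ((∑ y, W x y * g y) ^ (edgesAt E (τ.symm i₀)).card *
            (∑ y, g y) ^ (m - 1 - (edgesAt E (τ.symm i₀)).card))
          - p ^ E.card * (∑ y, g y) ^ (m - 1))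
      = (∑ τ : Equiv.Perm (Fin m), homSum E W (fun i => w (τ i))
          - (m.factorial : ℝ) * (p ^ E.card * ∏ i, ∑ x, w i x))
        - ∑ τ : Equiv.Perm (Fin m), (homSum E W (fun k => w (τ k))
            - p ^ (E.card - (edgesAt E (τ.symm i₀)).card) *
        ∑ x, f x * ((∑ y, W x y * g y) ^ (edgesAt E (τ.symm i₀)).card *
            (∑ y, g y) ^ (m - 1 - (edgesAt E (τ.symm i₀)).card))) := by
    simp only [hw]
    rw [hprod]
    have h5 : (m.factorial : ℝ) * (p ^ E.card * ((∑ x, f x) * (∑ y, g y) ^ (m - 1)))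
        = ∑ τ : Equiv.Perm (Fin m), ∑ x, f x * (p ^ E.card * (∑ y, g y) ^ (m - 1)) := by
      rw [Finset.sum_const, Finset.card_univ, Fintype.card_perm, Fintype.card_fin, nsmul_eq_mul,
        ← Finset.sum_mul]
      ring
    rw [h5, ← Finset.sum_sub_distrib, ← Finset.sum_sub_distrib]
    simp only [Finset.mul_sum]
    rw [Finset.sum_comm]
    refine Finset.sum_congr rfl fun τ _ => ?_
    rw [sub_sub_sub_cancel_left, ← Finset.sum_sub_distrib]
    exact Finset.sum_congr rfl fun x _ => by ring
  rw [h4]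
  refine (abs_sub _ _).trans ?_
  have h6 : |∑ τ : Equiv.Perm (Fin m), (homSum E W (fun k => w (τ k))
            - p ^ (E.card - (edgesAt E (τ.symm i₀)).card) *
        ∑ x, f x * ((∑ y, W x y * g y) ^ (edgesAt E (τ.symm i₀)).card *
            (∑ y, g y) ^ (m - 1 - (edgesAt E (τ.symm i₀)).card)))|
      ≤ m.factorial * (E.card * (ε * (Fintype.card β * (∑ x, s x) ^ (m - 1)))) := by
    refine (Finset.abs_sum_le_sum_abs _ _).trans ((Finset.sum_le_sum fun τ _ => hσ τ).trans ?_)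
    rw [Finset.sum_const, Finset.card_univ, Fintype.card_perm, Fintype.card_fin, nsmul_eq_mul]
  linarith

theorem mul_abs_bilSum_le_of_symHomClose (hsym : ∀ x y, W x y = W y x) (hW0 : ∀ x y, 0 ≤ W x y)
    (hW1 : ∀ x y, W x y ≤ 1) (hE : ∀ e ∈ E, e.1 < e.2) (hEne : E.Nonempty)
    (hp0 : 0 ≤ p) (hp1 : p ≤ 1)
    (hstar : SymHomClose E W p c) (hs1 : s ≤ 1) (hε : 0 ≤ ε)
    (hreg : CutBound (fun x y => W x y - p) s s (ε * ((∑ x, s x) * ∑ x, s x)))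
    {g : β → ℝ} (hg0 : 0 ≤ g) (hgs : g ≤ s) {f : β → ℝ} (hf0 : 0 ≤ f) (hf1 : f ≤ 1) :
    p ^ (E.card - 1) * (∑ y, g y) ^ (m - 2) * |bilSum (fun x y => W x y - p) f g|
      ≤ m.factorial * (E.card * (ε * (Fintype.card β * (∑ x, s x) ^ (m - 1)))) + c := by
  classical
  obtain ⟨e₀, he₀⟩ := hEne
  set b : β → ℝ := fun x => ∑ y, W x y * g y with hb
  set γ : ℝ := ∑ y, g y with hγ
  have hγ0 : 0 ≤ γ := Finset.sum_nonneg fun y _ => hg0 y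
  have hb0 : ∀ x, 0 ≤ b x := fun x => Finset.sum_nonneg fun y _ => mul_nonneg (hW0 x y) (hg0 y)
  set C : ℝ := p ^ (E.card - 1) * γ ^ (m - 2) with hC
  have hC0 : 0 ≤ C := by positivity
  set t : Equiv.Perm (Fin m) → β → ℝ := fun τ x =>
    p ^ (E.card - (edgesAt E (τ.symm e₀.1)).card) * (b x ^ (edgesAt E (τ.symm e₀.1)).card *
      γ ^ (m - 1 - (edgesAt E (τ.symm e₀.1)).card)) - p ^ E.card * γ ^ (m - 1) with ht
  have hstarsum : ∀ f : β → ℝ, 0 ≤ f → f ≤ 1 → |∑ x, f x * ∑ τ, t τ x|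
      ≤ m.factorial * (E.card * (ε * (Fintype.card β * (∑ x, s x) ^ (m - 1)))) + c :=
    fun f hf0 hf1 => abs_sum_star_le hsym hW0 hW1 hE hp0 hp1 hstar hs1 hε hreg hg0 hgs e₀.1 hf0 hf1
  have hbd := fun (τ : Equiv.Perm (Fin m)) (x : β) =>
    star_term_bounds (e := E.card) (d := (edgesAt E (τ.symm e₀.1)).card) (n := m - 1)
      hp0 hγ0 (hb0 x) (Finset.card_le_card (Finset.filter_subset _ _))
      (homSum_edgesAt hsym hE (τ.symm e₀.1) (w := fun _ => g) (g := g) (fun _ _ => rfl)).2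
  have hd1 : 1 ≤ (edgesAt E ((1 : Equiv.Perm (Fin m)).symm e₀.1)).card :=
    Finset.card_pos.2 ⟨e₀, Finset.mem_filter.2 ⟨he₀, Or.inl rfl⟩⟩
  have hm2 : m - 1 - 1 = m - 2 := by omega
  simp only [hm2] at hbd
  have hge : ∀ x, p * γ ≤ b x → C * (b x - p * γ) ≤ ∑ τ, t τ x := fun x hx =>
    (((hbd 1 x).1 hx).2 hd1).trans
      (Finset.single_le_sum (f := fun τ => t τ x) (fun τ _ => ((hbd τ x).1 hx).1) (mem_univ 1))
  have hle : ∀ x, b x ≤ p * γ → ∑ τ, t τ x ≤ C * (b x - p * γ) := fun x hx => by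
    have h1 := Finset.single_le_sum (f := fun τ => -t τ x)
      (fun τ _ => neg_nonneg.2 ((hbd τ x).2 hx).1) (mem_univ 1)
    have h2 := ((hbd 1 x).2 hx).2 hd1
    rw [Finset.sum_neg_distrib] at h1
    have h3 : t 1 x ≤ C * (b x - p * γ) := h2
    linarith
  have habs : ∀ z : ℝ, C * |z| = |C * z| := fun z => by rw [abs_mul, abs_of_nonneg hC0]
  rw [bilSum_sub_eq, habs, Finset.mul_sum]
  set f₁ : β → ℝ := fun x => if p * γ ≤ b x then f x else 0 with hf₁
  set f₂ : β → ℝ := fun x => if p * γ ≤ b x then 0 else f x with hf₂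
  have a1 := abs_le.1 (hstarsum f₁ (fun x => by
      simp only [hf₁]; split_ifs; exacts [hf0 x, le_rfl])
    (fun x => by simp only [hf₁]; split_ifs; exacts [hf1 x, zero_le_one]))
  have a2 := abs_le.1 (hstarsum f₂ (fun x => by
      simp only [hf₂]; split_ifs; exacts [le_rfl, hf0 x])
    (fun x => by simp only [hf₂]; split_ifs; exacts [zero_le_one, hf1 x]))
  refine abs_le.2 ⟨a2.1.trans (Finset.sum_le_sum fun x _ => ?_),
    (Finset.sum_le_sum fun x _ => ?_).trans a1.2⟩
  · have hfx : 0 ≤ f x := hf0 x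
    simp only [hf₂]
    split_ifs with h
    · rw [zero_mul]
      exact mul_nonneg hC0 (mul_nonneg hfx (sub_nonneg.2 h))
    · have := mul_le_mul_of_nonneg_left (hle x (not_le.1 h).le) hfx
      linarith
  · have hfx : 0 ≤ f x := hf0 x
    simp only [hf₁]
    split_ifs with h
    · have := mul_le_mul_of_nonneg_left (hge x h) hfx
      linarith
    · rw [zero_mul]
      exact mul_nonpos_of_nonneg_of_nonpos hC0
        (mul_nonpos_of_nonneg_of_nonpos hfx (sub_nonpos.2 (not_le.1 h).le))

end Rooted
theorem homSum_singleton {ι β : Type*} [Fintype ι] [DecidableEq ι] [Fintype β]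
    (W : β → β → ℝ) (w : ι → β → ℝ) {e : ι × ι} (he : e.1 ≠ e.2) :
    homSum {e} W w
      = bilSum W (w e.1) (w e.2) * ∏ k ∈ (univ.erase e.1).erase e.2, ∑ y, w k y := by
  have hmem : e.2 ∈ univ.erase e.1 := mem_erase.2 ⟨he.symm, mem_univ _⟩
  have h1 : ∀ φ : ι → β, (∏ e' ∈ ({e} : Finset (ι × ι)), W (φ e'.1) (φ e'.2)) * ∏ i, w i (φ i)
      = w e.1 (φ e.1) * ∏ k ∈ univ.erase e.1,
        (if k = e.2 then W (φ e.1) (φ k) * w k (φ k) else w k (φ k)) := by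
    intro φ
    rw [Finset.prod_singleton, ← Finset.mul_prod_erase univ _ (mem_univ e.1),
      ← Finset.mul_prod_erase _ _ hmem, ← Finset.mul_prod_erase _ _ hmem, if_pos rfl,
      Finset.prod_congr rfl (g := fun k => w k (φ k))
        (s₁ := (univ.erase e.1).erase e.2) (fun k hk => if_neg (ne_of_mem_erase hk))]
    ring
  rw [homSum]
  simp only [h1]
  rw [sum_root_eq e.1 (w e.1) (fun k x y => if k = e.2 then W x y * w k y else w k y), bilSum,
    Finset.sum_mul]
  refine Finset.sum_congr rfl fun x _ => ?_
  rw [← Finset.mul_prod_erase _ _ hmem]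
  simp only [if_true]
  rw [Finset.prod_congr rfl (g := fun k => ∑ y, w k y)
        (s₁ := (univ.erase e.1).erase e.2)
        (fun k hk => by simp only [if_neg (ne_of_mem_erase hk)]), ← mul_assoc, Finset.mul_sum]
  congr 1
  exact Finset.sum_congr rfl fun y _ => by ring

section Rooted

variable {m : ℕ} {β : Type} [Fintype β]
  {W : β → β → ℝ} {E : Finset (Fin m × Fin m)} {p c ε : ℝ} {s : β → ℝ}

theorem mul_abs_bilSum_le_of_cutBound_one_left (hsym : ∀ x y, W x y = W y x)
    (hW0 : ∀ x y, 0 ≤ W x y)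
    (hW1 : ∀ x y, W x y ≤ 1) (hE : ∀ e ∈ E, e.1 < e.2) (hEne : E.Nonempty)
    (hp0 : 0 ≤ p) (hp1 : p ≤ 1)
    (hstar : SymHomClose E W p c) (hs0 : 0 ≤ s) (hs1 : s ≤ 1) (hε : 0 ≤ ε)
    (hreg : CutBound (fun x y => W x y - p) s s (ε * ((∑ x, s x) * ∑ x, s x)))
    (hreg1 : CutBound (fun x y => W x y - p) 1 s (ε * (Fintype.card β * ∑ x, s x)))
    {f g : β → ℝ} (hf0 : 0 ≤ f) (hf1 : f ≤ 1) (hg0 : 0 ≤ g) (hg1 : g ≤ 1) :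
    p ^ (E.card - 1) * (∑ y, s y) ^ (m - 2) * |bilSum (fun x y => W x y - p) f g|
      ≤ m.factorial *
        (E.card * (ε * (Fintype.card β * (Fintype.card β * (∑ x, s x) ^ (m - 2))))) + c := by
  classical
  obtain ⟨e₀, he₀⟩ := hEne
  have hne₀ : e₀.1 ≠ e₀.2 := (hE e₀ he₀).ne
  set w : Fin m → β → ℝ := fun k => if k = e₀.1 then f else if k = e₀.2 then g else s with hw
  set u : Fin m → β → ℝ := fun k => if k = e₀.1 then 1 else if k = e₀.2 then 1 else s with hu
  have hw0 : ∀ k, 0 ≤ w k := fun k => by simp only [hw]; split_ifs <;> assumption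
  have hw1 : ∀ k, w k ≤ 1 := fun k => by simp only [hw]; split_ifs <;> assumption
  have hwu : ∀ k, w k ≤ u k := fun k => by
    simp only [hw, hu]; split_ifs <;> first | assumption | exact le_rfl
  have hmem : e₀.2 ∈ univ.erase e₀.1 := mem_erase.2 ⟨hne₀.symm, mem_univ _⟩
  have hprod0 : ∀ f' g' : β → ℝ, ∏ k ∈ (univ.erase e₀.1).erase e₀.2,
      ∑ x, (if k = e₀.1 then f' else if k = e₀.2 then g' else s) x = (∑ x, s x) ^ (m - 2) := by
    intro f' g'
    rw [Finset.prod_congr rfl (g := fun _ => ∑ x, s x) (fun k hk => by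
      rw [if_neg (ne_of_mem_erase (mem_of_mem_erase hk)), if_neg (ne_of_mem_erase hk)]),
      Finset.prod_const, Finset.card_erase_of_mem hmem, Finset.card_erase_of_mem (mem_univ _),
      Finset.card_univ, Fintype.card_fin]
    rfl
  have hprod : ∀ f' g' : β → ℝ, ∏ k,
      ∑ x, (if k = e₀.1 then f' else if k = e₀.2 then g' else s) x
        = (∑ x, f' x) * ((∑ x, g' x) * (∑ x, s x) ^ (m - 2)) := by
    intro f' g'
    rw [← Finset.mul_prod_erase univ _ (mem_univ e₀.1), ← Finset.mul_prod_erase _ _ hmem,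
      hprod0]
    simp only [if_true, if_neg hne₀.symm]
  set N : ℝ := (Fintype.card β : ℝ) with hN
  set σ : ℝ := ∑ x, s x with hσ
  have hσ0 : 0 ≤ σ := Finset.sum_nonneg fun x _ => hs0 x
  set X : ℝ := p ^ (E.card - 1) * σ ^ (m - 2) * bilSum (fun x y => W x y - p) f g with hX
  set Q : Equiv.Perm (Fin m) → Finset (Fin m × Fin m) := fun τ =>
    E.filter fun e => (τ e.1 = e₀.1 ∧ τ e.2 = e₀.2) ∨ (τ e.1 = e₀.2 ∧ τ e.2 = e₀.1) with hQ
  have h1 := hstar w hw0 hw1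
  have hmain : ∀ τ : Equiv.Perm (Fin m), p ^ (E \ Q τ).card * homSum (Q τ) W (fun k => w (τ k))
      - p ^ E.card * ∏ i, ∑ x, w i x = if (Q τ).Nonempty then X else 0 := by
    intro τ
    have hwprod := hprod f g
    have hsub : Q τ ⊆ E := Finset.filter_subset _ _
    split_ifs with hne
    · obtain ⟨e, he⟩ := hne
      have hQe : Q τ = {e} := by
        refine Finset.eq_singleton_iff_unique_mem.2 ⟨he, fun e' he' => ?_⟩
        simp only [hQ, Finset.mem_filter] at he he'
        have b1 := hE e he.1
        have b2 := hE e' he'.1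
        have b3 := τ.injective
        apply Prod.ext
        · rcases he.2 with h | h <;> rcases he'.2 with h' | h'
          · exact b3 (h'.1.trans h.1.symm)
          · have c1 := b3 (h'.1.trans h.2.symm)
            have c2 := b3 (h'.2.trans h.1.symm)
            omega
          · have c1 := b3 (h'.1.trans h.2.symm)
            have c2 := b3 (h'.2.trans h.1.symm)
            omega
          · exact b3 (h'.1.trans h.1.symm)
        · rcases he.2 with h | h <;> rcases he'.2 with h' | h'
          · exact b3 (h'.2.trans h.2.symm)
          · have c1 := b3 (h'.1.trans h.2.symm)
            have c2 := b3 (h'.2.trans h.1.symm)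
            omega
          · have c1 := b3 (h'.1.trans h.2.symm)
            have c2 := b3 (h'.2.trans h.1.symm)
            omega
          · exact b3 (h'.2.trans h.2.symm)
      have hee : e.1 ≠ e.2 := (hE e (hsub he)).ne
      have hpe : p ^ E.card = p ^ (E.card - 1) * p := by
        rw [← pow_succ, Nat.sub_add_cancel (Finset.card_pos.2 ⟨e₀, he₀⟩)]
      have hbil : bilSum W (w (τ e.1)) (w (τ e.2)) = bilSum W f g := by
        simp only [hQ, Finset.mem_filter] at he
        rcases he.2 with h | h
        · rw [h.1, h.2]; simp only [hw, if_true, if_neg hne₀.symm]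
        · rw [h.1, h.2, bilSum_comm hsym]; simp only [hw, if_true, if_neg hne₀.symm]
      have hrest : ∏ k ∈ (univ.erase e.1).erase e.2, ∑ y, w (τ k) y = σ ^ (m - 2) := by
        rw [← hprod0 f g]
        refine Finset.prod_equiv τ (fun k => ?_) fun k _ => rfl
        simp only [hQ, Finset.mem_filter] at he
        simp only [mem_erase, mem_univ, and_true, ne_eq]
        rcases he.2 with h | h <;> rw [← h.1, ← h.2, τ.injective.eq_iff, τ.injective.eq_iff]
        tauto
      rw [Finset.card_sdiff_of_subset hsub, hQe, Finset.card_singleton,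
        homSum_singleton W _ hee, hbil, hrest, hX, bilSum_sub_const, hwprod, hpe]
      ring
    · rw [Finset.not_nonempty_iff_eq_empty] at hne
      rw [hne, Finset.sdiff_empty, ← Equiv.prod_comp τ (fun k => ∑ x, w k x), homSum]
      simp only [Finset.prod_empty, one_mul]
      rw [sum_prod_eq_prod_sum (fun k => w (τ k)), sub_self]
  have herr : ∀ τ : Equiv.Perm (Fin m), |homSum E W (fun k => w (τ k))
      - p ^ (E \ Q τ).card * homSum (Q τ) W (fun k => w (τ k))|
      ≤ E.card * (ε * (N * (N * σ ^ (m - 2)))) := by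
    intro τ
    have hsub : Q τ ⊆ E := Finset.filter_subset _ _
    have h2 := abs_homSum_sub_le hW0 hW1 (w := fun k => w (τ k)) (u := fun k => u (τ k))
      (fun k => hw0 _) (fun k => hwu _) hp0 hp1 hε (Q τ) (E \ Q τ)
      Finset.sdiff_disjoint (fun e he => hE e (Finset.sdiff_subset he))
      (fun e he => hE e (hsub he)) (fun e he => by
        have hrsym : ∀ x y, (fun x y => W x y - p) x y = (fun x y => W x y - p) y x :=
          fun x y => by simp only [hsym x y]
        have hne : τ e.1 ≠ τ e.2 := fun h =>
          (hE e (Finset.sdiff_subset he)).ne (τ.injective h)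
        have hsum1 : ∑ x : β, (1 : β → ℝ) x = N := by simp [hN]
        simp only [hQ, Finset.mem_sdiff, Finset.mem_filter, not_and, not_or] at he
        have h3 := he.2 he.1
        have hreg2 := hreg1.symm hrsym
        simp only [hu]
        by_cases a1 : τ e.1 = e₀.1 <;> by_cases a2 : τ e.1 = e₀.2 <;>
          by_cases a3 : τ e.2 = e₀.1 <;> by_cases a4 : τ e.2 = e₀.2 <;>
          first
          | exact absurd (a1.trans a3.symm) hne
          | exact absurd (a2.trans a4.symm) hne
          | exact absurd a4 (h3.1 a1)
          | exact absurd a3 (h3.2 a2)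
          | (simp only [a1, a2, a3, a4, if_true, if_false, hsum1, hne₀.symm, ← hσ]
             first
             | exact hreg1
             | exact hreg
             | (rw [mul_comm σ N]; exact hreg2)))
    rw [Finset.sdiff_union_of_subset hsub,
      Equiv.prod_comp τ (fun k => ∑ x, u k x)] at h2
    simp only [hu] at h2
    rw [hprod] at h2
    simp only [Pi.one_apply, Finset.sum_const, Finset.card_univ, nsmul_eq_mul, mul_one] at h2
    refine h2.trans ?_
    gcongr
    exact Finset.sdiff_subset
  set q : ℕ := (univ.filter fun τ : Equiv.Perm (Fin m) => (Q τ).Nonempty).card with hq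
  have hq1 : (1 : ℝ) ≤ q := by
    have : 0 < q := Finset.card_pos.2 ⟨1, Finset.mem_filter.2 ⟨mem_univ _, e₀,
      Finset.mem_filter.2 ⟨he₀, Or.inl ⟨rfl, rfl⟩⟩⟩⟩
    exact_mod_cast this
  have hsum : (q : ℝ) * X = (∑ τ : Equiv.Perm (Fin m), homSum E W (fun i => w (τ i))
          - (m.factorial : ℝ) * (p ^ E.card * ∏ i, ∑ x, w i x))
        - ∑ τ : Equiv.Perm (Fin m), (homSum E W (fun k => w (τ k))
      - p ^ (E \ Q τ).card * homSum (Q τ) W (fun k => w (τ k))) := by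
    have h5 : (q : ℝ) * X = ∑ τ : Equiv.Perm (Fin m), if (Q τ).Nonempty then X else 0 := by
      rw [Finset.sum_ite, Finset.sum_const_zero, add_zero, Finset.sum_const, nsmul_eq_mul]
    rw [h5, ← Finset.sum_congr rfl fun τ _ => hmain τ, Finset.sum_sub_distrib,
      Finset.sum_sub_distrib, Finset.sum_const, Finset.card_univ, Fintype.card_perm,
      Fintype.card_fin, nsmul_eq_mul]
    ring
  have h6 : |(q : ℝ) * X| ≤ c + m.factorial * (E.card * (ε * (N * (N * σ ^ (m - 2))))) := by
    rw [hsum]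
    refine (abs_sub _ _).trans (add_le_add h1 ?_)
    refine (Finset.abs_sum_le_sum_abs _ _).trans
      ((Finset.sum_le_sum fun τ _ => herr τ).trans ?_)
    rw [Finset.sum_const, Finset.card_univ, Fintype.card_perm, Fintype.card_fin, nsmul_eq_mul]
  have h7 : |X| ≤ |(q : ℝ) * X| := by
    rw [abs_mul (q : ℝ) X, abs_of_nonneg (a := (q : ℝ)) (by linarith)]
    exact le_mul_of_one_le_left (abs_nonneg _) hq1
  have h8 : |X| = p ^ (E.card - 1) * σ ^ (m - 2) * |bilSum (fun x y => W x y - p) f g| := by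
    rw [hX, abs_mul, abs_of_nonneg (a := p ^ (E.card - 1) * σ ^ (m - 2)) (by positivity)]
  rw [← h8]
  linarith

end Rooted
theorem CutBound.sub_const {β : Type*} [Fintype β] {W : β → β → ℝ} {a p : ℝ} {s : β → ℝ} {ε : ℝ}
    (h : CutBound (fun x y => W x y - a) s s (ε * ((∑ x, s x) * ∑ x, s x))) :
    CutBound (fun x y => W x y - p) s s ((ε + |a - p|) * ((∑ x, s x) * ∑ x, s x)) := by
  intro f g hf hfs hg hgs
  have h1 := h f g hf hfs hg hgs
  rw [bilSum_sub_const] at h1 ⊢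
  have hF0 : 0 ≤ ∑ x, f x := Finset.sum_nonneg fun x _ => hf x
  have hG0 : 0 ≤ ∑ x, g x := Finset.sum_nonneg fun x _ => hg x
  have hF : ∑ x, f x ≤ ∑ x, s x := Finset.sum_le_sum fun x _ => hfs x
  have hG : ∑ x, g x ≤ ∑ x, s x := Finset.sum_le_sum fun x _ => hgs x
  have h2 : bilSum W f g - p * ((∑ x, f x) * ∑ x, g x)
      = (bilSum W f g - a * ((∑ x, f x) * ∑ x, g x))
        + (a - p) * ((∑ x, f x) * ∑ x, g x) := by ring
  rw [h2, add_mul]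
  refine (abs_add_le _ _).trans (add_le_add h1 ?_)
  rw [abs_mul, abs_of_nonneg (mul_nonneg hF0 hG0)]
  have := hF0.trans hF
  gcongr

/-- If all symmetrised weighted counts of copies of a fixed nonempty graph are as expected for
density `p`, then the kernel is close to `p` in cut norm. -/
theorem exists_cutBound_of_symHomClose {m : ℕ} {E : Finset (Fin m × Fin m)}
    (hE : ∀ e ∈ E, e.1 < e.2) (hEne : E.Nonempty) {p : ℝ} (hp0 : 0 < p) (hp1 : p ≤ 1)
    {ε : ℝ} (hε : 0 < ε) :
    ∃ δ : ℝ, 0 < δ ∧ ∀ (β : Type) [Fintype β] [Nonempty β] (W : β → β → ℝ),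
      (∀ x y, W x y = W y x) → (∀ x y, 0 ≤ W x y) → (∀ x y, W x y ≤ 1) →
      SymHomClose E W p (δ * (Fintype.card β : ℝ) ^ m) →
      CutBound (fun x y => W x y - p) 1 1 (ε * (Fintype.card β : ℝ) ^ 2) := by
  obtain ⟨k, rfl⟩ : ∃ k, m = k + 2 := by
    obtain ⟨e, he⟩ := hEne
    have := hE e he
    exact Nat.exists_eq_add_of_le' (by omega)
  set P : ℝ := p ^ (E.card - 1) with hP
  have hP0 : 0 < P := by positivity
  set M : ℝ := ((k + 2).factorial : ℝ) * E.card with hM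
  have hE1 : (1 : ℝ) ≤ E.card := by exact_mod_cast hEne.card_pos
  have hM0 : 0 < M := by have := (k + 2).factorial_pos; positivity
  set ε₃ : ℝ := P * ε / (2 * M) with hε₃
  have hε₃0 : 0 < ε₃ := by positivity
  set θ : ℝ := min ε₃ 1 with hθ
  have hθ0 : 0 < θ := lt_min hε₃0 one_pos
  set ε₂ : ℝ := min ε₃ (P * θ ^ k * ε₃ / (2 * M)) with hε₂
  have hε₂0 : 0 < ε₂ := lt_min hε₃0 (by positivity)
  set ε₁ : ℝ := ε₂ / (2 * (1 + E.card / P)) with hε₁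
  have hε₁0 : 0 < ε₁ := by positivity
  obtain ⟨κ, hκ0, hκ1, H⟩ := exists_subweight_cutBound hε₁0
  set δ : ℝ := min (P * κ ^ k * ε / 2) (min (P * θ ^ k * κ ^ (k + 1) * ε₃ / 2)
    (ε₂ * P * κ ^ (k + 2) / 2)) with hδ
  have hδ0 : 0 < δ := lt_min (by positivity) (lt_min (by positivity) (by positivity))
  have hδ1 : δ ≤ P * κ ^ k * ε / 2 := min_le_left _ _
  have hδ2 : δ ≤ P * θ ^ k * κ ^ (k + 1) * ε₃ / 2 := (min_le_right _ _).trans (min_le_left _ _)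
  have hδ3 : δ ≤ ε₂ * P * κ ^ (k + 2) / 2 := (min_le_right _ _).trans (min_le_right _ _)
  refine ⟨δ, hδ0, fun β _ _ W hsym hW0 hW1 hstar => ?_⟩
  set N : ℝ := (Fintype.card β : ℝ) with hN
  have hN0 : 0 < N := Nat.cast_pos.2 Fintype.card_pos
  have hsum1 : ∑ x : β, (1 : β → ℝ) x = N := by simp [hN]
  obtain ⟨s, hs0, hs1, hκs, a, ha0, ha1, hreg⟩ := H β W hsym hW0 hW1 1 zero_le_one
    (by rw [hsum1]; exact hN0)
  rw [hsum1] at hκs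
  set σ : ℝ := ∑ x, s x with hσ
  have hσ0 : 0 < σ := lt_of_lt_of_le (by positivity) hκs
  have hpow : ∀ j, κ ^ j * N ^ j ≤ σ ^ j := fun j => by rw [← mul_pow]; gcongr
  have hap : ε₁ + |a - p| ≤ ε₂ := by
    have h1 := abs_sub_le_of_symHomClose hW0 hW1 hE hEne hp0.le hstar hs0 hs1 hε₁0.le ha0 ha1 hreg
    have h2 : δ * N ^ (k + 2) ≤ ε₂ * P / 2 * σ ^ (k + 2) :=
      calc δ * N ^ (k + 2) ≤ (ε₂ * P * κ ^ (k + 2) / 2) * N ^ (k + 2) := by gcongr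
        _ = ε₂ * P / 2 * (κ ^ (k + 2) * N ^ (k + 2)) := by ring
        _ ≤ _ := by gcongr; exact hpow _
    have h3 : (|a - p| * P) * σ ^ (k + 2) ≤ (E.card * ε₁ + ε₂ * P / 2) * σ ^ (k + 2) := by
      rw [add_mul]; linarith
    have h4 := le_of_mul_le_mul_right h3 (by positivity)
    have h5 : ε₁ * (P + E.card) = ε₂ * P / 2 := by
      rw [hε₁]; field_simp
    refine le_of_mul_le_mul_right ?_ hP0
    linarith
  have hreg2 : CutBound (fun x y => W x y - p) s s (ε₂ * (σ * σ)) :=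
    hreg.sub_const.mono (by gcongr)
  have hreg3 : CutBound (fun x y => W x y - p) s s (ε₃ * (σ * σ)) :=
    hreg2.mono (by gcongr; exact min_le_left _ _)
  have hW : ∀ x y, |W x y - p| ≤ 1 := fun x y =>
    abs_le.2 ⟨by linarith [hW0 x y], by linarith [hW1 x y]⟩
  have hreg4 : CutBound (fun x y => W x y - p) 1 s (ε₃ * (N * σ)) := by
    intro f g hf hf1 hg hgs
    rcases le_total (∑ x, g x) (θ * σ) with h | h
    · have h1 := abs_bilSum_le hW (f := f) (g := g) (u := 1) (v := g)
        (fun x => by rw [abs_of_nonneg (hf x)]; exact hf1 x)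
        (fun x => by rw [abs_of_nonneg (hg x)])
      rw [hsum1] at h1
      calc _ ≤ N * ∑ x, g x := h1
        _ ≤ N * (ε₃ * σ) := by
          gcongr
          exact h.trans (by gcongr; exact min_le_left _ _)
        _ = _ := by ring
    · have h1 := mul_abs_bilSum_le_of_symHomClose hsym hW0 hW1 hE hEne hp0.le hp1 hstar hs1
        hε₂0.le hreg2 hg hgs hf hf1
      simp only [Nat.add_sub_cancel, show k + 2 - 1 = k + 1 by omega] at h1
      have h2 : δ * N ^ (k + 2) ≤ P * θ ^ k * σ ^ k * (ε₃ / 2 * (N * σ)) :=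
        calc δ * N ^ (k + 2) ≤ (P * θ ^ k * κ ^ (k + 1) * ε₃ / 2) * N ^ (k + 2) := by gcongr
          _ = P * θ ^ k * ε₃ / 2 * N * (κ ^ (k + 1) * N ^ (k + 1)) := by ring
          _ ≤ P * θ ^ k * ε₃ / 2 * N * σ ^ (k + 1) := by gcongr; exact hpow _
          _ = _ := by ring
      have h3 : M * ε₂ ≤ P * θ ^ k * ε₃ / 2 := by
        have : ε₂ ≤ P * θ ^ k * ε₃ / (2 * M) := min_le_right _ _
        calc M * ε₂ ≤ M * (P * θ ^ k * ε₃ / (2 * M)) := by gcongr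
          _ = _ := by field_simp
      have h4 : ((k + 2).factorial : ℝ) * (E.card * (ε₂ * (N * σ ^ (k + 1))))
          ≤ P * θ ^ k * σ ^ k * (ε₃ / 2 * (N * σ)) :=
        calc _ = M * ε₂ * (N * σ ^ (k + 1)) := by rw [hM]; ring
          _ ≤ P * θ ^ k * ε₃ / 2 * (N * σ ^ (k + 1)) := by gcongr
          _ = _ := by ring
      have h5 : P * θ ^ k * σ ^ k * |bilSum (fun x y => W x y - p) f g|
          ≤ P * (∑ y, g y) ^ k * |bilSum (fun x y => W x y - p) f g| := by
        rw [mul_assoc P, ← mul_pow]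
        gcongr
      refine le_of_mul_le_mul_left (a := P * θ ^ k * σ ^ k) ?_ (by positivity)
      linarith
  intro f g hf hf1 hg hg1
  have h1 := mul_abs_bilSum_le_of_cutBound_one_left hsym hW0 hW1 hE hEne hp0.le hp1 hstar hs0 hs1
    hε₃0.le hreg3 hreg4 hf hf1 hg hg1
  simp only [Nat.add_sub_cancel] at h1
  have h2 : δ * N ^ (k + 2) ≤ P * σ ^ k * (ε / 2 * N ^ 2) :=
    calc δ * N ^ (k + 2) ≤ (P * κ ^ k * ε / 2) * N ^ (k + 2) := by gcongr
      _ = P * ε / 2 * N ^ 2 * (κ ^ k * N ^ k) := by ring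
      _ ≤ P * ε / 2 * N ^ 2 * σ ^ k := by gcongr; exact hpow _
      _ = _ := by ring
  have h3 : ((k + 2).factorial : ℝ) * (E.card * (ε₃ * (N * (N * σ ^ k))))
      = P * σ ^ k * (ε / 2 * N ^ 2) :=
    calc _ = M * ε₃ * (N ^ 2 * σ ^ k) := by rw [hM]; ring
      _ = (P * ε / 2) * (N ^ 2 * σ ^ k) := by congr 1; rw [hε₃]; field_simp
      _ = _ := by ring
  refine le_of_mul_le_mul_left (a := P * σ ^ k) ?_ (by positivity)
  linarith
section Multilinear

variable {ι β : Type*} [Fintype ι] [DecidableEq ι] [Fintype β]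

/-- The multilinear form with coefficient function `Φ`. -/
noncomputable def formSum (Φ : (ι → β) → ℝ) (u : ι → β → ℝ) : ℝ :=
  ∑ φ : ι → β, Φ φ * ∏ i, u i (φ i)

theorem formSum_perm {Φ : (ι → β) → ℝ} (hΦ : ∀ (σ : Equiv.Perm ι) (φ : ι → β), Φ (φ ∘ σ) = Φ φ)
    (u : ι → β → ℝ) (σ : Equiv.Perm ι) : formSum Φ (fun i => u (σ i)) = formSum Φ u := by
  refine Fintype.sum_equiv (Equiv.arrowCongr σ (Equiv.refl β)) _ _ fun φ => ?_
  have h1 : (Equiv.arrowCongr σ (Equiv.refl β)) φ = φ ∘ σ.symm := rfl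
  rw [h1, hΦ σ.symm φ, ← Equiv.prod_comp σ (fun i => u i ((φ ∘ σ.symm) i))]
  simp

theorem formSum_add (Φ : (ι → β) → ℝ) (f g : ι → β → ℝ) :
    formSum Φ (fun i => f i + g i)
      = ∑ S ∈ (univ : Finset ι).powerset, formSum Φ (fun i => if i ∈ S then f i else g i) := by
  simp only [formSum, Pi.add_apply]
  rw [Finset.sum_comm]
  refine Finset.sum_congr rfl fun φ _ => ?_
  rw [Finset.prod_add, Finset.mul_sum]
  refine Finset.sum_congr rfl fun S _ => ?_
  congr 1
  have h1 : ∀ i, (if i ∈ S then f i else g i) (φ i) = if i ∈ S then f i (φ i) else g i (φ i) :=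
    fun i => by split_ifs <;> rfl
  simp only [h1]
  rw [Finset.prod_ite, Finset.filter_mem_eq_inter, Finset.univ_inter,
    Finset.filter_notMem_eq_sdiff]

theorem formSum_smul (Φ : (ι → β) → ℝ) (a : ι → ℝ) (f : ι → β → ℝ) :
    formSum Φ (fun i => a i • f i) = (∏ i, a i) * formSum Φ f := by
  simp only [formSum, Pi.smul_apply, smul_eq_mul, Finset.prod_mul_distrib, Finset.mul_sum]
  exact Finset.sum_congr rfl fun φ _ => by ring

theorem exists_formSum_eq_card {Φ : (ι → β) → ℝ}
    (hΦ : ∀ (σ : Equiv.Perm ι) (φ : ι → β), Φ (φ ∘ σ) = Φ φ) (f g : β → ℝ) :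
    ∃ T : ℕ → ℝ, ∀ S : Finset ι, formSum Φ (fun i => if i ∈ S then f else g) = T S.card := by
  have key : ∀ S S' : Finset ι, S.card = S'.card →
      formSum Φ (fun i => if i ∈ S then f else g)
        = formSum Φ (fun i => if i ∈ S' then f else g) := by
    intro S S' h
    obtain ⟨e⟩ : Nonempty ({x // x ∈ S} ≃ {x // x ∈ S'}) :=
      Fintype.card_eq.1 (by simpa using h)
    set σ : Equiv.Perm ι := e.extendSubtype with hσ
    have hmem : ∀ i, σ i ∈ S' ↔ i ∈ S := fun i => by
      constructor
      · intro hi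
        by_contra hc
        exact Equiv.extendSubtype_not_mem e i hc hi
      · exact fun hi => Equiv.extendSubtype_mem e i hi
    rw [← formSum_perm hΦ (fun i => if i ∈ S' then f else g) σ]
    simp only [hmem]
  refine ⟨fun k => if h : ∃ S : Finset ι, S.card = k then
    formSum Φ (fun i => if i ∈ h.choose then f else g) else 0, fun S => ?_⟩
  have h : ∃ S' : Finset ι, S'.card = S.card := ⟨S, rfl⟩
  simp only [dif_pos h]
  exact key _ _ h.choose_spec.symm

/-- Ryser's formula for the permanent. -/
theorem sum_powerset_neg_one_mul_prod_sum (x : ι → ι → ℝ) :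
    ∑ S ∈ (univ : Finset ι).powerset, (-1 : ℝ) ^ (univ \ S).card * ∏ j, ∑ i ∈ S, x i j
      = ∑ σ : Equiv.Perm ι, ∏ j, x (σ j) j := by
  have h1 : ∀ S : Finset ι, ∏ j, ∑ i ∈ S, x i j
      = ∑ f : ι → ι, if (∀ j, f j ∈ S) then ∏ j, x (f j) j else 0 := by
    intro S
    rw [Finset.prod_univ_sum, ← Finset.sum_filter]
    refine Finset.sum_congr ?_ fun _ _ => rfl
    ext f; simp
  have h2 : ∀ f : ι → ι, ∑ S ∈ (univ : Finset ι).powerset,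
      (-1 : ℝ) ^ (univ \ S).card * (if (∀ j, f j ∈ S) then ∏ j, x (f j) j else 0)
      = if Function.Bijective f then ∏ j, x (f j) j else 0 := by
    intro f
    have h3 : ∀ S : Finset ι,
        (-1 : ℝ) ^ (univ \ S).card * (if (∀ j, f j ∈ S) then ∏ j, x (f j) j else 0)
        = ((∏ i ∈ S, (1 : ℝ)) * ∏ i ∈ univ \ S, (if i ∈ Set.range f then (0 : ℝ) else -1)) *
          ∏ j, x (f j) j := by
      intro S
      rw [Finset.prod_const_one, one_mul]
      split_ifs with h
      · congr 1
        rw [Finset.prod_congr rfl (g := fun _ => (-1 : ℝ)), Finset.prod_const]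
        intro i hi
        rw [if_neg]
        rintro ⟨j, rfl⟩
        exact (Finset.mem_sdiff.1 hi).2 (h j)
      · push Not at h
        obtain ⟨j, hj⟩ := h
        rw [Finset.prod_eq_zero (i := f j) (by simp [hj]) (by simp)]
        simp
    simp only [h3]
    rw [← Finset.sum_mul, ← Finset.prod_add]
    split_ifs with h
    · rw [Finset.prod_eq_one, one_mul]
      intro i _
      rw [if_pos (show i ∈ Set.range f from h.2 i), add_zero]
    · rw [← Finite.surjective_iff_bijective] at h
      simp only [Function.Surjective, not_forall] at h
      obtain ⟨i, hi⟩ := h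
      rw [Finset.prod_eq_zero (mem_univ i), zero_mul]
      rw [if_neg (by simpa using hi)]
      norm_num
  simp only [h1, Finset.mul_sum]
  rw [Finset.sum_comm]
  simp only [h2]
  rw [← Finset.sum_filter]
  symm
  refine Finset.sum_bij (fun (σ : Equiv.Perm ι) _ => (⇑σ : ι → ι)) ?_ ?_ ?_ ?_
  · intro σ _
    simp
  · intro σ _ σ' _ h
    exact Equiv.coe_fn_injective h
  · intro f hf
    exact ⟨Equiv.ofBijective f (Finset.mem_filter.1 hf).2, mem_univ _, rfl⟩
  · intro σ _
    rfl

/-- Polarisation: a symmetric multilinear form is controlled by its diagonal. -/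
theorem abs_formSum_le_of_diag [Nonempty ι] {Φ : (ι → β) → ℝ}
    (hΦ : ∀ (σ : Equiv.Perm ι) (φ : ι → β), Φ (φ ∘ σ) = Φ φ) {c : ℝ}
    (h : ∀ w : β → ℝ, 0 ≤ w → w ≤ 1 → |formSum Φ (fun _ => w)| ≤ c)
    {w : ι → β → ℝ} (hw0 : ∀ i, 0 ≤ w i) (hw1 : ∀ i, w i ≤ 1) :
    |formSum Φ w| ≤ 2 ^ Fintype.card ι * (Fintype.card ι : ℝ) ^ Fintype.card ι * c := by
  set n := Fintype.card ι with hn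
  have hn0 : (0 : ℝ) < n := Nat.cast_pos.2 Fintype.card_pos
  have h1 : ((Fintype.card (Equiv.Perm ι) : ℕ) : ℝ) * formSum Φ w
      = ∑ S ∈ (univ : Finset ι).powerset,
        (-1 : ℝ) ^ (univ \ S).card * formSum Φ (fun _ => ∑ i ∈ S, w i) := by
    have h2 : ((Fintype.card (Equiv.Perm ι) : ℕ) : ℝ) * formSum Φ w
        = ∑ σ : Equiv.Perm ι, formSum Φ (fun i => w (σ i)) := by
      simp only [formSum_perm hΦ, Finset.sum_const, Finset.card_univ, nsmul_eq_mul]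
    rw [h2]
    simp only [formSum, Finset.mul_sum]
    rw [Finset.sum_comm, Finset.sum_comm (s := univ.powerset)]
    refine Finset.sum_congr rfl fun φ _ => ?_
    rw [← Finset.mul_sum, ← sum_powerset_neg_one_mul_prod_sum (fun i j => w i (φ j)),
      Finset.mul_sum]
    refine Finset.sum_congr rfl fun S _ => ?_
    simp only [Finset.sum_apply]
    ring
  have h3 : ∀ S : Finset ι, |formSum Φ (fun _ => ∑ i ∈ S, w i)| ≤ (n : ℝ) ^ n * c := by
    intro S
    have h4 : (fun _ : ι => ∑ i ∈ S, w i)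
        = fun _ : ι => (n : ℝ) • ((n : ℝ)⁻¹ • ∑ i ∈ S, w i) := by
      funext _
      rw [smul_smul, mul_inv_cancel₀ hn0.ne', one_smul]
    rw [h4, formSum_smul Φ (fun _ => (n : ℝ)), Finset.prod_const, Finset.card_univ, ← hn, abs_mul,
      abs_of_nonneg (by positivity)]
    refine mul_le_mul_of_nonneg_left (h _ ?_ ?_) (by positivity)
    · exact smul_nonneg (by positivity) (Finset.sum_nonneg fun i _ => hw0 i)
    · intro x
      simp only [Pi.smul_apply, Finset.sum_apply, smul_eq_mul, Pi.one_apply]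
      rw [inv_mul_le_iff₀ hn0, mul_one]
      calc ∑ i ∈ S, w i x ≤ ∑ i ∈ S, (1 : ℝ) := Finset.sum_le_sum fun i _ => hw1 i x
        _ = S.card := by simp
        _ ≤ n := by exact_mod_cast Finset.card_le_univ S
  have h5 : |((Fintype.card (Equiv.Perm ι) : ℕ) : ℝ) * formSum Φ w| ≤ 2 ^ n * (n : ℝ) ^ n * c := by
    rw [h1]
    refine (Finset.abs_sum_le_sum_abs _ _).trans ?_
    refine (Finset.sum_le_sum (g := fun _ => (n : ℝ) ^ n * c) fun S _ => ?_).trans ?_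
    · rw [abs_mul, abs_pow, abs_neg, abs_one, one_pow, one_mul]
      exact h3 S
    · rw [Finset.sum_const, Finset.card_powerset, Finset.card_univ, nsmul_eq_mul]
      push_cast
      rw [mul_assoc]
  refine le_trans ?_ h5
  rw [abs_mul, Nat.abs_cast]
  exact le_mul_of_one_le_left (abs_nonneg _) (Nat.one_le_cast.2 Fintype.card_pos)

end Multilinear

theorem exists_abs_coeff_le (m : ℕ) {t₀ : ℝ} (ht₀ : 0 < t₀) :
    ∃ C : ℝ, 0 < C ∧ ∀ (a : ℕ → ℝ) (η : ℝ),
      (∀ t, 0 ≤ t → t ≤ t₀ → |∑ k ∈ range (m + 1), t ^ k * a k| ≤ η) →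
      ∀ k ∈ range (m + 1), |a k| ≤ C * η := by
  set t : Fin (m + 1) → ℝ := fun j => t₀ / (j + 1) with ht
  set V := Matrix.vandermonde t with hV
  have hinj : Function.Injective t := by
    intro i j hij
    have h1 : (0 : ℝ) < (i : ℕ) + 1 := by positivity
    have h2 : (0 : ℝ) < (j : ℕ) + 1 := by positivity
    simp only [ht] at hij
    rw [div_eq_div_iff h1.ne' h2.ne'] at hij
    have h3 := mul_left_cancel₀ ht₀.ne' hij
    have h4 : ((j : ℕ) : ℝ) = (i : ℕ) := by linarith
    exact Fin.ext (by exact_mod_cast h4.symm)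
  have hdet : IsUnit V.det := isUnit_iff_ne_zero.2 (Matrix.det_vandermonde_ne_zero_iff.2 hinj)
  refine ⟨1 + ∑ i, ∑ j, |V⁻¹ i j|, by positivity, fun a η h k hk => ?_⟩
  set b : Fin (m + 1) → ℝ := fun j => a j with hb
  have h1 : V⁻¹.mulVec (V.mulVec b) = b := by
    rw [Matrix.mulVec_mulVec, Matrix.nonsing_inv_mul _ hdet, Matrix.one_mulVec]
  have h2 : ∀ j, |V.mulVec b j| ≤ η := by
    intro j
    have h3 := h (t j) (by simp only [ht]; positivity) (by
      simp only [ht]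
      exact div_le_self ht₀.le (by linarith [Nat.cast_nonneg (α := ℝ) (j : ℕ)]))
    rwa [Finset.sum_range] at h3
  have hη : 0 ≤ η := (abs_nonneg _).trans (h2 0)
  have hk' : k < m + 1 := mem_range.1 hk
  have h4 : a k = ∑ j, V⁻¹ ⟨k, hk'⟩ j * V.mulVec b j :=
    (congrFun h1 ⟨k, hk'⟩).symm
  rw [h4]
  calc _ ≤ ∑ j, |V⁻¹ ⟨k, hk'⟩ j| * η := by
        refine (Finset.abs_sum_le_sum_abs _ _).trans (Finset.sum_le_sum fun j _ => ?_)
        rw [abs_mul]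
        exact mul_le_mul_of_nonneg_left (h2 j) (abs_nonneg _)
    _ = (∑ j, |V⁻¹ ⟨k, hk'⟩ j|) * η := by rw [Finset.sum_mul]
    _ ≤ (1 + ∑ i, ∑ j, |V⁻¹ i j|) * η := by
      gcongr
      have := Finset.single_le_sum (f := fun i => ∑ j, |V⁻¹ i j|)
        (fun i _ => Finset.sum_nonneg fun j _ => abs_nonneg _) (mem_univ (⟨k, hk'⟩ : Fin (m + 1)))
      linarith
theorem exists_pos_forall_admissible {ι : Type*} [Fintype ι] {α : ι → ℝ} (hα : ∀ i, 0 < α i) (hsum : ∑ i, α i ≤ 1) {c : ι → ℝ}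
    (hc : ∑ i, c i = 0 ∨ ∑ i, α i < 1) :
    ∃ t₀ : ℝ, 0 < t₀ ∧ ∀ t, 0 ≤ t → t ≤ t₀ → ∀ v : ℝ, |v| ≤ 1 →
      (∀ i, 0 ≤ α i + t * c i * v) ∧ ∑ i, (α i + t * c i * v) ≤ 1 := by
  obtain ⟨a, ha0, ha⟩ : ∃ a : ℝ, 0 < a ∧ ∀ i, a ≤ α i := by
    rcases isEmpty_or_nonempty ι with h | h
    · exact ⟨1, one_pos, fun i => (h.false i).elim⟩
    · obtain ⟨i, hi⟩ := Finite.exists_min α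
      exact ⟨α i, hα i, hi⟩
  obtain ⟨b, hb0, hb⟩ : ∃ b : ℝ, 0 < b ∧ (∑ i, c i = 0 ∨ b ≤ 1 - ∑ i, α i) := by
    rcases hc with h | h
    · exact ⟨1, one_pos, Or.inl h⟩
    · exact ⟨1 - ∑ i, α i, by linarith, Or.inr le_rfl⟩
  set L : ℝ := 1 + ∑ i, |c i| with hL
  have hL0 : 0 < L := by positivity
  refine ⟨min a b / L, by positivity, fun t ht0 ht v hv => ?_⟩
  have htL : t * L ≤ min a b := (le_div_iff₀ hL0).1 ht
  have hbound : ∀ z : ℝ, |z| ≤ L → |t * z * v| ≤ min a b := fun z hz => by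
    rw [abs_mul, abs_mul, abs_of_nonneg ht0]
    calc t * |z| * |v| ≤ t * L * 1 := by gcongr
      _ ≤ min a b := by linarith
  refine ⟨fun i => ?_, ?_⟩
  · have h1 : |c i| ≤ L := by
      have := Finset.single_le_sum (f := fun i => |c i|) (fun i _ => abs_nonneg _) (mem_univ i)
      linarith
    have h2 := (abs_le.1 (hbound _ h1)).1
    linarith [ha i, min_le_left a b]
  · have h3 : ∑ i, (α i + t * c i * v) = ∑ i, α i + t * (∑ i, c i) * v := by
      rw [Finset.sum_add_distrib, ← Finset.sum_mul, ← Finset.mul_sum]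
    rw [h3]
    rcases hb with h | h
    · rw [h]; simpa using hsum
    · have h1 : |∑ i, c i| ≤ L := (Finset.abs_sum_le_sum_abs _ _).trans (by linarith)
      have h2 := (abs_le.1 (hbound _ h1)).2
      linarith [min_le_right a b]

section Directions

variable {ι : Type*} [Fintype ι] [DecidableEq ι] {α : ι → ℝ}

theorem sum_powersetCard_one_mul_prod (hα : ∀ i, 0 < α i) (c : ι → ℝ) :
    ∑ S ∈ powersetCard 1 (univ : Finset ι), (∏ i ∈ S, c i) * ∏ i ∈ univ \ S, α i
      = (∏ i, α i) * ∑ i, c i / α i := by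
  rw [Finset.powersetCard_one, Finset.sum_map, Finset.mul_sum]
  refine Finset.sum_congr rfl fun i _ => ?_
  simp only [Function.Embedding.coeFn_mk, Finset.prod_singleton]
  rw [← Finset.mul_prod_erase univ α (mem_univ i), Finset.sdiff_singleton_eq_erase]
  have := (hα i).ne'
  field_simp

theorem exists_direction (hα : ∀ i, 0 < α i) (hsum : ∑ i, α i ≤ 1)
    (hne : α ≠ fun _ => 1 / (Fintype.card ι : ℝ)) {k : ℕ} (hk : k ≤ Fintype.card ι) :
    ∃ c : ι → ℝ, (∑ i, c i = 0 ∨ ∑ i, α i < 1) ∧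
      ∑ S ∈ powersetCard k (univ : Finset ι), (∏ i ∈ S, c i) * ∏ i ∈ univ \ S, α i ≠ 0 := by
  have hprod : ∀ S : Finset ι, ∏ i ∈ S, α i ≠ 0 := fun S =>
    Finset.prod_ne_zero_iff.2 fun i _ => (hα i).ne'
  rcases Nat.lt_or_ge k 2 with hk2 | hk2
  · interval_cases k
    · exact ⟨0, Or.inl (by simp), by simpa using hprod univ⟩
    · rcases hsum.lt_or_eq with h | h
      · obtain ⟨i⟩ : Nonempty ι := Fintype.card_pos_iff.1 hk
        refine ⟨Pi.single i 1, Or.inr h, ?_⟩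
        rw [sum_powersetCard_one_mul_prod hα]
        refine mul_ne_zero (hprod _) ?_
        rw [Finset.sum_eq_single i (fun j _ hj => by simp [hj]) (by simp)]
        simp [(hα i).ne']
      · obtain ⟨a, b, hab⟩ : ∃ a b, α a ≠ α b := by
          by_contra! hc
          refine hne (funext fun i => ?_)
          have h1 : ∑ j, α j = Fintype.card ι * α i := by
            rw [Finset.sum_congr rfl fun j _ => hc j i, Finset.sum_const, Finset.card_univ,
              nsmul_eq_mul]
          rw [h] at h1
          have : (Fintype.card ι : ℝ) ≠ 0 := fun h0 => by rw [h0, zero_mul] at h1; norm_num at h1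
          field_simp
          linarith
        have hab' : a ≠ b := fun h => hab (by rw [h])
        refine ⟨Pi.single a 1 - Pi.single b 1, Or.inl (by simp), ?_⟩
        rw [sum_powersetCard_one_mul_prod hα]
        refine mul_ne_zero (hprod _) ?_
        simp only [Pi.sub_apply, sub_div, Finset.sum_sub_distrib]
        rw [Finset.sum_eq_single a (fun j _ hj => by simp [hj]) (by simp),
          Finset.sum_eq_single b (fun j _ hj => by simp [hj]) (by simp)]
        simp only [Pi.single_eq_same, one_div]
        exact sub_ne_zero.2 fun h => hab (inv_injective h)
  · obtain ⟨S₀, -, hS₀⟩ := Finset.exists_subset_card_eq (s := (univ : Finset ι)) (by simpa using hk)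
    obtain ⟨j, hj⟩ : S₀.Nonempty := Finset.card_pos.1 (by omega)
    set A : ℝ := ∑ i ∈ S₀.erase j, α i with hA
    have hA0 : 0 < A := Finset.sum_pos (fun i _ => hα i)
      (Finset.card_pos.1 (by rw [Finset.card_erase_of_mem hj]; omega))
    set c : ι → ℝ := fun i => if i = j then -A else if i ∈ S₀ then α i else 0 with hc
    have hcj : ∀ i ∈ S₀.erase j, c i = α i := fun i hi => by
      simp only [hc, if_neg (ne_of_mem_erase hi), if_pos (mem_of_mem_erase hi)]
    have hc0 : ∀ i, i ∉ S₀ → c i = 0 := fun i hi => by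
      have : i ≠ j := fun h => hi (h ▸ hj)
      simp only [hc, if_neg this, if_neg hi]
    refine ⟨c, Or.inl ?_, ?_⟩
    · rw [← Finset.sum_subset (Finset.subset_univ S₀) (fun i _ hi => hc0 i hi),
        ← Finset.add_sum_erase _ _ hj, Finset.sum_congr rfl hcj]
      simp [hc, hA]
    · rw [Finset.sum_eq_single S₀]
      · refine mul_ne_zero (Finset.prod_ne_zero_iff.2 fun i hi => ?_) (hprod _)
        simp only [hc, if_pos hi]
        split_ifs
        · exact neg_ne_zero.2 hA0.ne'
        · exact (hα i).ne'
      · intro S hS hne'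
        obtain ⟨i, hi, hi'⟩ : ∃ i ∈ S, i ∉ S₀ := by
          by_contra! hcon
          exact hne' (Finset.eq_of_subset_of_card_le hcon
            (by rw [hS₀, (Finset.mem_powersetCard.1 hS).2]))
        rw [Finset.prod_eq_zero hi (hc0 i hi'), zero_mul]
      · intro h
        exact absurd (Finset.mem_powersetCard.2 ⟨Finset.subset_univ _, hS₀⟩) h

/-- A symmetric multilinear form that is small on fractional partitions with part sizes
proportional to `α` is small on the diagonal. -/
theorem exists_formSum_diag_le (hα : ∀ i, 0 < α i) (hsum : ∑ i, α i ≤ 1)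
    (hne : α ≠ fun _ => 1 / (Fintype.card ι : ℝ)) :
    ∃ C : ℝ, 0 < C ∧ ∀ (β : Type) [Fintype β] [Nonempty β] (Φ : (ι → β) → ℝ),
      (∀ (σ : Equiv.Perm ι) (φ : ι → β), Φ (φ ∘ σ) = Φ φ) → ∀ η : ℝ,
      (∀ u : ι → β → ℝ, (∀ i x, 0 ≤ u i x) → (∀ x, ∑ i, u i x ≤ 1) →
        (∀ i, ∑ x, u i x = α i * Fintype.card β) → |formSum Φ u| ≤ η) →
      ∀ w : β → ℝ, 0 ≤ w → w ≤ 1 → |formSum Φ (fun _ => w)| ≤ C * η := by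
  set n := Fintype.card ι with hn
  have hex : ∀ k ∈ range (n + 1), ∃ C : ℝ, 0 < C ∧
      ∀ (β : Type) [Fintype β] [Nonempty β] (Φ : (ι → β) → ℝ) (T : ℕ → ℝ) (v : β → ℝ) (η : ℝ),
      (∀ x, |v x| ≤ 1) → ∑ x, v x = 0 →
      (∀ S : Finset ι, formSum Φ (fun i => if i ∈ S then v else 1) = T S.card) →
      (∀ u : ι → β → ℝ, (∀ i x, 0 ≤ u i x) → (∀ x, ∑ i, u i x ≤ 1) →
        (∀ i, ∑ x, u i x = α i * Fintype.card β) → |formSum Φ u| ≤ η) → |T k| ≤ C * η := by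
    intro k hk
    obtain ⟨c, hc, hck⟩ := exists_direction hα hsum hne (Nat.lt_succ_iff.1 (mem_range.1 hk))
    obtain ⟨t₀, ht₀, hadm⟩ := exists_pos_forall_admissible hα hsum hc
    obtain ⟨C, hC0, hC⟩ := exists_abs_coeff_le n ht₀
    set e : ℕ → ℝ := fun k =>
      ∑ S ∈ powersetCard k (univ : Finset ι), (∏ i ∈ S, c i) * ∏ i ∈ univ \ S, α i with he
    have hek : 0 < |e k| := abs_pos.2 hck
    refine ⟨C / |e k|, by positivity, fun β _ _ Φ T v η hv hv0 hT h => ?_⟩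
    have h1 := hC (fun k => e k * T k) η (fun t ht0 ht => ?_) k hk
    · rw [abs_mul] at h1
      rw [div_mul_eq_mul_div, le_div_iff₀ hek, mul_comm]
      exact h1
    · have h2 := h (fun i => (t * c i) • v + α i • (1 : β → ℝ)) (fun i x => by
          have := (hadm t ht0 ht (v x) (hv x)).1 i
          simp only [Pi.add_apply, Pi.smul_apply, smul_eq_mul, Pi.one_apply]
          linarith) (fun x => by
          have := (hadm t ht0 ht (v x) (hv x)).2
          simp only [Pi.add_apply, Pi.smul_apply, smul_eq_mul, Pi.one_apply, mul_one]
          rwa [Finset.sum_congr rfl fun i _ => add_comm _ _]) (fun i => by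
          simp only [Pi.add_apply, Pi.smul_apply, smul_eq_mul, Pi.one_apply, mul_one,
            Finset.sum_add_distrib, ← Finset.mul_sum, hv0, Finset.sum_const, Finset.card_univ,
            nsmul_eq_mul]
          ring)
      rw [formSum_add, Finset.sum_powerset, Finset.card_univ] at h2
      have h3 : ∀ k, ∑ S ∈ powersetCard k (univ : Finset ι),
          formSum Φ (fun i => if i ∈ S then (t * c i) • v else α i • (1 : β → ℝ))
          = t ^ k * (e k * T k) := by
        intro k
        simp only [he]
        rw [Finset.sum_mul, Finset.mul_sum]
        refine Finset.sum_congr rfl fun S hS => ?_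
        have h4 : (fun i => if i ∈ S then (t * c i) • v else α i • (1 : β → ℝ))
            = fun i => (if i ∈ S then t * c i else α i) • (if i ∈ S then v else 1) := by
          funext i; split_ifs <;> rfl
        rw [h4, formSum_smul, hT, Finset.prod_ite, Finset.filter_mem_eq_inter,
          Finset.univ_inter, Finset.filter_notMem_eq_sdiff, Finset.prod_mul_distrib,
          Finset.prod_const, (Finset.mem_powersetCard.1 hS).2]
        ring
      simp only [h3] at h2
      exact h2
  choose! C hC0 hC using hex
  refine ⟨∑ k ∈ range (n + 1), 2 ^ n * C k, Finset.sum_pos (fun k hk => by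
    have := hC0 k hk; positivity) ⟨0, by simp⟩, fun β _ _ Φ hΦ η h w hw0 hw1 => ?_⟩
  set N : ℝ := (Fintype.card β : ℝ) with hN
  have hN0 : 0 < N := Nat.cast_pos.2 Fintype.card_pos
  set μ : ℝ := (∑ x, w x) / N with hμ
  have hμ0 : 0 ≤ μ := div_nonneg (Finset.sum_nonneg fun x _ => hw0 x) hN0.le
  have hμ1 : μ ≤ 1 := by
    rw [hμ, div_le_one hN0]
    calc ∑ x, w x ≤ ∑ x : β, (1 : ℝ) := Finset.sum_le_sum fun x _ => hw1 x
      _ = N := by simp [hN]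
  set v : β → ℝ := w - μ • 1 with hv
  have hv1 : ∀ x, |v x| ≤ 1 := fun x => by
    have h1 : 0 ≤ w x := hw0 x
    have h2 : w x ≤ 1 := hw1 x
    simp only [hv, Pi.sub_apply, Pi.smul_apply, Pi.one_apply, smul_eq_mul, mul_one]
    exact abs_le.2 ⟨by linarith, by linarith⟩
  have hv0 : ∑ x, v x = 0 := by
    simp only [hv, Pi.sub_apply, Pi.smul_apply, Pi.one_apply, smul_eq_mul, mul_one,
      Finset.sum_sub_distrib, Finset.sum_const, Finset.card_univ, nsmul_eq_mul, hμ]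
    field_simp
    simp [hN]
  obtain ⟨T, hT⟩ := exists_formSum_eq_card hΦ v 1
  have hTk : ∀ k ∈ range (n + 1), |T k| ≤ C k * η := fun k hk => hC k hk β Φ T v η hv1 hv0 hT h
  have h1 : (fun _ : ι => w) = fun _ : ι => v + μ • (1 : β → ℝ) := by
    funext _; simp [hv]
  rw [h1, formSum_add, Finset.sum_powerset, Finset.card_univ, Finset.sum_mul]
  refine (Finset.abs_sum_le_sum_abs _ _).trans (Finset.sum_le_sum fun k hk => ?_)
  refine (Finset.abs_sum_le_sum_abs _ _).trans ?_
  refine (Finset.sum_le_sum (g := fun _ => C k * η) fun S hS => ?_).trans ?_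
  · have h4 : (fun i => if i ∈ S then v else μ • (1 : β → ℝ))
        = fun i => (if i ∈ S then 1 else μ) • (if i ∈ S then v else 1) := by
      funext i; split_ifs <;> simp
    rw [h4, formSum_smul, hT, (Finset.mem_powersetCard.1 hS).2, abs_mul]
    have h5 : |∏ i, (if i ∈ S then 1 else μ)| ≤ 1 := by
      rw [Finset.abs_prod]
      refine Finset.prod_le_one (fun i _ => abs_nonneg _) fun i _ => ?_
      split_ifs
      · simp
      · rwa [abs_of_nonneg hμ0]
    calc _ ≤ 1 * |T k| := by gcongr
      _ ≤ _ := by rw [one_mul]; exact hTk k hk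
  · rw [Finset.sum_const, Finset.card_powersetCard, Finset.card_univ, nsmul_eq_mul, mul_assoc]
    have h6 : (Nat.choose n k : ℝ) ≤ 2 ^ n := by
      exact_mod_cast (Nat.choose_le_two_pow n k)
    have h7 : 0 ≤ C k * η := (abs_nonneg _).trans (hTk k hk)
    gcongr

end Directions
section Rounding

theorem sum_prod_mul_prod_comp {β κ ω : Type*} [Fintype β] [DecidableEq β] [Fintype κ] [Fintype ω]
    {q : β → ω → ℝ} (hq : ∀ x, ∑ o, q x o = 1) {ψ : κ → β} (hψ : Function.Injective ψ)
    (g : κ → ω → ℝ) :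
    ∑ τ : β → ω, (∏ x, q x (τ x)) * ∏ i, g i (τ (ψ i)) = ∏ i, ∑ o, q (ψ i) o * g i o := by
  set H : β → ω → ℝ := Function.extend ψ g (fun _ _ => 1) with hH
  have h1 : ∀ τ : β → ω, (∏ x, q x (τ x)) * ∏ i, g i (τ (ψ i)) = ∏ x, q x (τ x) * H x (τ x) := by
    intro τ
    rw [Finset.prod_mul_distrib]
    congr 1
    refine Fintype.prod_of_injective ψ hψ _ _ (fun x hx => ?_) fun i => ?_
    · rw [hH, Function.extend_apply' _ _ _ (by simpa using hx)]
    · rw [hH, hψ.extend_apply]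
  simp only [h1]
  rw [sum_prod_eq_prod_sum (fun x o => q x o * H x o)]
  refine (Fintype.prod_of_injective ψ hψ _ _ (fun x hx => ?_) fun i => ?_).symm
  · simp only [hH]
    rw [Function.extend_apply' _ _ _ (by simpa using hx)]
    simpa using hq x
  · simp only [hH]
    rw [hψ.extend_apply]

theorem sum_prod_eq_one {β ω : Type*} [Fintype β] [DecidableEq β] [Fintype ω]
    {q : β → ω → ℝ} (hq : ∀ x, ∑ o, q x o = 1) : ∑ τ : β → ω, ∏ x, q x (τ x) = 1 := by
  rw [sum_prod_eq_prod_sum q]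
  simp [hq]

theorem sum_prod_mul_sq_le {β ω : Type*} [Fintype β] [DecidableEq β] [Fintype ω]
    {q : β → ω → ℝ} (hq0 : ∀ x o, 0 ≤ q x o) (hq : ∀ x, ∑ o, q x o = 1) (h : β → ω → ℝ)
    (hh : ∀ x o, |h x o| ≤ 1) (hh0 : ∀ x, ∑ o, q x o * h x o = 0) :
    ∑ τ : β → ω, (∏ x, q x (τ x)) * (∑ x, h x (τ x)) ^ 2 ≤ Fintype.card β := by
  have h1 : ∀ x y, ∑ τ : β → ω, (∏ z, q z (τ z)) * (h x (τ x) * h y (τ y))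
      ≤ if x = y then 1 else 0 := by
    intro x y
    split_ifs with hxy
    · subst hxy
      calc _ ≤ ∑ τ : β → ω, ∏ z, q z (τ z) := by
            refine Finset.sum_le_sum fun τ _ => ?_
            refine mul_le_of_le_one_right (Finset.prod_nonneg fun z _ => hq0 z _) ?_
            rw [← abs_mul_abs_self]
            exact mul_le_one₀ (hh _ _) (abs_nonneg _) (hh _ _)
        _ = 1 := sum_prod_eq_one hq
    · have hinj : Function.Injective ![x, y] := by
        intro i j hij
        fin_cases i <;> fin_cases j <;> simp_all [eq_comm]
      have h2 := sum_prod_mul_prod_comp hq hinj ![h x, h y]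
      simp only [Fin.prod_univ_two, Matrix.cons_val_zero, Matrix.cons_val_one, hh0,
        zero_mul] at h2
      exact h2.le
  calc _ = ∑ x, ∑ y, ∑ τ : β → ω, (∏ z, q z (τ z)) * (h x (τ x) * h y (τ y)) := by
        simp only [sq, Finset.sum_mul_sum]
        simp only [Finset.mul_sum]
        rw [Finset.sum_comm]
        exact Finset.sum_congr rfl fun x _ => Finset.sum_comm
    _ ≤ ∑ x : β, ∑ y : β, if x = y then (1 : ℝ) else 0 :=
        Finset.sum_le_sum fun x _ => Finset.sum_le_sum fun y _ => h1 x y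
    _ = Fintype.card β := by simp

theorem sum_prod_mul_abs_le {β ω : Type*} [Fintype β] [Nonempty β] [DecidableEq β] [Fintype ω]
    {q : β → ω → ℝ} (hq0 : ∀ x o, 0 ≤ q x o) (hq : ∀ x, ∑ o, q x o = 1) (h : β → ω → ℝ)
    (hh : ∀ x o, |h x o| ≤ 1) (hh0 : ∀ x, ∑ o, q x o * h x o = 0) :
    ∑ τ : β → ω, (∏ x, q x (τ x)) * |∑ x, h x (τ x)| ≤ √(Fintype.card β) := by
  set N : ℝ := (Fintype.card β : ℝ) with hN
  have hN0 : 0 < N := Nat.cast_pos.2 Fintype.card_pos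
  set r := √N with hr
  have hr0 : 0 < r := Real.sqrt_pos.2 hN0
  have hrr : r * r = N := Real.mul_self_sqrt hN0.le
  have h1 : ∀ z : ℝ, |z| ≤ (z ^ 2 / r + r) / 2 := fun z => by
    have h2 : z ^ 2 / r + r - 2 * |z| = (|z| - r) ^ 2 / r := by
      rw [← sq_abs z]; field_simp; ring
    have : 0 ≤ (|z| - r) ^ 2 / r := by positivity
    linarith
  calc _ ≤ ∑ τ : β → ω, (∏ x, q x (τ x)) * (((∑ x, h x (τ x)) ^ 2 / r + r) / 2) :=
        Finset.sum_le_sum fun τ _ => mul_le_mul_of_nonneg_left (h1 _)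
          (Finset.prod_nonneg fun z _ => hq0 z _)
    _ = ((∑ τ : β → ω, (∏ x, q x (τ x)) * (∑ x, h x (τ x)) ^ 2) / r
          + r * ∑ τ : β → ω, ∏ x, q x (τ x)) / 2 := by
        rw [Finset.sum_div, Finset.mul_sum, ← Finset.sum_add_distrib, Finset.sum_div]
        exact Finset.sum_congr rfl fun τ _ => by ring
    _ ≤ (N / r + r * 1) / 2 := by
        rw [sum_prod_eq_one hq]
        have := sum_prod_mul_sq_le hq0 hq h hh hh0
        gcongr
    _ = r := by rw [← hrr]; field_simp; ring

theorem exists_disjoint_extension {ι β : Type*} [Fintype ι] [DecidableEq ι] [Fintype β]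
    [DecidableEq β] {n : ι → ℕ} (hn : ∑ i, n i ≤ Fintype.card β) {U : ι → Finset β}
    (hU : Pairwise fun i j => Disjoint (U i) (U j)) (hUn : ∀ i, (U i).card ≤ n i) :
    ∃ U' : ι → Finset β, (Pairwise fun i j => Disjoint (U' i) (U' j)) ∧
      (∀ i, (U' i).card = n i) ∧ ∀ i, U i ⊆ U' i := by
  obtain ⟨d, hd⟩ : ∃ d, d = ∑ i, (n i - (U i).card) := ⟨_, rfl⟩
  induction d generalizing U with
  | zero =>
    refine ⟨U, hU, fun i => ?_, fun i => Subset.rfl⟩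
    have := (Finset.sum_eq_zero_iff.1 hd.symm) i (mem_univ i)
    have := hUn i
    omega
  | succ d ih =>
    obtain ⟨i, -, hi⟩ : ∃ i ∈ univ, n i - (U i).card ≠ 0 :=
      Finset.exists_ne_zero_of_sum_ne_zero (by omega)
    have hlt : (univ.biUnion U).card < Fintype.card β := by
      rw [Finset.card_biUnion fun a _ b _ hab => hU hab]
      exact lt_of_lt_of_le (Finset.sum_lt_sum (fun j _ => hUn j) ⟨i, mem_univ i, by omega⟩) hn
    obtain ⟨x, hx⟩ : ∃ x, x ∉ univ.biUnion U := by
      by_contra! hc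
      have := Finset.eq_univ_iff_forall.2 hc
      rw [this, Finset.card_univ] at hlt
      exact lt_irrefl _ hlt
    have hx' : ∀ j, x ∉ U j := fun j hj => hx (Finset.mem_biUnion.2 ⟨j, mem_univ j, hj⟩)
    obtain ⟨U', h1, h2, h3⟩ := ih (U := Function.update U i (insert x (U i))) (by
        intro a b hab
        rcases eq_or_ne a i with rfl | ha <;> rcases eq_or_ne b a with rfl | hb
        · exact absurd rfl hab
        · rw [Function.update_self, Function.update_of_ne hb, Finset.disjoint_insert_left]
          exact ⟨hx' b, hU hab⟩
        · exact absurd rfl hab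
        · rw [Function.update_of_ne ha]
          rcases eq_or_ne b i with rfl | hbi
          · rw [Function.update_self, Finset.disjoint_insert_right]
            exact ⟨hx' a, hU hab⟩
          · rw [Function.update_of_ne hbi]
            exact hU hab) (by
        intro j
        rcases eq_or_ne j i with rfl | hj
        · rw [Function.update_self, Finset.card_insert_of_notMem (hx' j)]
          omega
        · rw [Function.update_of_ne hj]
          exact hUn j) (by
        rw [← Finset.add_sum_erase _ _ (mem_univ i)] at hd ⊢
        rw [Function.update_self, Finset.card_insert_of_notMem (hx' i),
          Finset.sum_congr rfl (g := fun j => n j - (U j).card) (fun j hj => by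
            rw [Function.update_of_ne (ne_of_mem_erase hj)])]
        omega)
    refine ⟨U', h1, h2, fun j => ?_⟩
    rcases eq_or_ne j i with rfl | hj
    · have := h3 j
      rw [Function.update_self] at this
      exact (Finset.subset_insert _ _).trans this
    · have := h3 j
      rwa [Function.update_of_ne hj] at this

theorem exists_disjoint_of_card {ι β : Type*} [Fintype ι] [DecidableEq ι] [Fintype β]
    [DecidableEq β] {n : ι → ℕ} (hn : ∑ i, n i ≤ Fintype.card β) {U : ι → Finset β}
    (hU : Pairwise fun i j => Disjoint (U i) (U j)) :
    ∃ U' : ι → Finset β, (Pairwise fun i j => Disjoint (U' i) (U' j)) ∧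
      (∀ i, (U' i).card = n i) ∧
      ∀ i, ∑ x, |(if x ∈ U i then (1 : ℝ) else 0) - (if x ∈ U' i then 1 else 0)|
        = |((U i).card : ℝ) - n i| := by
  have hV : ∀ i, ∃ V ⊆ U i, V.card = min (U i).card (n i) := fun i =>
    Finset.exists_subset_card_eq (min_le_left _ _)
  choose V hVU hVc using hV
  obtain ⟨U', h1, h2, h3⟩ := exists_disjoint_extension hn (U := V)
    (fun i j hij => (hU hij).mono (hVU i) (hVU j)) (fun i => by rw [hVc]; exact min_le_right _ _)
  refine ⟨U', h1, h2, fun i => ?_⟩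
  have hind : ∀ S : Finset β, ∑ x, (if x ∈ S then (1 : ℝ) else 0) = S.card := fun S => by simp
  rcases le_total (n i) (U i).card with h | h
  · have hV' : V i = U' i := Finset.eq_of_subset_of_card_le (h3 i) (by rw [h2, hVc, min_eq_right h])
    have hsub : U' i ⊆ U i := hV' ▸ hVU i
    rw [abs_of_nonneg (sub_nonneg.2 (by exact_mod_cast h)), ← h2 i, ← hind, ← hind,
      ← Finset.sum_sub_distrib]
    refine Finset.sum_congr rfl fun x _ => abs_of_nonneg ?_
    by_cases hx : x ∈ U' i
    · simp [hx, hsub hx]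
    · simp only [hx, if_false, sub_zero]; split_ifs <;> norm_num
  · have hV' : V i = U i := Finset.eq_of_subset_of_card_le (hVU i) (by rw [hVc, min_eq_left h])
    have hsub : U i ⊆ U' i := hV' ▸ h3 i
    rw [abs_of_nonpos (sub_nonpos.2 (by exact_mod_cast h)), neg_sub, ← h2 i, ← hind, ← hind,
      ← Finset.sum_sub_distrib]
    refine Finset.sum_congr rfl fun x _ => ?_
    rw [abs_sub_comm]
    refine abs_of_nonneg ?_
    by_cases hx : x ∈ U i
    · simp [hx, hsub hx]
    · simp only [hx, if_false, sub_zero]; split_ifs <;> norm_num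

end Rounding

section FractionalRounding

theorem abs_prod_sub_prod_le {ι : Type*} [DecidableEq ι] (s : Finset ι) {a b : ι → ℝ} (ha0 : ∀ i, 0 ≤ a i)
    (ha1 : ∀ i, a i ≤ 1) (hb0 : ∀ i, 0 ≤ b i) (hb1 : ∀ i, b i ≤ 1) :
    |∏ i ∈ s, a i - ∏ i ∈ s, b i| ≤ ∑ i ∈ s, |a i - b i| := by
  induction s using Finset.induction_on with
  | empty => simp
  | insert i s hi ih =>
    rw [Finset.prod_insert hi, Finset.prod_insert hi, Finset.sum_insert hi]
    have h1 : a i * ∏ j ∈ s, a j - b i * ∏ j ∈ s, b j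
        = (a i - b i) * ∏ j ∈ s, a j + b i * (∏ j ∈ s, a j - ∏ j ∈ s, b j) := by ring
    rw [h1]
    refine (abs_add_le _ _).trans (add_le_add ?_ ?_)
    · rw [abs_mul]
      refine mul_le_of_le_one_right (abs_nonneg _) ?_
      rw [abs_of_nonneg (Finset.prod_nonneg fun j _ => ha0 j)]
      exact Finset.prod_le_one (fun j _ => ha0 j) fun j _ => ha1 j
    · rw [abs_mul, abs_of_nonneg (hb0 i)]
      exact (mul_le_of_le_one_left (abs_nonneg _) (hb1 i)).trans ih

variable {ι β : Type*} [Fintype ι] [DecidableEq ι] [Fintype β]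

theorem sum_comp_eval_mul_card (i : ι) (h : β → ℝ) :
    (∑ φ : ι → β, h (φ i)) * Fintype.card β
      = (Fintype.card β : ℝ) ^ Fintype.card ι * ∑ x, h x := by
  have h1 := sum_prod_eq_prod_sum (fun (j : ι) (x : β) => if j = i then h x else 1)
  have h2 : ∀ φ : ι → β, ∏ j, (if j = i then h (φ j) else 1) = h (φ i) := fun φ => by simp
  have h3 : ∀ j, ∑ x, (if j = i then h x else 1)
      = if j = i then ∑ x, h x else (Fintype.card β : ℝ) := fun j => by split_ifs <;> simp
  simp only [h2, h3] at h1
  rw [h1, ← Finset.mul_prod_erase _ _ (mem_univ i),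
    Finset.prod_congr rfl (g := fun _ => (Fintype.card β : ℝ)) (fun j hj => by
      rw [if_neg (ne_of_mem_erase hj)])]
  rw [Finset.prod_const, if_pos rfl, mul_assoc, ← pow_succ, Finset.card_erase_of_mem (mem_univ i),
    Finset.card_univ, Nat.sub_add_cancel (Fintype.card_pos_iff.2 ⟨i⟩), mul_comm]

theorem abs_formSum_sub_le {Φ : (ι → β) → ℝ} {B : ℝ} (hΦ : ∀ φ, |Φ φ| ≤ B)
    {a b : ι → β → ℝ} (ha0 : ∀ i x, 0 ≤ a i x) (ha1 : ∀ i x, a i x ≤ 1)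
    (hb0 : ∀ i x, 0 ≤ b i x) (hb1 : ∀ i x, b i x ≤ 1) :
    |formSum Φ a - formSum Φ b| * Fintype.card β
      ≤ B * (Fintype.card β : ℝ) ^ Fintype.card ι * ∑ i, ∑ x, |a i x - b i x| := by
  have h1 : |formSum Φ a - formSum Φ b| ≤ ∑ φ : ι → β, B * ∑ i, |a i (φ i) - b i (φ i)| := by
    unfold formSum
    rw [← Finset.sum_sub_distrib]
    refine (Finset.abs_sum_le_sum_abs _ _).trans (Finset.sum_le_sum fun φ _ => ?_)
    rw [← mul_sub, abs_mul]
    exact mul_le_mul (hΦ φ) (abs_prod_sub_prod_le univ (fun i => ha0 i _) (fun i => ha1 i _)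
      (fun i => hb0 i _) fun i => hb1 i _) (abs_nonneg _) ((abs_nonneg _).trans (hΦ φ))
  refine (mul_le_mul_of_nonneg_right h1 (Nat.cast_nonneg _)).trans (le_of_eq ?_)
  rw [← Finset.mul_sum, Finset.sum_comm, mul_assoc B, mul_assoc B]
  congr 1
  rw [Finset.sum_mul, Finset.mul_sum]
  exact Finset.sum_congr rfl fun i _ => sum_comp_eval_mul_card i fun x => |a i x - b i x|

theorem pow_succ_le_descFactorial (N m : ℕ) :
    (N : ℝ) ^ (m + 1) ≤ N * N.descFactorial m + (m : ℝ) ^ 2 * (N : ℝ) ^ m := by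
  induction m with
  | zero => simp
  | succ m ih =>
    rcases le_total m N with h | h
    · rw [Nat.descFactorial_succ, Nat.cast_mul, Nat.cast_sub h]
      have hNm : (0 : ℝ) ≤ N - m := sub_nonneg.2 (by exact_mod_cast h)
      have h1 := mul_le_mul_of_nonneg_left ih hNm
      have h2 : (0 : ℝ) ≤ (m : ℝ) ^ 3 * (N : ℝ) ^ m := by positivity
      have h3 : (0 : ℝ) ≤ (m + 1) * (N : ℝ) ^ (m + 1) := by positivity
      push_cast
      rw [pow_succ] at h1 h3 ⊢
      rw [pow_succ]
      nlinarith
    · have h1 : (N : ℝ) ≤ ((m + 1 : ℕ) : ℝ) ^ 2 := by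
        have : (N : ℝ) ≤ m := by exact_mod_cast h
        have : (0 : ℝ) ≤ m := Nat.cast_nonneg m
        push_cast
        nlinarith
      have h2 : (N : ℝ) ^ (m + 1 + 1) ≤ ((m + 1 : ℕ) : ℝ) ^ 2 * (N : ℝ) ^ (m + 1) := by
        rw [pow_succ, mul_comm]
        gcongr
      have h3 : (0 : ℝ) ≤ N * N.descFactorial (m + 1) := by positivity
      linarith

theorem sum_not_injective_mul_card_le (ι β : Type*) [Fintype ι] [DecidableEq ι] [Fintype β]
    [DecidablePred fun φ : ι → β => Function.Injective φ] :
    (∑ φ : ι → β, if Function.Injective φ then (0 : ℝ) else 1) * Fintype.card β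
      ≤ (Fintype.card ι : ℝ) ^ 2 * (Fintype.card β : ℝ) ^ Fintype.card ι := by
  have h1 : ∑ φ : ι → β, (if Function.Injective φ then (1 : ℝ) else 0)
      = (Fintype.card β).descFactorial (Fintype.card ι) := by
    rw [Finset.sum_boole, ← Fintype.card_embedding_eq,
      ← Fintype.card_congr (Equiv.subtypeInjectiveEquivEmbedding ι β), Fintype.card_subtype]
  have h2 : ∑ φ : ι → β, (if Function.Injective φ then (0 : ℝ) else 1)
      = (Fintype.card β : ℝ) ^ Fintype.card ι
        - (Fintype.card β).descFactorial (Fintype.card ι) := by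
    rw [← h1, eq_sub_iff_add_eq, ← Finset.sum_add_distrib,
      Finset.sum_congr rfl (g := fun _ => (1 : ℝ)) (fun φ _ => by split_ifs <;> norm_num)]
    simp
  rw [h2]
  have := pow_succ_le_descFactorial (Fintype.card β) (Fintype.card ι)
  rw [pow_succ] at this
  linarith

theorem abs_formSum_mul_card_le [DecidableEq β] [Nonempty β] {α : ι → ℝ} (hα : ∀ i, 0 ≤ α i) (hsum : ∑ i, α i ≤ 1)
    {Φ : (ι → β) → ℝ} {B η : ℝ} (hΦ : ∀ φ, |Φ φ| ≤ B)
    (h : ∀ U : ι → Finset β, (Pairwise fun i j => Disjoint (U i) (U j)) →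
      (∀ i, (U i).card = ⌊α i * (Fintype.card β : ℝ)⌋₊) →
      |formSum Φ (fun i x => if x ∈ U i then 1 else 0)| ≤ η)
    {u : ι → β → ℝ} (hu0 : ∀ i x, 0 ≤ u i x) (hu1 : ∀ x, ∑ i, u i x ≤ 1)
    (hu : ∀ i, ∑ x, u i x = α i * Fintype.card β) :
    |formSum Φ u| * Fintype.card β ≤ η * Fintype.card β
      + B * (Fintype.card β : ℝ) ^ Fintype.card ι
        * (Fintype.card ι ^ 2 + Fintype.card ι * (√(Fintype.card β) + 1)) := by
  classical
  set N : ℝ := (Fintype.card β : ℝ) with hN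
  have hN0 : 0 < N := Nat.cast_pos.2 Fintype.card_pos
  have hB0 : 0 ≤ B := (abs_nonneg _).trans (hΦ fun _ => Classical.arbitrary β)
  have hui : ∀ i x, u i x ≤ 1 := fun i x =>
    (Finset.single_le_sum (f := fun i => u i x) (fun j _ => hu0 j x) (mem_univ i)).trans (hu1 x)
  -- independent random assignment of the vertices to the parts
  set q : β → Option ι → ℝ := fun x o => o.elim (1 - ∑ i, u i x) (fun i => u i x) with hqdef
  have hq0 : ∀ x o, 0 ≤ q x o := by
    rintro x (_ | i)
    · exact sub_nonneg.2 (hu1 x)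
    · exact hu0 i x
  have hq : ∀ x, ∑ o, q x o = 1 := fun x => by rw [Fintype.sum_option]; simp [hqdef]
  set I : (β → Option ι) → ι → β → ℝ := fun τ i x => if τ x = some i then 1 else 0 with hI
  set P : (β → Option ι) → ℝ := fun τ => ∏ x, q x (τ x) with hP
  have hP0 : ∀ τ, 0 ≤ P τ := fun τ => Finset.prod_nonneg fun x _ => hq0 x _
  have hP1 : ∑ τ, P τ = 1 := sum_prod_eq_one hq
  have hI0 : ∀ τ i x, 0 ≤ I τ i x := fun τ i x => by simp only [hI]; split_ifs <;> norm_num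
  have hI1 : ∀ τ i x, I τ i x ≤ 1 := fun τ i x => by simp only [hI]; split_ifs <;> norm_num
  have hqi : ∀ i x, ∑ o, q x o * (if o = some i then (1 : ℝ) else 0) = u i x := fun i x => by
    simp [hqdef]
  -- the expected form
  have hE1 : |formSum Φ u - ∑ τ, P τ * formSum Φ (I τ)| * N
      ≤ B * (Fintype.card ι ^ 2 * N ^ Fintype.card ι) := by
    have e1 : ∑ τ, P τ * formSum Φ (I τ)
        = ∑ φ : ι → β, Φ φ * ∑ τ, P τ * ∏ i, I τ i (φ i) := by
      unfold formSum
      simp only [Finset.mul_sum]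
      rw [Finset.sum_comm]
      exact Finset.sum_congr rfl fun φ _ => Finset.sum_congr rfl fun τ _ => by ring
    have e2 : |formSum Φ u - ∑ τ, P τ * formSum Φ (I τ)|
        ≤ ∑ φ : ι → β, B * if Function.Injective φ then (0 : ℝ) else 1 := by
      rw [e1]
      unfold formSum
      rw [← Finset.sum_sub_distrib]
      refine (Finset.abs_sum_le_sum_abs _ _).trans (Finset.sum_le_sum fun φ _ => ?_)
      rw [← mul_sub, abs_mul]
      refine mul_le_mul (hΦ φ) ?_ (abs_nonneg _) hB0
      split_ifs with hφ
      · have := sum_prod_mul_prod_comp hq hφ fun i o => if o = some i then (1 : ℝ) else 0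
        simp only [hqi] at this
        simp only [hP, hI]
        rw [this, sub_self, abs_zero]
      · have a0 : 0 ≤ ∏ i, u i (φ i) := Finset.prod_nonneg fun i _ => hu0 i _
        have a1 : ∏ i, u i (φ i) ≤ 1 := Finset.prod_le_one (fun i _ => hu0 i _) fun i _ => hui i _
        have b0 : 0 ≤ ∑ τ, P τ * ∏ i, I τ i (φ i) := Finset.sum_nonneg fun τ _ =>
          mul_nonneg (hP0 τ) (Finset.prod_nonneg fun i _ => hI0 τ i _)
        have b1 : ∑ τ, P τ * ∏ i, I τ i (φ i) ≤ 1 := by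
          rw [← hP1]
          exact Finset.sum_le_sum fun τ _ => mul_le_of_le_one_right (hP0 τ)
            (Finset.prod_le_one (fun i _ => hI0 τ i _) fun i _ => hI1 τ i _)
        rw [abs_le]
        constructor <;> linarith
    rw [← Finset.mul_sum] at e2
    refine (mul_le_mul_of_nonneg_right e2 hN0.le).trans ?_
    rw [mul_assoc]
    exact mul_le_mul_of_nonneg_left (sum_not_injective_mul_card_le ι β) hB0
  have hfl : ∑ i, ⌊α i * N⌋₊ ≤ Fintype.card β := by
    have : ((∑ i, ⌊α i * N⌋₊ : ℕ) : ℝ) ≤ N := by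
      push_cast
      calc ∑ i, (⌊α i * N⌋₊ : ℝ) ≤ ∑ i, α i * N :=
            Finset.sum_le_sum fun i _ => Nat.floor_le (mul_nonneg (hα i) hN0.le)
        _ = (∑ i, α i) * N := by rw [Finset.sum_mul]
        _ ≤ N := mul_le_of_le_one_left hN0.le hsum
    exact Nat.cast_le.1 this
  have hτ : ∀ τ, |formSum Φ (I τ)| * N ≤ η * N
      + B * N ^ Fintype.card ι * ∑ i, (|∑ x, (I τ i x - u i x)| + 1) := by
    intro τ
    set U : ι → Finset β := fun i => univ.filter fun x => τ x = some i with hU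
    have hUd : Pairwise fun i j => Disjoint (U i) (U j) := by
      intro i j hij
      rw [Finset.disjoint_left]
      intro x hx hx'
      simp only [hU, mem_filter, mem_univ, true_and] at hx hx'
      exact hij (Option.some_injective _ (hx.symm.trans hx'))
    obtain ⟨U', h1, h2, h3⟩ := exists_disjoint_of_card hfl hUd
    have hIU : I τ = fun i x => if x ∈ U i then 1 else 0 := by
      funext i x
      simp [hI, hU]
    have h4 := abs_formSum_sub_le hΦ (a := I τ) (b := fun i x => if x ∈ U' i then 1 else 0)
      (hI0 τ) (hI1 τ) (fun i x => by split_ifs <;> norm_num)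
      (fun i x => by split_ifs <;> norm_num)
    have h5 : |formSum Φ (I τ)| ≤ |formSum Φ (I τ)
        - formSum Φ (fun i x => if x ∈ U' i then 1 else 0)| + η := by
      have e1 := h U' h1 h2
      have e2 := abs_add_le (formSum Φ (I τ) - formSum Φ (fun i x => if x ∈ U' i then 1 else 0))
        (formSum Φ (fun i x => if x ∈ U' i then 1 else 0))
      rw [sub_add_cancel] at e2
      linarith
    have h6 : ∑ i, ∑ x, |I τ i x - (if x ∈ U' i then 1 else 0)|
        ≤ ∑ i, (|∑ x, (I τ i x - u i x)| + 1) := by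
      refine Finset.sum_le_sum fun i _ => ?_
      have e1 : ∑ x, (I τ i x - u i x) = ((U i).card : ℝ) - α i * N := by
        rw [Finset.sum_sub_distrib, hu, hIU]
        simp
      rw [hIU] at e1 ⊢
      rw [h3 i, e1]
      have e2 := Nat.floor_le (mul_nonneg (hα i) hN0.le)
      have e3 := Nat.lt_floor_add_one (α i * N)
      have e4 := abs_add_le (((U i).card : ℝ) - α i * N) (α i * N - ⌊α i * N⌋₊)
      rw [sub_add_sub_cancel, abs_of_nonneg (a := α i * N - ⌊α i * N⌋₊) (by linarith)] at e4
      linarith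
    have h7 := mul_le_mul_of_nonneg_left h6
      (mul_nonneg hB0 (pow_nonneg hN0.le (Fintype.card ι)))
    nlinarith [mul_le_mul_of_nonneg_right h5 hN0.le]
  have hE2 : |∑ τ, P τ * formSum Φ (I τ)| * N ≤ η * N
      + B * N ^ Fintype.card ι * (Fintype.card ι * (√N + 1)) := by
    have hdev : ∀ i, ∑ τ, P τ * |∑ x, (I τ i x - u i x)| ≤ √N := by
      intro i
      refine sum_prod_mul_abs_le hq0 hq (fun x o => (if o = some i then (1 : ℝ) else 0) - u i x)
        (fun x o => ?_) fun x => ?_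
      · have := hu0 i x
        have := hui i x
        rw [abs_le]
        split_ifs <;> constructor <;> linarith
      · simp only [mul_sub, Finset.sum_sub_distrib, hqi, ← Finset.sum_mul, hq]
        ring
    calc |∑ τ, P τ * formSum Φ (I τ)| * N
        ≤ ∑ τ, P τ * (|formSum Φ (I τ)| * N) := by
          simp only [← mul_assoc, ← Finset.sum_mul]
          refine mul_le_mul_of_nonneg_right ((Finset.abs_sum_le_sum_abs _ _).trans (le_of_eq ?_))
            hN0.le
          exact Finset.sum_congr rfl fun τ _ => by rw [abs_mul, abs_of_nonneg (hP0 τ)]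
      _ ≤ ∑ τ, P τ * (η * N + B * N ^ Fintype.card ι * ∑ i, (|∑ x, (I τ i x - u i x)| + 1)) :=
          Finset.sum_le_sum fun τ _ => mul_le_mul_of_nonneg_left (hτ τ) (hP0 τ)
      _ = η * N + B * N ^ Fintype.card ι
            * ∑ i, ((∑ τ, P τ * |∑ x, (I τ i x - u i x)|) + 1) := by
          have e1 : ∑ i, ((∑ τ, P τ * |∑ x, (I τ i x - u i x)|) + 1)
              = ∑ τ, P τ * ∑ i, (|∑ x, (I τ i x - u i x)| + 1) := by
            simp only [Finset.mul_sum]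
            rw [Finset.sum_comm]
            refine Finset.sum_congr rfl fun i _ => ?_
            simp only [mul_add, mul_one, Finset.sum_add_distrib, hP1]
          have e2 : η * N = ∑ τ, P τ * (η * N) := by rw [← Finset.sum_mul, hP1, one_mul]
          conv_rhs => rw [e1, e2, Finset.mul_sum, ← Finset.sum_add_distrib]
          exact Finset.sum_congr rfl fun τ _ => by ring
      _ ≤ η * N + B * N ^ Fintype.card ι * ∑ i : ι, (√N + 1) := by
          gcongr
          exact hdev _
      _ = _ := by rw [Finset.sum_const, Finset.card_univ, nsmul_eq_mul]
  have hfin : |formSum Φ u| ≤ |formSum Φ u - ∑ τ, P τ * formSum Φ (I τ)|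
      + |∑ τ, P τ * formSum Φ (I τ)| := by
    have := abs_add_le (formSum Φ u - ∑ τ, P τ * formSum Φ (I τ)) (∑ τ, P τ * formSum Φ (I τ))
    rwa [sub_add_cancel] at this
  nlinarith [mul_le_mul_of_nonneg_right hfin hN0.le]

end FractionalRounding

section Counts

open Classical in
/-- The edges of `F`, each recorded once as an increasing pair of vertices. -/
noncomputable def edgePairs {m : ℕ} (F : SimpleGraph (Fin m)) : Finset (Fin m × Fin m) :=
  univ.filter fun e => e.1 < e.2 ∧ F.Adj e.1 e.2

open Classical in
/-- The `0`-`1` adjacency kernel of a graph. -/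
noncomputable def adjKernel {β : Type*} (G : SimpleGraph β) (x y : β) : ℝ :=
  if G.Adj x y then 1 else 0

theorem adjKernel_symm {β : Type*} (G : SimpleGraph β) (x y : β) :
    adjKernel G x y = adjKernel G y x := by
  classical exact if_congr (G.adj_comm x y) rfl rfl

theorem adjKernel_nonneg {β : Type*} (G : SimpleGraph β) (x y : β) : 0 ≤ adjKernel G x y := by
  unfold adjKernel; split_ifs <;> norm_num

theorem adjKernel_le_one {β : Type*} (G : SimpleGraph β) (x y : β) : adjKernel G x y ≤ 1 := by
  unfold adjKernel; split_ifs <;> norm_num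

variable {m : ℕ}

theorem mem_edgePairs {F : SimpleGraph (Fin m)} {e : Fin m × Fin m} :
    e ∈ edgePairs F ↔ e.1 < e.2 ∧ F.Adj e.1 e.2 := by
  simp [edgePairs]

theorem numEdges_eq_card (F : SimpleGraph (Fin m)) : numEdges F = (edgePairs F).card := by
  classical
  have h1 : ((edgePairs F).image fun e => s(e.1, e.2)) = F.edgeFinset := by
    ext z
    induction z using Sym2.ind with
    | _ a b =>
      simp only [Finset.mem_image, mem_edgePairs, SimpleGraph.mem_edgeFinset,
        SimpleGraph.mem_edgeSet, Prod.exists]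
      constructor
      · rintro ⟨x, y, ⟨-, hadj⟩, hxy⟩
        rw [← SimpleGraph.mem_edgeSet, ← hxy]
        exact hadj
      · intro hab
        rcases lt_or_gt_of_ne hab.ne with h | h
        · exact ⟨a, b, ⟨h, hab⟩, rfl⟩
        · exact ⟨b, a, ⟨h, hab.symm⟩, Sym2.eq_swap⟩
  have h2 : Set.InjOn (fun e : Fin m × Fin m => s(e.1, e.2)) (edgePairs F) := by
    rintro ⟨a, b⟩ he ⟨c, d⟩ he' h
    have h3 := (mem_edgePairs.1 he).1
    have h4 := (mem_edgePairs.1 he').1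
    simp only at h3 h4
    rcases Sym2.eq_iff.1 h with ⟨rfl, rfl⟩ | ⟨rfl, rfl⟩
    · rfl
    · exact absurd h3 h4.asymm
  rw [numEdges, ← Finset.card_image_of_injOn h2, h1, SimpleGraph.edgeFinset_card,
    Nat.card_eq_fintype_card]

variable {β : Type*}

open Classical in
theorem prod_adjKernel (F : SimpleGraph (Fin m)) (G : SimpleGraph β) (φ : Fin m → β) :
    ∏ e ∈ edgePairs F, adjKernel G (φ e.1) (φ e.2)
      = if ∀ i j, F.Adj i j → G.Adj (φ i) (φ j) then 1 else 0 := by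
  have h : (∀ e ∈ edgePairs F, G.Adj (φ e.1) (φ e.2)) ↔ ∀ i j, F.Adj i j → G.Adj (φ i) (φ j) := by
    refine ⟨fun h i j hij => ?_, fun h e he => h _ _ (mem_edgePairs.1 he).2⟩
    rcases lt_or_gt_of_ne hij.ne with hlt | hlt
    · exact h (i, j) (mem_edgePairs.2 ⟨hlt, hij⟩)
    · exact (h (j, i) (mem_edgePairs.2 ⟨hlt, hij.symm⟩)).symm
  simp only [adjKernel, Finset.prod_boole, h]

theorem prod_mem_boole {ι : Type*} [Fintype ι] [DecidableEq β] (U : ι → Finset β) (φ : ι → β)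
    [Decidable (∀ i, φ i ∈ U i)] :
    ∏ i, (if φ i ∈ U i then (1 : ℝ) else 0) = if ∀ i, φ i ∈ U i then 1 else 0 := by
  rw [Finset.prod_boole]
  simp

theorem injective_of_mem_disjoint {ι : Type*} {U : ι → Finset β}
    (hU : Pairwise fun i j => Disjoint (U i) (U j)) {φ : ι → β} (hφ : ∀ i, φ i ∈ U i) :
    Function.Injective φ := by
  intro i j hij
  by_contra h
  exact Finset.disjoint_left.1 (hU h) (hφ i) (hij ▸ hφ j)

theorem labCount_eq_homSum {β : Type} [Fintype β] [DecidableEq β] (F : SimpleGraph (Fin m))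
    (G : SimpleGraph β) {U : Fin m → Finset β} (hU : Pairwise fun i j => Disjoint (U i) (U j)) :
    (labCount F G U : ℝ)
      = homSum (edgePairs F) (adjKernel G) (fun i x => if x ∈ U i then 1 else 0) := by
  classical
  have h1 : ∀ φ : Fin m → β, (Function.Injective φ ∧
      (∀ i j, F.Adj i j → G.Adj (φ i) (φ j)) ∧ ∀ i, φ i ∈ U i)
      ↔ ((∀ i j, F.Adj i j → G.Adj (φ i) (φ j)) ∧ ∀ i, φ i ∈ U i) := fun φ =>
    ⟨fun h => h.2, fun h => ⟨injective_of_mem_disjoint hU h.2, h⟩⟩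
  rw [labCount, Nat.card_eq_fintype_card, Fintype.card_subtype, homSum, ← Finset.sum_boole]
  refine Finset.sum_congr rfl fun φ _ => ?_
  rw [prod_adjKernel, prod_mem_boole, ite_zero_mul_ite_zero, one_mul]
  simp only [h1]

theorem abs_totalCount_sub_homSum_le {β : Type} [Fintype β] (F : SimpleGraph (Fin m))
    (G : SimpleGraph β) :
    |(totalCount F G : ℝ) - homSum (edgePairs F) (adjKernel G) (fun _ _ => 1)|
      * Fintype.card β ≤ (m : ℝ) ^ 2 * (Fintype.card β : ℝ) ^ m := by
  classical
  have h1 : |(totalCount F G : ℝ) - homSum (edgePairs F) (adjKernel G) (fun _ _ => 1)|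
      ≤ ∑ φ : Fin m → β, if Function.Injective φ then (0 : ℝ) else 1 := by
    rw [totalCount, Nat.card_eq_fintype_card, Fintype.card_subtype, homSum, ← Finset.sum_boole,
      ← Finset.sum_sub_distrib]
    refine (Finset.abs_sum_le_sum_abs _ _).trans (Finset.sum_le_sum fun φ _ => ?_)
    rw [prod_adjKernel, Finset.prod_const_one, mul_one]
    by_cases hφ : Function.Injective φ
    · simp [hφ]
    · simp only [hφ, false_and, if_false, zero_sub, abs_neg]
      split_ifs <;> norm_num
  have h2 := sum_not_injective_mul_card_le (Fin m) β
  rw [Fintype.card_fin] at h2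
  exact (mul_le_mul_of_nonneg_right h1 (Nat.cast_nonneg _)).trans h2

theorem sum_perm_homSum_sub_eq_formSum {ι : Type*} [Fintype ι] [DecidableEq ι] [Fintype β]
    (E : Finset (ι × ι)) (W : β → β → ℝ) (p : ℝ) (w : ι → β → ℝ) :
    ∑ σ : Equiv.Perm ι, homSum E W (fun i => w (σ i))
        - ((Fintype.card ι).factorial : ℝ) * (p ^ E.card * ∏ i, ∑ x, w i x)
      = formSum (fun φ => ∑ σ : Equiv.Perm ι,
          ((∏ e ∈ E, W (φ (σ e.1)) (φ (σ e.2))) - p ^ E.card)) w := by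
  have h1 : ∀ σ : Equiv.Perm ι, homSum E W (fun i => w (σ i)) - p ^ E.card * ∏ i, ∑ x, w i x
      = ∑ φ : ι → β, ((∏ e ∈ E, W (φ (σ e.1)) (φ (σ e.2))) - p ^ E.card) * ∏ i, w i (φ i) := by
    intro σ
    simp only [sub_mul, Finset.sum_sub_distrib, ← Finset.mul_sum, sum_prod_eq_prod_sum]
    congr 1
    unfold homSum
    refine (Fintype.sum_equiv (Equiv.arrowCongr σ.symm (Equiv.refl β)) _ _ fun φ => ?_).symm
    have h2 : (Equiv.arrowCongr σ.symm (Equiv.refl β)) φ = φ ∘ σ := rfl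
    rw [h2]
    congr 1
    exact (Equiv.prod_comp σ fun i => w i (φ i)).symm
  have h3 : ((Fintype.card ι).factorial : ℝ) * (p ^ E.card * ∏ i, ∑ x, w i x)
      = ∑ σ : Equiv.Perm ι, p ^ E.card * ∏ i, ∑ x, w i x := by
    rw [Finset.sum_const, Finset.card_univ, Fintype.card_perm, nsmul_eq_mul]
  rw [h3, ← Finset.sum_sub_distrib]
  simp only [h1, formSum]
  rw [Finset.sum_comm]
  exact Finset.sum_congr rfl fun φ _ => by rw [Finset.sum_mul]

theorem exists_symHomClose_of_symCount {m : ℕ} (F : SimpleGraph (Fin m)) (hm : 0 < m) {p : ℝ}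
    (hp0 : 0 ≤ p) (hp1 : p ≤ 1) {α : Fin m → ℝ} (hα : ∀ i, 0 < α i) (hsum : ∑ i, α i ≤ 1)
    (hne : α ≠ fun _ => 1 / (m : ℝ)) :
    ∃ C : ℝ, 0 < C ∧ ∀ (β : Type) [Fintype β] [Nonempty β] (G : SimpleGraph β) (η : ℝ),
      (∀ U : Fin m → Finset β, (Pairwise fun i j => Disjoint (U i) (U j)) →
        (∀ i, (U i).card = ⌊α i * (Fintype.card β : ℝ)⌋₊) →
        |symCount F G U - p ^ numEdges F * ∏ i, ((U i).card : ℝ)|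
          ≤ η * (Fintype.card β : ℝ) ^ m) →
      SymHomClose (edgePairs F) (adjKernel G) p
        (C * (η + 1 / √(Fintype.card β)) * (Fintype.card β : ℝ) ^ m) := by
  classical
  have : Nonempty (Fin m) := ⟨⟨0, hm⟩⟩
  obtain ⟨C, hC0, hC⟩ := exists_formSum_diag_le hα hsum (by simpa using hne)
  set B : ℝ := (m.factorial : ℝ) with hB
  have hB0 : 0 < B := by positivity
  set M : ℝ := (m : ℝ) ^ 2 + m * 2 with hM
  have hM1 : 1 ≤ M := by
    have : (1 : ℝ) ≤ m := by exact_mod_cast hm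
    nlinarith
  refine ⟨2 ^ m * (m : ℝ) ^ m * (C * (B * M)), by positivity, ?_⟩
  intro β _ _ G η hη
  set N : ℝ := (Fintype.card β : ℝ) with hN
  have hN1 : 1 ≤ N := Nat.one_le_cast.2 Fintype.card_pos
  have hN0 : 0 < N := by linarith
  set r := √N with hr
  have hr1 : 1 ≤ r := Real.one_le_sqrt.2 hN1
  have hrr : r * r = N := Real.mul_self_sqrt hN0.le
  set E := edgePairs F with hE
  set W := adjKernel G with hW
  set Φ : (Fin m → β) → ℝ := fun φ => ∑ σ : Equiv.Perm (Fin m),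
    ((∏ e ∈ E, W (φ (σ e.1)) (φ (σ e.2))) - p ^ E.card) with hΦ
  have hsym : ∀ (σ : Equiv.Perm (Fin m)) (φ : Fin m → β), Φ (φ ∘ σ) = Φ φ := by
    intro σ φ
    exact Equiv.sum_comp (Equiv.mulLeft σ) fun τ : Equiv.Perm (Fin m) =>
      ((∏ e ∈ E, W (φ (τ e.1)) (φ (τ e.2))) - p ^ E.card)
  have hbd : ∀ φ, |Φ φ| ≤ B := by
    intro φ
    refine (Finset.abs_sum_le_sum_abs _ _).trans ?_
    calc _ ≤ ∑ σ : Equiv.Perm (Fin m), (1 : ℝ) := by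
          refine Finset.sum_le_sum fun σ _ => ?_
          have a0 : 0 ≤ ∏ e ∈ E, W (φ (σ e.1)) (φ (σ e.2)) :=
            Finset.prod_nonneg fun e _ => adjKernel_nonneg G _ _
          have a1 : ∏ e ∈ E, W (φ (σ e.1)) (φ (σ e.2)) ≤ 1 :=
            Finset.prod_le_one (fun e _ => adjKernel_nonneg G _ _) fun e _ => adjKernel_le_one G _ _
          have b0 : 0 ≤ p ^ E.card := by positivity
          have b1 : p ^ E.card ≤ 1 := pow_le_one₀ hp0 hp1
          rw [abs_le]
          constructor <;> linarith
      _ = B := by simp [hB, Fintype.card_perm]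
  have hform := sum_perm_homSum_sub_eq_formSum E W p
  rw [Fintype.card_fin] at hform
  have hU : ∀ U : Fin m → Finset β, (Pairwise fun i j => Disjoint (U i) (U j)) →
      (∀ i, (U i).card = ⌊α i * N⌋₊) →
      |formSum Φ (fun i x => if x ∈ U i then 1 else 0)| ≤ B * η * N ^ m := by
    intro U hd hc
    have h1 : ∀ σ : Equiv.Perm (Fin m), homSum E W (fun i x => if x ∈ U (σ i) then 1 else 0)
        = labCount F G fun i => U (σ i) := fun σ =>
      (labCount_eq_homSum F G fun i j hij => hd (σ.injective.ne hij)).symm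
    have h2 : ∀ i, ∑ x, (if x ∈ U i then (1 : ℝ) else 0) = (U i).card := fun i => by simp
    rw [hΦ, ← hform]
    simp only [h1, h2]
    have h3 : ∑ σ : Equiv.Perm (Fin m), (labCount F G fun i => U (σ i) : ℝ)
        = B * symCount F G U := by
      rw [symCount, mul_inv_cancel_left₀ hB0.ne']
    rw [h3, ← mul_sub, abs_mul, abs_of_pos hB0, ← numEdges_eq_card, mul_assoc]
    exact mul_le_mul_of_nonneg_left (hη U hd hc) hB0.le
  have hfrac : ∀ u : Fin m → β → ℝ, (∀ i x, 0 ≤ u i x) → (∀ x, ∑ i, u i x ≤ 1) →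
      (∀ i, ∑ x, u i x = α i * Fintype.card β) →
      |formSum Φ u| ≤ B * M * (η + 1 / r) * N ^ m := by
    intro u hu0 hu1 hu
    have h1 := abs_formSum_mul_card_le (fun i => (hα i).le) hsum hbd hU hu0 hu1 hu
    rw [Fintype.card_fin, ← hN] at h1
    have hη0 : 0 ≤ B * η * N ^ m := by
      obtain ⟨U, h2, h3, -⟩ := exists_disjoint_of_card (ι := Fin m) (β := β)
        (n := fun i => ⌊α i * N⌋₊) (U := fun _ => ∅) (by
          have : ((∑ i, ⌊α i * N⌋₊ : ℕ) : ℝ) ≤ N := by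
            push_cast
            calc ∑ i, (⌊α i * N⌋₊ : ℝ) ≤ ∑ i, α i * N :=
                  Finset.sum_le_sum fun i _ => Nat.floor_le (mul_nonneg (hα i).le hN0.le)
              _ = (∑ i, α i) * N := by rw [Finset.sum_mul]
              _ ≤ N := mul_le_of_le_one_left hN0.le hsum
          exact Nat.cast_le.1 this) (fun i j _ => Finset.disjoint_empty_left _)
      exact (abs_nonneg _).trans (hU U h2 h3)
    have h2 : (m : ℝ) ^ 2 + m * (√N + 1) ≤ M * r := by
      rw [hM, ← hr]
      nlinarith [sq_nonneg (m : ℝ), (Nat.cast_nonneg m : (0 : ℝ) ≤ m)]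
    have h3 : B * N ^ m * ((m : ℝ) ^ 2 + m * (√N + 1)) ≤ B * N ^ m * (M * r) :=
      mul_le_mul_of_nonneg_left h2 (by positivity)
    have h4 : B * N ^ m * (M * r) = B * M * (1 / r) * N ^ m * N := by
      rw [← hrr]
      field_simp
    have h5 : B * η * N ^ m ≤ M * (B * η * N ^ m) := le_mul_of_one_le_left hη0 hM1
    have h6 : |formSum Φ u| * N ≤ (B * M * (η + 1 / r) * N ^ m) * N := by
      have := mul_le_mul_of_nonneg_right h5 hN0.le
      nlinarith
    exact le_of_mul_le_mul_right h6 hN0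
  intro w hw0 hw1
  rw [hform]
  have h1 := abs_formSum_le_of_diag hsym (hC β Φ hsym _ hfrac) hw0 hw1
  rw [Fintype.card_fin] at h1
  refine h1.trans (le_of_eq ?_)
  ring

end Counts

section Quasirandom

theorem abs_homSum_sub_le_of_cutBound {m : ℕ} {β : Type*} [Fintype β] {W : β → β → ℝ}
    (hW0 : ∀ x y, 0 ≤ W x y) (hW1 : ∀ x y, W x y ≤ 1) {w : Fin m → β → ℝ}
    (hw0 : ∀ i x, 0 ≤ w i x) (hw1 : ∀ i x, w i x ≤ 1) {p : ℝ} (hp0 : 0 ≤ p) (hp1 : p ≤ 1)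
    {c : ℝ} (hc : 0 ≤ c) {E : Finset (Fin m × Fin m)} (hE : ∀ e ∈ E, e.1 < e.2)
    (hK : CutBound (fun x y => W x y - p) 1 1 (c * (Fintype.card β : ℝ) ^ 2)) :
    |homSum E W w - p ^ E.card * ∏ i, ∑ x, w i x|
      ≤ E.card * c * (Fintype.card β : ℝ) ^ m := by
  have h := abs_homSum_sub_le hW0 hW1 hw0 (u := fun _ => 1) hw1 hp0 hp1 hc ∅ E
    (Finset.disjoint_empty_right _) hE (by simp) (fun e _ => by
      simpa [sq] using hK)
  have h0 : homSum ∅ W w = ∏ i, ∑ x, w i x := by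
    simp [homSum, sum_prod_eq_prod_sum]
  rw [Finset.union_empty, h0] at h
  refine h.trans (le_of_eq ?_)
  simp [mul_assoc]

theorem sq_sum_mul_le {ι : Type*} [Fintype ι] {f : ι → ℝ} (hf0 : ∀ x, 0 ≤ f x)
    (hf1 : ∀ x, f x ≤ 1) (h : ι → ℝ) :
    (∑ x, f x * h x) ^ 2 ≤ Fintype.card ι * ∑ x, h x ^ 2 := by
  refine (Finset.sum_mul_sq_le_sq_mul_sq univ f h).trans ?_
  refine mul_le_mul_of_nonneg_right ?_ (Finset.sum_nonneg fun x _ => sq_nonneg _)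
  calc ∑ x, f x ^ 2 ≤ ∑ _x : ι, (1 : ℝ) :=
        Finset.sum_le_sum fun x _ => pow_le_one₀ (hf0 x) (hf1 x)
    _ = Fintype.card ι := by simp

theorem sum_fin_succ_arrow {β : Type*} [Fintype β] {n : ℕ} (H : (Fin (n + 1) → β) → ℝ) :
    ∑ φ, H φ = ∑ x, ∑ φ, H (Fin.cons x φ) := by
  rw [← Fintype.sum_prod_type']
  exact (Equiv.sum_comp (Fin.consEquiv fun _ => β) H).symm

/-- The edges of the four-cycle `0 - 2 - 1 - 3 - 0`. -/
def fourCycle : Finset (Fin 4 × Fin 4) := {(0, 2), (0, 3), (1, 2), (1, 3)}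

theorem homSum_fourCycle {β : Type*} [Fintype β] (K : β → β → ℝ) :
    homSum fourCycle K (fun _ _ => 1) = ∑ y, ∑ y', (∑ x, K x y * K x y') ^ 2 := by
  have h : ∀ φ : Fin 4 → β, ∏ e ∈ fourCycle, K (φ e.1) (φ e.2)
      = K (φ 0) (φ 2) * (K (φ 0) (φ 3) * (K (φ 1) (φ 2) * K (φ 1) (φ 3))) := by
    intro φ
    rw [fourCycle, Finset.prod_insert (by decide), Finset.prod_insert (by decide),
      Finset.prod_insert (by decide), Finset.prod_singleton]
  simp only [homSum, h, Finset.prod_const_one, mul_one]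
  simp only [sum_fin_succ_arrow, Finset.univ_unique, Finset.sum_singleton]
  simp only [sq, Finset.sum_mul_sum]
  have e1 : ∀ H : β → β → β → β → ℝ, ∑ x, ∑ x', ∑ y, ∑ y', H x x' y y'
      = ∑ y, ∑ y', ∑ x, ∑ x', H x x' y y' := by
    intro H
    calc _ = ∑ x, ∑ y, ∑ x', ∑ y', H x x' y y' :=
          Finset.sum_congr rfl fun x _ => Finset.sum_comm
      _ = ∑ y, ∑ x, ∑ x', ∑ y', H x x' y y' := Finset.sum_comm
      _ = ∑ y, ∑ x, ∑ y', ∑ x', H x x' y y' :=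
          Finset.sum_congr rfl fun y _ => Finset.sum_congr rfl fun x _ => Finset.sum_comm
      _ = _ := Finset.sum_congr rfl fun y _ => Finset.sum_comm
  refine Eq.trans ?_ (e1 fun x x' y y' => K x y * K x y' * (K x' y * K x' y'))
  refine Finset.sum_congr rfl fun x _ => Finset.sum_congr rfl fun x' _ =>
    Finset.sum_congr rfl fun y _ => Finset.sum_congr rfl fun y' _ => ?_
  exact (mul_assoc _ _ _).symm

theorem bilSum_pow_four_le {β : Type*} [Fintype β] (K : β → β → ℝ) {f g : β → ℝ}
    (hf0 : ∀ x, 0 ≤ f x) (hf1 : ∀ x, f x ≤ 1) (hg0 : ∀ x, 0 ≤ g x) (hg1 : ∀ x, g x ≤ 1) :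
    bilSum K f g ^ 4 ≤ (Fintype.card β : ℝ) ^ 4 * homSum fourCycle K (fun _ _ => 1) := by
  set N : ℝ := (Fintype.card β : ℝ) with hN
  set Q : ℝ := ∑ x, (∑ y, g y * K x y) ^ 2 with hQ
  have h1 : bilSum K f g ^ 2 ≤ N * Q := by
    have e1 : bilSum K f g = ∑ x, f x * ∑ y, g y * K x y := by
      unfold bilSum
      refine Finset.sum_congr rfl fun x _ => ?_
      rw [Finset.mul_sum]
      exact Finset.sum_congr rfl fun y _ => by ring
    rw [e1]
    exact sq_sum_mul_le hf0 hf1 _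
  have h2 : Q = ∑ z : β × β, (g z.1 * g z.2) * ∑ x, K x z.1 * K x z.2 := by
    rw [Fintype.sum_prod_type, hQ]
    simp only [sq, Finset.sum_mul_sum]
    simp only [Finset.mul_sum]
    rw [Finset.sum_comm]
    refine Finset.sum_congr rfl fun y _ => ?_
    rw [Finset.sum_comm]
    exact Finset.sum_congr rfl fun y' _ => Finset.sum_congr rfl fun x _ => by ring
  have h3 : Q ^ 2 ≤ N ^ 2 * homSum fourCycle K (fun _ _ => 1) := by
    rw [h2, homSum_fourCycle, ← Fintype.sum_prod_type' (f := fun y y' => (∑ x, K x y * K x y') ^ 2)]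
    have := sq_sum_mul_le (f := fun z : β × β => g z.1 * g z.2)
      (fun z => mul_nonneg (hg0 _) (hg0 _)) (fun z => mul_le_one₀ (hg1 _) (hg0 _) (hg1 _))
      fun z => ∑ x, K x z.1 * K x z.2
    rwa [Fintype.card_prod, Nat.cast_mul, ← sq] at this
  calc bilSum K f g ^ 4 = (bilSum K f g ^ 2) ^ 2 := by ring
    _ ≤ (N * Q) ^ 2 := by gcongr
    _ = N ^ 2 * Q ^ 2 := by ring
    _ ≤ N ^ 2 * (N ^ 2 * homSum fourCycle K (fun _ _ => 1)) := by gcongr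
    _ = _ := by ring

theorem homSum_sub_const {ι β : Type*} [Fintype ι] [DecidableEq ι] [Fintype β]
    (E : Finset (ι × ι)) (W : β → β → ℝ) (p : ℝ) (w : ι → β → ℝ) :
    homSum E (fun x y => W x y - p) w
      = ∑ S ∈ E.powerset, (-p) ^ (E \ S).card * homSum S W w := by
  simp only [homSum, sub_eq_add_neg, Finset.prod_add, Finset.prod_const, Finset.mul_sum,
    Finset.sum_mul]
  rw [Finset.sum_comm]
  exact Finset.sum_congr rfl fun S _ => Finset.sum_congr rfl fun φ _ => by ring

theorem abs_homSum_sub_const_le {ι β : Type*} [Fintype ι] [DecidableEq ι] [Fintype β]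
    {E : Finset (ι × ι)} (hE : E.Nonempty) {W : β → β → ℝ} {p : ℝ} (hp0 : 0 ≤ p) (hp1 : p ≤ 1)
    {w : ι → β → ℝ} {M c : ℝ} (h : ∀ S ⊆ E, |homSum S W w - p ^ S.card * M| ≤ c) :
    |homSum E (fun x y => W x y - p) w| ≤ 2 ^ E.card * c := by
  have h0 : ∑ S ∈ E.powerset, (-p) ^ (E \ S).card * (p ^ S.card * M) = 0 := by
    have h1 := Finset.prod_add (fun _ => p) (fun _ => -p) E
    simp only [Finset.prod_const, add_neg_cancel] at h1
    rw [zero_pow hE.card_pos.ne'] at h1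
    have h2 : (∑ S ∈ E.powerset, p ^ S.card * (-p) ^ (E \ S).card) * M
        = ∑ S ∈ E.powerset, (-p) ^ (E \ S).card * (p ^ S.card * M) := by
      rw [Finset.sum_mul]
      exact Finset.sum_congr rfl fun S _ => by ring
    rw [← h2, ← h1, zero_mul]
  rw [homSum_sub_const, ← sub_zero (∑ S ∈ E.powerset, _), ← h0, ← Finset.sum_sub_distrib]
  refine (Finset.abs_sum_le_sum_abs _ _).trans ?_
  calc _ ≤ ∑ S ∈ E.powerset, c := by
        refine Finset.sum_le_sum fun S hS => ?_
        rw [← mul_sub, abs_mul]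
        refine (mul_le_of_le_one_left (abs_nonneg _) ?_).trans (h S (Finset.mem_powerset.1 hS))
        rw [abs_pow, abs_neg, abs_of_nonneg hp0]
        exact pow_le_one₀ hp0 hp1
    _ = 2 ^ E.card * c := by simp [Finset.card_powerset]

theorem exists_edgePairs_eq {m : ℕ} {E : Finset (Fin m × Fin m)} (hE : ∀ e ∈ E, e.1 < e.2) :
    ∃ F : SimpleGraph (Fin m), edgePairs F = E := by
  refine ⟨SimpleGraph.fromRel fun a b => (a, b) ∈ E, ?_⟩
  ext ⟨a, b⟩
  simp only [mem_edgePairs, SimpleGraph.fromRel_adj]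
  constructor
  · rintro ⟨hab, -, h | h⟩
    · exact h
    · exact absurd (hE _ h) hab.asymm
  · exact fun h => ⟨hE _ h, (hE _ h).ne, Or.inl h⟩

variable {p : ℝ} {V : ℕ → ℕ} {G : ∀ n, SimpleGraph (Fin (V n))}

theorem IsQuasirandom.eventually_homSum (hV : Tendsto V atTop atTop) (h : IsQuasirandom p V G)
    {m : ℕ} {E : Finset (Fin m × Fin m)} (hE : ∀ e ∈ E, e.1 < e.2) {δ : ℝ} (hδ : 0 < δ) :
    ∀ᶠ n in atTop, |homSum E (adjKernel (G n)) (fun _ _ => 1) - p ^ E.card * (V n : ℝ) ^ m|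
      ≤ δ * (V n : ℝ) ^ m := by
  obtain ⟨F, rfl⟩ := exists_edgePairs_eq hE
  have h1 := (isLittleO_iff.1 (h m F)) (half_pos hδ)
  obtain ⟨N₀, hN₀⟩ := exists_nat_ge (2 * (m : ℝ) ^ 2 / δ)
  filter_upwards [h1, hV.eventually_ge_atTop (N₀ + 1)] with n hn hVn
  rw [Real.norm_eq_abs, Real.norm_eq_abs, abs_of_nonneg (a := (V n : ℝ) ^ m) (by positivity),
    numEdges_eq_card] at hn
  have h2 := abs_totalCount_sub_homSum_le F (G n)
  rw [Fintype.card_fin] at h2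
  set N : ℝ := (V n : ℝ) with hN
  have hN0 : 2 * (m : ℝ) ^ 2 / δ ≤ N :=
    hN₀.trans (by rw [hN]; exact_mod_cast (Nat.le_succ _).trans hVn)
  have hNpos : 0 < N := by rw [hN]; exact_mod_cast (Nat.succ_pos _).trans_le hVn
  have h3 : (m : ℝ) ^ 2 * N ^ m ≤ (δ / 2 * N ^ m) * N := by
    rw [div_le_iff₀ hδ] at hN0
    have : (m : ℝ) ^ 2 ≤ δ / 2 * N := by linarith
    calc (m : ℝ) ^ 2 * N ^ m ≤ (δ / 2 * N) * N ^ m := by gcongr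
      _ = _ := by ring
  have h4 := le_of_mul_le_mul_right (h2.trans h3) hNpos
  rw [abs_sub_comm] at h4
  have h5 := abs_add_le (homSum (edgePairs F) (adjKernel (G n)) (fun _ _ => 1) - totalCount F (G n))
    (totalCount F (G n) - p ^ (edgePairs F).card * N ^ m)
  rw [sub_add_sub_cancel] at h5
  linarith

/-- The adjacency kernels of the sequence converge to the constant `p` in cut norm. -/
def CutConverges (p : ℝ) (V : ℕ → ℕ) (G : ∀ n, SimpleGraph (Fin (V n))) : Prop :=
  ∀ ε : ℝ, 0 < ε → ∀ᶠ n in atTop,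
    CutBound (fun x y => adjKernel (G n) x y - p) 1 1 (ε * (V n : ℝ) ^ 2)

theorem IsQuasirandom.cutConverges (hp0 : 0 ≤ p) (hp1 : p ≤ 1) (hV : Tendsto V atTop atTop)
    (h : IsQuasirandom p V G) : CutConverges p V G := by
  intro ε hε
  have hC : ∀ e ∈ fourCycle, e.1 < e.2 := by decide
  have h1 : ∀ᶠ n in atTop, ∀ S ∈ fourCycle.powerset,
      |homSum S (adjKernel (G n)) (fun _ _ => 1) - p ^ S.card * (V n : ℝ) ^ 4|
        ≤ ε ^ 4 / 16 * (V n : ℝ) ^ 4 :=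
    (Filter.eventually_all_finset _).2 fun S hS =>
      h.eventually_homSum hV (fun e he => hC e (Finset.mem_powerset.1 hS he)) (by positivity)
  filter_upwards [h1] with n hn f g hf0 hf1 hg0 hg1
  have h2 := abs_homSum_sub_const_le (E := fourCycle) ⟨(0, 2), by decide⟩ hp0 hp1
    fun S hS => hn S (Finset.mem_powerset.2 hS)
  have h3 := bilSum_pow_four_le (fun x y => adjKernel (G n) x y - p) hf0 hf1 hg0 hg1
  rw [Fintype.card_fin] at h3
  have hcard : fourCycle.card = 4 := by decide
  rw [hcard] at h2
  set T := homSum fourCycle (fun x y => adjKernel (G n) x y - p) (fun _ _ => 1)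
  have h4 : |bilSum (fun x y => adjKernel (G n) x y - p) f g| ^ 4 ≤ (ε * (V n : ℝ) ^ 2) ^ 4 := by
    rw [Even.pow_abs (by decide)]
    calc _ ≤ (V n : ℝ) ^ 4 * T := h3
      _ ≤ (V n : ℝ) ^ 4 * (2 ^ 4 * (ε ^ 4 / 16 * (V n : ℝ) ^ 4)) := by
          gcongr
          exact (le_abs_self _).trans h2
      _ = _ := by ring
  exact le_of_pow_le_pow_left₀ (by norm_num) (by positivity) h4

theorem CutConverges.isQuasirandom (hp0 : 0 ≤ p) (hp1 : p ≤ 1) (hV : Tendsto V atTop atTop)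
    (h : CutConverges p V G) : IsQuasirandom p V G := by
  intro m F
  rw [isLittleO_iff]
  intro c hc
  obtain ⟨N₀, hN₀⟩ := exists_nat_ge (2 * (m : ℝ) ^ 2 / c)
  set k : ℝ := ((edgePairs F).card : ℝ) with hk
  have hk0 : 0 ≤ k := Nat.cast_nonneg _
  filter_upwards [h (c / (2 * (k + 1))) (by positivity), hV.eventually_ge_atTop (N₀ + 1)]
    with n hn hVn
  rw [Real.norm_eq_abs, Real.norm_eq_abs, abs_of_nonneg (a := (V n : ℝ) ^ m) (by positivity),
    numEdges_eq_card]
  have h2 := abs_totalCount_sub_homSum_le F (G n)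
  have h1 := abs_homSum_sub_le_of_cutBound (W := adjKernel (G n)) (adjKernel_nonneg _)
    (adjKernel_le_one _) (w := fun _ _ => 1) (fun _ _ => zero_le_one) (fun _ _ => le_rfl) hp0 hp1
    (c := c / (2 * (k + 1))) (by positivity) (E := edgePairs F)
    (fun e he => (mem_edgePairs.1 he).1) (by rwa [Fintype.card_fin])
  simp only [Finset.sum_const, Finset.card_univ, Fintype.card_fin, Finset.prod_const, nsmul_eq_mul,
    mul_one] at h1
  rw [Fintype.card_fin] at h2
  set N : ℝ := (V n : ℝ) with hN
  have hN0 : 2 * (m : ℝ) ^ 2 / c ≤ N :=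
    hN₀.trans (by rw [hN]; exact_mod_cast (Nat.le_succ _).trans hVn)
  have hNpos : 0 < N := by rw [hN]; exact_mod_cast (Nat.succ_pos _).trans_le hVn
  have h3 : (m : ℝ) ^ 2 * N ^ m ≤ (c / 2 * N ^ m) * N := by
    rw [div_le_iff₀ hc] at hN0
    have : (m : ℝ) ^ 2 ≤ c / 2 * N := by linarith
    calc (m : ℝ) ^ 2 * N ^ m ≤ (c / 2 * N) * N ^ m := by gcongr
      _ = _ := by ring
  have h4 := le_of_mul_le_mul_right (h2.trans h3) hNpos
  have h5 := abs_add_le (totalCount F (G n) - homSum (edgePairs F) (adjKernel (G n)) (fun _ _ => 1))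
    (homSum (edgePairs F) (adjKernel (G n)) (fun _ _ => 1) - p ^ (edgePairs F).card * N ^ m)
  rw [sub_add_sub_cancel] at h5
  have h6 : k * (c / (2 * (k + 1))) ≤ c / 2 := by
    rw [mul_div_assoc', div_le_div_iff₀ (by positivity) two_pos]
    nlinarith
  have h7 : k * (c / (2 * (k + 1))) * N ^ m ≤ c / 2 * N ^ m := by gcongr
  linarith

theorem CutConverges.exists_rate (hp0 : 0 ≤ p) (hp1 : p ≤ 1) (h : CutConverges p V G) :
    ∃ ε : ℕ → ℝ, Tendsto ε atTop (nhds 0) ∧ (∀ n, 0 ≤ ε n) ∧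
      ∀ n, CutBound (fun x y => adjKernel (G n) x y - p) 1 1 (ε n * (V n : ℝ) ^ 2) := by
  set S : ℕ → Set ℝ := fun n =>
    {c | 0 ≤ c ∧ CutBound (fun x y => adjKernel (G n) x y - p) 1 1 (c * (V n : ℝ) ^ 2)} with hS
  have hne : ∀ n, (S n).Nonempty := by
    refine fun n => ⟨1, zero_le_one, fun f g hf0 hf1 hg0 hg1 => ?_⟩
    unfold bilSum
    calc _ ≤ ∑ x, ∑ y, |f x * (adjKernel (G n) x y - p) * g y| :=
          (Finset.abs_sum_le_sum_abs _ _).trans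
            (Finset.sum_le_sum fun x _ => Finset.abs_sum_le_sum_abs _ _)
      _ ≤ ∑ _x : Fin (V n), ∑ _y : Fin (V n), (1 : ℝ) := by
          refine Finset.sum_le_sum fun x _ => Finset.sum_le_sum fun y _ => ?_
          have a1 : |adjKernel (G n) x y - p| ≤ 1 := by
            have := adjKernel_nonneg (G n) x y
            have := adjKernel_le_one (G n) x y
            rw [abs_le]
            constructor <;> linarith
          rw [abs_mul, abs_mul, abs_of_nonneg (hf0 x), abs_of_nonneg (hg0 y)]
          exact mul_le_one₀ (mul_le_one₀ (hf1 x) (abs_nonneg _) a1) (hg0 y) (hg1 y)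
      _ = 1 * (V n : ℝ) ^ 2 := by simp [sq]
  have hbdd : ∀ n, BddBelow (S n) := fun n => ⟨0, fun c hc => hc.1⟩
  have hex : ∀ n : ℕ, ∃ c ∈ S n, c < sInf (S n) + 1 / ((n : ℝ) + 1) := fun n =>
    exists_lt_of_csInf_lt (hne n) (lt_add_of_pos_right _ (by positivity))
  choose ε hε hlt using hex
  refine ⟨ε, ?_, fun n => (hε n).1, fun n => (hε n).2⟩
  rw [Metric.tendsto_nhds]
  intro d hd
  have h1 := (tendsto_one_div_add_atTop_nhds_zero_nat (𝕜 := ℝ)).eventually_lt_const (half_pos hd)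
  filter_upwards [h (d / 2) (half_pos hd), h1] with n hn hn1
  have h2 : sInf (S n) ≤ d / 2 := csInf_le (hbdd n) ⟨(half_pos hd).le, hn⟩
  have h3 := hlt n
  rw [Real.dist_eq, sub_zero, abs_of_nonneg (hε n).1]
  linarith

theorem CutConverges.satisfiesP {m : ℕ} (F : SimpleGraph (Fin m)) (hp0 : 0 ≤ p) (hp1 : p ≤ 1)
    (α : Fin m → ℝ) (h : CutConverges p V G) : SatisfiesP F p α V G := by
  obtain ⟨ε, hε, hε0, hc⟩ := h.exists_rate hp0 hp1
  refine ⟨fun n => numEdges F * ε n, ?_, fun n U hU _ => ?_⟩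
  · simpa using hε.const_mul (numEdges F : ℝ)
  · have h1 := abs_homSum_sub_le_of_cutBound (W := adjKernel (G n)) (adjKernel_nonneg _)
      (adjKernel_le_one _) (w := fun i x => if x ∈ U i then 1 else 0)
      (fun i x => by split_ifs <;> norm_num) (fun i x => by split_ifs <;> norm_num) hp0 hp1
      (hε0 n) (E := edgePairs F) (fun e he => (mem_edgePairs.1 he).1)
      (by rw [Fintype.card_fin]; exact hc n)
    have h2 : ∀ i, ∑ x, (if x ∈ U i then (1 : ℝ) else 0) = (U i).card := fun i => by simp
    rw [← labCount_eq_homSum F (G n) hU, Fintype.card_fin, ← numEdges_eq_card] at h1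
    simp only [h2] at h1
    exact h1

theorem labCount_comp_perm {m : ℕ} {β : Type} [Fintype β] (F : SimpleGraph (Fin m))
    (G : SimpleGraph β) (U : Fin m → Finset β) (σ : Equiv.Perm (Fin m)) :
    labCount F G (fun i => U (σ i)) = labCount (F.map σ.toEmbedding) G U := by
  refine Nat.card_congr (Equiv.subtypeEquiv (Equiv.arrowCongr σ (Equiv.refl β)) fun φ => ?_)
  have h1 : (Equiv.arrowCongr σ (Equiv.refl β)) φ = φ ∘ σ.symm := rfl
  rw [h1]
  refine and_congr ?_ (and_congr ?_ ?_)
  · exact (σ.symm.injective_comp φ).symm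
  · constructor
    · rintro h _ _ ⟨-, a, b, hab, rfl, rfl⟩
      simpa using h a b hab
    · intro h i j hij
      simpa using h (σ i) (σ j) ⟨σ.injective.ne hij.ne, i, j, hij, rfl, rfl⟩
  · rw [← σ.forall_congr_right (q := fun i => (φ ∘ σ.symm) i ∈ U i)]
    simp

theorem numEdges_map {m : ℕ} (F : SimpleGraph (Fin m)) (σ : Equiv.Perm (Fin m)) :
    numEdges (F.map σ.toEmbedding) = numEdges F :=
  (Nat.card_congr (SimpleGraph.Iso.map σ F).mapEdgeSet).symm

theorem SatisfiesPu.satisfiesPt {m : ℕ} {F : SimpleGraph (Fin m)} {α : Fin m → ℝ}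
    (h : SatisfiesPu F p α V G) : SatisfiesPt F p α V G := by
  choose ε hε hc using h
  refine ⟨fun n => ((m.factorial : ℝ))⁻¹ * ∑ σ, ε σ n, ?_, fun n U hU hUc => ?_⟩
  · simpa using (tendsto_finsetSum univ fun σ _ => hε σ).const_mul ((m.factorial : ℝ))⁻¹
  · have hm : (0 : ℝ) < m.factorial := by positivity
    have h1 : symCount F (G n) U - p ^ numEdges F * ∏ i, ((U i).card : ℝ)
        = ((m.factorial : ℝ))⁻¹ * ∑ σ : Equiv.Perm (Fin m),
          ((labCount (F.map σ.toEmbedding) (G n) U : ℝ)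
            - p ^ numEdges (F.map σ.toEmbedding) * ∏ i, ((U i).card : ℝ)) := by
      simp only [symCount, numEdges_map, labCount_comp_perm, Finset.sum_sub_distrib, mul_sub,
        Finset.sum_const, Finset.card_univ, Fintype.card_perm, Fintype.card_fin, nsmul_eq_mul]
      rw [inv_mul_cancel_left₀ hm.ne']
    rw [h1, abs_mul, abs_of_pos (inv_pos.2 hm), mul_assoc]
    refine mul_le_mul_of_nonneg_left ?_ (inv_pos.2 hm).le
    rw [Finset.sum_mul]
    exact (Finset.abs_sum_le_sum_abs _ _).trans (Finset.sum_le_sum fun σ _ => hc σ n U hU hUc)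

theorem SatisfiesPt.cutConverges {m : ℕ} {F : SimpleGraph (Fin m)} (hF : 0 < numEdges F)
    (hp0 : 0 < p) (hp1 : p ≤ 1) {α : Fin m → ℝ} (hα : ∀ i, 0 < α i) (hsum : ∑ i, α i ≤ 1)
    (hne : α ≠ fun _ => 1 / (m : ℝ)) (hV : Tendsto V atTop atTop) (h : SatisfiesPt F p α V G) :
    CutConverges p V G := by
  intro ε hε
  rw [numEdges_eq_card] at hF
  have hE := Finset.card_pos.1 hF
  have hm : 0 < m := by
    obtain ⟨e, -⟩ := hE
    exact e.1.pos
  obtain ⟨η, hη, hc⟩ := h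
  obtain ⟨C, hC0, hC⟩ := exists_symHomClose_of_symCount F hm hp0.le hp1 hα hsum hne
  obtain ⟨δ, hδ, hcut⟩ := exists_cutBound_of_symHomClose (E := edgePairs F)
    (fun e he => (mem_edgePairs.1 he).1) hE hp0 hp1 hε
  have hlim : Tendsto (fun n => C * (η n + 1 / √(V n : ℝ))) atTop (nhds 0) := by
    have h1 : Tendsto (fun n => √(V n : ℝ)) atTop atTop :=
      Real.tendsto_sqrt_atTop.comp (tendsto_natCast_atTop_atTop.comp hV)
    have h2 : Tendsto (fun n => 1 / √(V n : ℝ)) atTop (nhds 0) := by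
      simp only [one_div]
      exact h1.inv_tendsto_atTop
    simpa using (hη.add h2).const_mul C
  filter_upwards [hlim.eventually_le_const hδ, hV.eventually_gt_atTop 0] with n hn hVn
  have : Nonempty (Fin (V n)) := ⟨⟨0, hVn⟩⟩
  have h1 := hC (Fin (V n)) (G n) (η n) (by
    rw [Fintype.card_fin]
    exact hc n)
  have h2 := hcut (Fin (V n)) (adjKernel (G n)) (adjKernel_symm _) (adjKernel_nonneg _)
    (adjKernel_le_one _) (fun w hw0 hw1 => (h1 w hw0 hw1).trans (by
      rw [Fintype.card_fin]
      gcongr))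
  rwa [Fintype.card_fin] at h2

end Quasirandom

/-- **Theorem A (i).** If `e(F) > 0`, `0 < p ≤ 1`, the `α_i` are positive with
`∑ α_i ≤ 1` and `(α₁,…,α_m) ≠ (1/m,…,1/m)`, then `P̃(F;α)` and the stronger
`Pᵘ(F;α)` are `p`-quasi-random properties. -/
theorem stmt0 {m : ℕ} (F : SimpleGraph (Fin m)) (hF : 0 < numEdges F)
    (p : ℝ) (hp0 : 0 < p) (hp1 : p ≤ 1)
    (α : Fin m → ℝ) (hα : ∀ i, 0 < α i) (hsum : ∑ i, α i ≤ 1)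
    (hne : α ≠ fun _ => 1 / (m : ℝ)) :
    ∀ (V : ℕ → ℕ) (G : ∀ n, SimpleGraph (Fin (V n))), Tendsto V atTop atTop →
      ((SatisfiesPt F p α V G ↔ IsQuasirandom p V G) ∧
        (SatisfiesPu F p α V G ↔ IsQuasirandom p V G)) := by
  intro V G hV
  have h1 : SatisfiesPt F p α V G → IsQuasirandom p V G := fun h =>
    (h.cutConverges hF hp0 hp1 hα hsum hne hV).isQuasirandom hp0.le hp1 hV
  have h2 : IsQuasirandom p V G → SatisfiesPu F p α V G := fun h σ =>
    (h.cutConverges hp0.le hp1 hV).satisfiesP _ hp0.le hp1 α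
  exact ⟨⟨h1, fun h => (h2 h).satisfiesPt⟩, ⟨fun h => h1 h.satisfiesPt, h2⟩⟩
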